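/- Let d ≥ 1 and let f_d ∈ ℂ[x,y,z] be a homogeneous polynomial of degree d which is irreducible, such that every singular point of the projective plane curve C = {f_d = 0} ⊂ ℙ² is an ordinary node (i.e. at each singular point, in an affine coordinate chart containing it, the dehomogenized polynomial has vanishing gradient and invertible 2×2 Hessian at that point). Then the affine hypersurface F = {(x,y,z) ∈ ℂ³ : f_d(x,y,z) = 1}, with the subspace topology from ℂ³, is simply connected. -/

import Mathlib

open MvPolynomial

/-- The inclusion of the index set `{0,1}` of affine coordinates of the chart `{x_k ≠ 0}` of `ℙ²`
into `{0,1,2}`, skipping `k`. -/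
def chartIncl (k : Fin 3) (j : Fin 2) : Fin 3 :=
  if (j : ℕ) < (k : ℕ) then ⟨j, by have := j.isLt; omega⟩
  else ⟨(j : ℕ) + 1, by have := j.isLt; omega⟩

/-- The dehomogenization of `F ∈ ℂ[x₀,x₁,x₂]` in the affine coordinate chart `{x_k ≠ 0}`:
substitute `1` for the variable `x_k` and relabel the remaining two variables as `u₀, u₁`. -/
noncomputable def dehom (k : Fin 3) (F : MvPolynomial (Fin 3) ℂ) : MvPolynomial (Fin 2) ℂ :=
  aeval (fun i : Fin 3 =>
    if i = k then 1
    else if h : (i : ℕ) < (k : ℕ) then X ⟨(i : ℕ), by have := k.isLt; omega⟩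
    else X ⟨(i : ℕ) - 1, by have := i.isLt; omega⟩) F

/-- The projective point represented by `p ≠ 0` is an ordinary node of the projective curve
`{F = 0}`: in an affine coordinate chart containing it, the dehomogenized polynomial has
vanishing gradient and invertible 2×2 Hessian at the corresponding affine point. -/
noncomputable def IsOrdinaryNodeAt (F : MvPolynomial (Fin 3) ℂ) (p : Fin 3 → ℂ) : Prop :=
  ∃ k : Fin 3, p k ≠ 0 ∧
    (fun q : Fin 2 → ℂ =>
      (∀ j, eval q (pderiv j (dehom k F)) = 0) ∧
      Matrix.det !![eval q (pderiv 0 (pderiv 0 (dehom k F))),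
          eval q (pderiv 1 (pderiv 0 (dehom k F)));
          eval q (pderiv 0 (pderiv 1 (dehom k F))),
          eval q (pderiv 1 (pderiv 1 (dehom k F)))] ≠ 0)
      (fun j => p (chartIncl k j) / p k)

open Set Filter Topology unitInterval

namespace MilnorNodal

/-- Homotopy classes of paths relative to endpoints. -/
abbrev PC {X : Type*} [TopologicalSpace X] (x y : X) := Path.Homotopic.Quotient x y

notation:70 lhs:70 " ⬝ " rhs:71 => Path.Homotopic.Quotient.trans lhs rhs

/-- The homotopy class of a path. -/
abbrev cls {X : Type*} [TopologicalSpace X] {x y : X} (γ : Path x y) : PC x y :=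
  Path.Homotopic.Quotient.mk γ

section Basic

variable {X : Type*} [TopologicalSpace X]

lemma cls_eq {x y : X} {γ δ : Path x y} : cls γ = cls δ ↔ γ.Homotopic δ :=
  Path.Homotopic.Quotient.eq

lemma PC.exists_rep {x y : X} (a : PC x y) : ∃ γ : Path x y, cls γ = a := by
  induction a using Path.Homotopic.Quotient.ind with | mk γ => exact ⟨γ, rfl⟩

lemma cls_trans {x y z : X} (γ : Path x y) (δ : Path y z) :
    cls (γ.trans δ) = cls γ ⬝ cls δ := rfl

lemma cls_symm {x y : X} (γ : Path x y) : cls γ.symm = (cls γ).symm := rfl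

lemma cls_refl (x : X) : cls (Path.refl x) = Path.Homotopic.Quotient.refl x := rfl

@[simp] lemma PC.symm_trans_cancel {x y z : X} (a : PC x y) (b : PC y z) :
    a.symm ⬝ (a ⬝ b) = b := by
  rw [← Path.Homotopic.Quotient.trans_assoc]; simp

@[simp] lemma PC.trans_symm_cancel {x y z : X} (a : PC y x) (b : PC y z) :
    a ⬝ (a.symm ⬝ b) = b := by
  rw [← Path.Homotopic.Quotient.trans_assoc]; simp

@[simp] lemma PC.symm_symm {x y : X} (a : PC x y) : a.symm.symm = a := by
  obtain ⟨γ, rfl⟩ := a.exists_rep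
  rw [← cls_symm, ← cls_symm, Path.symm_symm]

lemma PC.trans_left_cancel {x y z : X} {a : PC x y} {b c : PC y z} (h : a ⬝ b = a ⬝ c) :
    b = c := by
  have := congrArg (fun t => a.symm ⬝ t) h
  simpa using this

lemma PC.trans_right_cancel {x y z : X} {b c : PC x y} {a : PC y z} (h : b ⬝ a = c ⬝ a) :
    b = c := by
  have := congrArg (fun t => t ⬝ a.symm) h
  simpa using this

@[simp] lemma PC.symm_trans {x y z : X} (a : PC x y) (b : PC y z) :
    (a ⬝ b).symm = b.symm ⬝ a.symm := by
  apply PC.trans_left_cancel (a := a ⬝ b)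
  simp

section Map
variable {Y : Type*} [TopologicalSpace Y] (f : C(X, Y))

@[simp] lemma PC.map_trans {x y z : X} (a : PC x y) (b : PC y z) :
    (a ⬝ b).map f = a.map f ⬝ b.map f := by
  obtain ⟨γ, rfl⟩ := a.exists_rep
  obtain ⟨δ, rfl⟩ := b.exists_rep
  exact congrArg cls (Path.map_trans γ δ f.continuous)

@[simp] lemma PC.map_symm {x y : X} (a : PC x y) : (a.symm).map f = (a.map f).symm := by
  obtain ⟨γ, rfl⟩ := a.exists_rep
  rfl

@[simp] lemma PC.map_refl (x : X) :
    (Path.Homotopic.Quotient.refl x).map f = Path.Homotopic.Quotient.refl (f x) := rfl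

lemma PC.map_cls {x y : X} (γ : Path x y) : (cls γ).map f = cls (γ.map f.continuous) := rfl

end Map

/-- A property of homotopy classes of paths which is stable under concatenation and holds for
all sufficiently small paths holds for every path. -/
theorem PC.induction_local (C : ∀ {x y : X}, PC x y → Prop)
    (htrans : ∀ {x y z : X} (a : PC x y) (b : PC y z), C a → C b → C (a ⬝ b))
    (hloc : ∀ x : X, ∃ U ∈ 𝓝 x, ∀ {y z : X} (γ : Path y z), range γ ⊆ U → C (cls γ))
    {x y : X} (a : PC x y) : C a := by
  obtain ⟨γ, rfl⟩ := a.exists_rep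
  choose U hU hC using hloc
  obtain ⟨t, ht0, htmono, ⟨N, hN⟩, htU⟩ := exists_monotone_Icc_subset_open_cover_unitInterval
    (c := fun x : X => γ ⁻¹' interior (U x))
    (fun x => isOpen_interior.preimage γ.continuous)
    (fun s _ => mem_iUnion.2 ⟨γ s, mem_interior_iff_mem_nhds.2 (hU (γ s))⟩)
  have small : ∀ n, C (cls (γ.subpath (t n) (t (n + 1)))) := by
    intro n
    obtain ⟨x, hx⟩ := htU n
    refine hC x _ ?_
    rw [Path.range_subpath_of_le _ _ _ (htmono n.le_succ)]
    rintro _ ⟨s, hs, rfl⟩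
    exact interior_subset (hx hs)
  have key : ∀ n, C (cls (γ.subpath (t 0) (t (n + 1)))) := by
    intro n
    induction n with
    | zero => exact small 0
    | succ n ih =>
      have := htrans _ _ ih (small (n + 1))
      rwa [← cls_trans, cls_eq.2 ⟨Path.Homotopy.subpathTransSubpath γ _ _ _⟩] at this
  have hk := key N
  rw [ht0, hN (N + 1) N.le_succ, Path.subpath_zero_one] at hk
  have : ∀ {a b : X} (ha : a = x) (hb : b = y), C (cls (γ.cast ha hb)) → C (cls γ) := by
    rintro _ _ rfl rfl h
    exact h
  exact this _ _ hk

/-- The boundary relation of a continuous square. -/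
theorem cls_square {x₀₀ x₁₀ x₀₁ x₁₁ : X} (Q : I × I → X) (hQ : Continuous Q)
    (b : Path x₀₀ x₁₀) (r : Path x₁₀ x₁₁) (l : Path x₀₀ x₀₁) (t : Path x₀₁ x₁₁)
    (hb : ∀ s, Q (s, 0) = b s) (hr : ∀ s, Q (1, s) = r s)
    (hl : ∀ s, Q (0, s) = l s) (ht : ∀ s, Q (s, 1) = t s) :
    cls b ⬝ cls r = cls l ⬝ cls t := by
  let B : Path ((0, 0) : I × I) (1, 0) := ⟨⟨fun s => (s, 0), by fun_prop⟩, rfl, rfl⟩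
  let R : Path ((1, 0) : I × I) (1, 1) := ⟨⟨fun s => (1, s), by fun_prop⟩, rfl, rfl⟩
  let L : Path ((0, 0) : I × I) (0, 1) := ⟨⟨fun s => (0, s), by fun_prop⟩, rfl, rfl⟩
  let T : Path ((0, 1) : I × I) (1, 1) := ⟨⟨fun s => (s, 1), by fun_prop⟩, rfl, rfl⟩
  have h00 : Q (0, 0) = x₀₀ := by rw [hb, b.source]
  have h10 : Q (1, 0) = x₁₀ := by rw [hb, b.target]
  have h01 : Q (0, 1) = x₀₁ := by rw [ht, t.source]
  have h11 : Q (1, 1) = x₁₁ := by rw [ht, t.target]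
  subst h00 h10 h01 h11
  have : ContractibleSpace I := (convex_Icc (0 : ℝ) 1).contractibleSpace ⟨0, by simp⟩
  have e : cls (B.trans R) = cls (L.trans T) := Subsingleton.elim _ _
  have he := congrArg (fun a => a.map ⟨Q, hQ⟩) e
  simp only [cls_trans, PC.map_trans] at he
  have hB : B.map hQ = b := by ext s; exact hb s
  have hR : R.map hQ = r := by ext s; exact hr s
  have hL : L.map hQ = l := by ext s; exact hl s
  have hT : T.map hQ = t := by ext s; exact ht s
  rw [← hB, ← hR, ← hL, ← hT]
  exact he

/-- A path from a continuous function. -/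
def mkPath (f : I → X) (hf : Continuous f) {x y : X} (h0 : f 0 = x) (h1 : f 1 = y) : Path x y :=
  ⟨⟨f, hf⟩, h0, h1⟩

@[simp] lemma mkPath_apply (f : I → X) (hf : Continuous f) {x y : X} (h0 : f 0 = x)
    (h1 : f 1 = y) (s : I) : mkPath f hf h0 h1 s = f s := rfl

/-- A homotopy given by a function relative to the endpoints. -/
theorem cls_eq_of_homotopy {x y : X} {γ δ : Path x y} (H : I × I → X) (hH : Continuous H)
    (h0 : ∀ s, H (s, 0) = γ s) (h1 : ∀ s, H (s, 1) = δ s)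
    (hl : ∀ t, H (0, t) = x) (hr : ∀ t, H (1, t) = y) : cls γ = cls δ := by
  have := cls_square H hH γ (Path.refl y) (Path.refl x) δ h0 hr hl h1
  simpa using this

/-- Transport along equalities of endpoints. -/
lemma cls_cast {x y x' y' : X} (γ : Path x y) (hx : x' = x) (hy : y' = y) :
    cls (γ.cast hx hy) = (cls γ).cast hx hy := rfl

end Basic

section Linear

variable {E : Type*} [AddCommGroup E] [Module ℝ E] [TopologicalSpace E]
  [IsTopologicalAddGroup E] [ContinuousSMul ℝ E]

/-- Two paths in a subset which are joined pointwise by segments in the subset are homotopic. -/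
theorem cls_eq_of_segment {U : Set E} {x y : U} (γ δ : Path x y)
    (h : ∀ t, segment ℝ (γ t : E) (δ t) ⊆ U) : cls γ = cls δ := by
  have hmem : ∀ p : I × I, (1 - (p.2 : ℝ)) • (γ p.1 : E) + (p.2 : ℝ) • (δ p.1 : E) ∈ U :=
    fun p => h p.1 ⟨1 - p.2, p.2, by linarith [p.2.2.2], p.2.2.1, by ring, rfl⟩
  refine cls_eq_of_homotopy (fun p : I × I => ⟨_, hmem p⟩) ?_ ?_ ?_ ?_ ?_
  · fun_prop
  · intro s; ext; simp
  · intro s; ext; simp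
  · intro s; ext; simp [← add_smul]
  · intro s; ext; simp [← add_smul]

theorem cls_eq_of_convex {U K : Set E} (hK : Convex ℝ K) (hKU : K ⊆ U) {x y : U} (γ δ : Path x y)
    (hγ : ∀ t, (γ t : E) ∈ K) (hδ : ∀ t, (δ t : E) ∈ K) : cls γ = cls δ :=
  cls_eq_of_segment γ δ fun t => (hK.segment_subset (hγ t) (hδ t)).trans hKU

/-- The straight path between two points of a set containing their segment. -/
def segPath {U : Set E} (x y : U) (h : segment ℝ (x : E) y ⊆ U) : Path x y where
  toFun s := ⟨(1 - (s : ℝ)) • (x : E) + (s : ℝ) • (y : E),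
    h ⟨1 - s, s, by linarith [s.2.2], s.2.1, by ring, rfl⟩⟩
  continuous_toFun := Continuous.subtype_mk (by fun_prop) _
  source' := Subtype.ext (by simp)
  target' := Subtype.ext (by simp)

lemma segPath_mem_segment {U : Set E} (x y : U) (h : segment ℝ (x : E) y ⊆ U) (s : I) :
    (segPath x y h s : E) ∈ segment ℝ (x : E) y :=
  ⟨1 - s, s, by linarith [s.2.2], s.2.1, by ring, rfl⟩

lemma segPath_apply {U : Set E} (x y : U) (h : segment ℝ (x : E) y ⊆ U) (s : I) :
    (segPath x y h s : E) = (1 - (s : ℝ)) • (x : E) + (s : ℝ) • (y : E) := rfl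

end Linear

lemma trans_forall {X : Type*} [TopologicalSpace X] {p : X → Prop} {x y z : X} {γ : Path x y}
    {δ : Path y z} (hγ : ∀ t, p (γ t)) (hδ : ∀ t, p (δ t)) (t : I) : p ((γ.trans δ) t) := by
  have : (γ.trans δ) t ∈ range (γ.trans δ) := ⟨t, rfl⟩
  rw [Path.trans_range] at this
  rcases this with ⟨s, hs⟩ | ⟨s, hs⟩
  · exact hs ▸ hγ s
  · exact hs ▸ hδ s

section GeneralPosition

variable {E : Type*} [NormedAddCommGroup E] [NormedSpace ℂ E]

/-- A set meeting every complex line not contained in it in a finite set. -/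
def Thin (A : Set E) : Prop :=
  ∀ v ∉ A, ∀ w : E, {t : ℂ | v + t • (w - v) ∈ A}.Finite

lemma Thin.exists_notMem {A : Set E} (hA : Thin A) (hne : ∃ v, v ∉ A) {K : Set E} (hK : IsOpen K)
    {b : E} (hb : b ∈ K) : ∃ v ∈ K, v ∉ A := by
  obtain ⟨v, hv⟩ := hne
  have hc : Continuous fun t : ℂ => v + t • (b - v) := by fun_prop
  have hopen : {t : ℂ | v + t • (b - v) ∈ K} ∈ 𝓝 (1 : ℂ) :=
    (hK.preimage hc).mem_nhds (by simpa using hb)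
  have hinf : {t : ℂ | v + t • (b - v) ∈ K}.Infinite := infinite_of_mem_nhds 1 hopen
  obtain ⟨t, ht, ht'⟩ := hinf.exists_notMem_finite (hA v hv b)
  exact ⟨_, ht, ht'⟩

/-- The complement of a thin set in a convex open set is path connected. -/
lemma Thin.joinedIn {A : Set E} (hA : Thin A) {K : Set E} (hK : IsOpen K) (hKc : Convex ℝ K)
    {v w : E} (hv : v ∈ K) (hw : w ∈ K) (hvA : v ∉ A) (hwA : w ∉ A) : JoinedIn (K \ A) v w := by
  set f : ℂ → E := fun t => v + t • (w - v) with hf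
  have hfc : Continuous f := by fun_prop
  have hf0 : f 0 = v := by simp [hf]
  have hf1 : f 1 = w := by simp [hf]
  set T := {t : ℂ | f t ∈ A} with hT
  have hTfin : T.Finite := hA v hvA w
  have hL : Convex ℝ (f ⁻¹' K) := by
    intro a ha b hb s t hs ht hst
    have e : f (s • a + t • b) = s • f a + t • f b := by
      obtain rfl : s = 1 - t := by linarith
      simp only [hf, ← Complex.coe_smul]
      push_cast
      module
    show f (s • a + t • b) ∈ K
    rw [e]
    exact hKc ha hb hs ht hst
  let m : ℝ → ℂ := fun τ => ⟨1 / 2, τ⟩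
  have hm : Continuous m := by
    have : m = fun τ : ℝ => (1 / 2 : ℂ) + τ * Complex.I := by
      funext τ; apply Complex.ext <;> simp [m]
    rw [this]; fun_prop
  have hm0 : m 0 ∈ f ⁻¹' K := by
    have := hL (x := 0) (by simpa [hf0] using hv) (y := 1) (by simpa [hf1] using hw)
      (show (0 : ℝ) ≤ 1 / 2 by norm_num) (show (0 : ℝ) ≤ 1 / 2 by norm_num) (by norm_num)
    convert this using 1
    apply Complex.ext <;> simp [m]
  have hnh : m ⁻¹' (f ⁻¹' K) ∈ 𝓝 (0 : ℝ) :=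
    (((hK.preimage hfc).preimage hm).mem_nhds hm0)
  have hbad : ((fun t : ℂ => t.im / (2 * t.re)) '' T ∪
      (fun t : ℂ => t.im / (2 * (1 - t.re))) '' T).Finite := (hTfin.image _).union (hTfin.image _)
  obtain ⟨τ, hτK, hτ⟩ := (infinite_of_mem_nhds 0 hnh).exists_notMem_finite hbad
  simp only [mem_union, not_or] at hτ
  have h0T : (0 : ℂ) ∉ T := by simpa [hT, hf0] using hvA
  have h1T : (1 : ℂ) ∉ T := by simpa [hT, hf1] using hwA
  have seg1 : segment ℝ (0 : ℂ) (m τ) ⊆ f ⁻¹' (K \ A) := by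
    intro t ht
    refine ⟨hL.segment_subset (by simpa [hf0] using hv) hτK ht, fun htA => hτ.1 ⟨t, htA, ?_⟩⟩
    obtain ⟨r, s, hr, hs, hrs, rfl⟩ := ht
    by_cases h : s = 0
    · subst h
      exact absurd htA (by simpa [hf0] using hvA)
    · simp [m]; field_simp
  have seg2 : segment ℝ (m τ) (1 : ℂ) ⊆ f ⁻¹' (K \ A) := by
    intro t ht
    refine ⟨hL.segment_subset hτK (by simpa [hf1] using hw) ht, fun htA => hτ.2 ⟨t, htA, ?_⟩⟩
    obtain ⟨r, s, hr, hs, hrs, rfl⟩ := ht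
    by_cases h : r = 0
    · subst h
      have : s = 1 := by linarith
      subst this
      exact absurd htA (by simpa [hf1] using hwA)
    · have : s = 1 - r := by linarith
      subst this
      simp [m]
      have : 1 - (r * 2⁻¹ + (1 - r)) = r / 2 := by ring
      rw [this]; field_simp
  have j1 := (JoinedIn.of_segment_subset seg1)
  have j2 := (JoinedIn.of_segment_subset seg2)
  obtain ⟨γ, hγ⟩ := j1.trans j2
  exact ⟨(γ.map hfc).cast hf0.symm hf1.symm, hγ⟩

lemma JoinedIn.exists_subtype_path {X : Type*} [TopologicalSpace X] {U S : Set X} (hSU : S ⊆ U)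
    {x y : U} (h : JoinedIn S (x : X) y) : ∃ γ : Path x y, ∀ t, (γ t : X) ∈ S := by
  let γ : Path x y :=
    { toFun := fun t => ⟨h.somePath t, hSU (h.somePath_mem t)⟩
      continuous_toFun := Continuous.subtype_mk (by fun_prop) _
      source' := Subtype.ext (by simp)
      target' := Subtype.ext (by simp) }
  exact ⟨γ, h.somePath_mem⟩

/-- In an open set, a path whose endpoints avoid a thin set is homotopic to a path avoiding
the thin set. -/
theorem Thin.exists_avoiding_rep {A : Set E} (hA : Thin A) {U : Set E} (hU : IsOpen U)
    {x y : U} (hx : (x : E) ∉ A) (hy : (y : E) ∉ A) (a : PC x y) :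
    ∃ γ : Path x y, (∀ t, (γ t : E) ∉ A) ∧ cls γ = a := by
  let Av : ∀ {v w : U}, PC v w → Prop := fun {v w} b =>
    ∃ γ : Path v w, (∀ t, (γ t : E) ∉ A) ∧ cls γ = b
  have Av_trans : ∀ {u v w : U} (b : PC u v) (c : PC v w), Av b → Av c → Av (b ⬝ c) := by
    rintro u v w _ _ ⟨γ, hγ, rfl⟩ ⟨δ, hδ, rfl⟩
    exact ⟨γ.trans δ, trans_forall (p := fun z : U => (z : E) ∉ A) hγ hδ, rfl⟩
  have hne : ∃ v, v ∉ A := ⟨x, hx⟩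
  have hseg : ∀ {K : Set E}, Convex ℝ K → K ⊆ U → ∀ {v w : U}, (v : E) ∈ K → (w : E) ∈ K →
      segment ℝ (v : E) w ⊆ U := fun hK hKU v w hv hw => (hK.segment_subset hv hw).trans hKU
  let C : ∀ {v w : U}, PC v w → Prop := fun {v w} b =>
    ∀ (K K' : Set E) (_ : IsOpen K) (_ : IsOpen K') (hKc : Convex ℝ K) (hKc' : Convex ℝ K')
      (hKU : K ⊆ U) (hKU' : K' ⊆ U) (hv : (v : E) ∈ K) (hw : (w : E) ∈ K')
      (v' w' : U) (hv' : (v' : E) ∈ K) (hw' : (w' : E) ∈ K'), (v' : E) ∉ A → (w' : E) ∉ A →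
      Av (cls (segPath v' v (hseg hKc hKU hv' hv)) ⬝ b ⬝
        cls (segPath w w' (hseg hKc' hKU' hw hw')))
  have inK : ∀ {K : Set E}, IsOpen K → ∀ (hKc : Convex ℝ K) (hKU : K ⊆ U) {v w : U}, (v : E) ∈ K →
      (w : E) ∈ K → (v : E) ∉ A → (w : E) ∉ A → ∀ γ : Path v w, (∀ t, (γ t : E) ∈ K) →
      Av (cls γ) := by
    intro K hK hKc hKU v w hv hw hvA hwA γ hγ
    obtain ⟨δ, hδ⟩ := JoinedIn.exists_subtype_path (sdiff_subset.trans hKU)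
      (hA.joinedIn hK hKc hv hw hvA hwA)
    exact ⟨δ, fun t => (hδ t).2, cls_eq_of_convex hKc hKU _ _ (fun t => (hδ t).1) hγ⟩
  have segK : ∀ {K : Set E} (hKc : Convex ℝ K) (hKU : K ⊆ U) {v w : U} (hv : (v : E) ∈ K)
      (hw : (w : E) ∈ K) (t : I), (segPath v w (hseg hKc hKU hv hw) t : E) ∈ K :=
    fun hKc hKU v w hv hw t => hKc.segment_subset hv hw (segPath_mem_segment _ _ _ t)
  have main : C a := by
    refine PC.induction_local C ?_ ?_ a
    · intro u v w b c hb hc K K' hK hK' hKc hKc' hKU hKU' hu hw u' w' hu' hw' huA hwA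
      obtain ⟨r, hr, hrU⟩ := Metric.isOpen_iff.1 hU v v.2
      obtain ⟨m, hmB, hmA⟩ := hA.exists_notMem hne Metric.isOpen_ball (Metric.mem_ball_self hr)
      have hvB := Metric.mem_ball_self (x := (v : E)) hr
      have hBc : Convex ℝ (Metric.ball (v : E) r) := convex_ball _ _
      have h1 := hb K _ hK Metric.isOpen_ball hKc hBc hKU hrU hu hvB u' ⟨m, hrU hmB⟩ hu' hmB huA hmA
      have h2 := hc _ K' Metric.isOpen_ball hK' hBc hKc' hrU hKU' hvB hw ⟨m, hrU hmB⟩ w' hmB hw'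
        hmA hwA
      have h3 := Av_trans _ _ h1 h2
      have e : cls (segPath v ⟨m, hrU hmB⟩ (hseg hBc hrU hvB hmB)) ⬝
          cls (segPath ⟨m, hrU hmB⟩ v (hseg hBc hrU hmB hvB)) = cls (Path.refl v) :=
        cls_eq_of_convex hBc hrU _ _ (trans_forall (p := fun z : U => (z : E) ∈ Metric.ball _ _)
          (segK hBc hrU hvB hmB) (segK hBc hrU hmB hvB)) (fun t => hvB)
      convert h3 using 1
      simp only [Path.Homotopic.Quotient.trans_assoc]
      rw [← Path.Homotopic.Quotient.trans_assoc (cls (segPath v ⟨m, hrU hmB⟩ _)), e, cls_refl]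
      simp
    · intro v
      obtain ⟨r, hr, hrU⟩ := Metric.isOpen_iff.1 hU v v.2
      refine ⟨Subtype.val ⁻¹' Metric.ball (v : E) r,
        (Metric.isOpen_ball.preimage continuous_subtype_val).mem_nhds (Metric.mem_ball_self hr), ?_⟩
      intro y z γ hγ K K' hK hK' hKc hKc' hKU hKU' hyK hzK y' z' hy' hz' hyA hzA
      have hγB : ∀ t, (γ t : E) ∈ Metric.ball (v : E) r := fun t => hγ ⟨t, rfl⟩
      have hyB : (y : E) ∈ Metric.ball (v : E) r := by simpa using hγB 0
      have hzB : (z : E) ∈ Metric.ball (v : E) r := by simpa using hγB 1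
      have hBc : Convex ℝ (Metric.ball (v : E) r) := convex_ball _ _
      obtain ⟨p, ⟨hpK, hpB⟩, hpA⟩ := hA.exists_notMem hne (hK.inter Metric.isOpen_ball)
        (b := (y : E)) ⟨hyK, hyB⟩
      obtain ⟨q, ⟨hqK, hqB⟩, hqA⟩ := hA.exists_notMem hne (hK'.inter Metric.isOpen_ball)
        (b := (z : E)) ⟨hzK, hzB⟩
      let P : U := ⟨p, hrU hpB⟩
      let R : U := ⟨q, hrU hqB⟩
      have h1 := inK hK hKc hKU hy' hpK hyA hpA _
        (trans_forall (p := fun z : U => (z : E) ∈ K) (segK hKc hKU hy' hyK)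
          (segK hKc hKU (w := P) hyK hpK))
      have h2 := inK Metric.isOpen_ball hBc hrU (v := P) (w := R) hpB hqB hpA hqA _
        (trans_forall (p := fun z : U => (z : E) ∈ Metric.ball (v : E) r)
          (segK hBc hrU (v := P) hpB hyB) (trans_forall (p := fun z : U => (z : E) ∈ Metric.ball _
              _)
            hγB (segK hBc hrU (w := R) hzB hqB)))
      have h3 := inK hK' hKc' hKU' (v := R) hqK hz' hqA hzA _
        (trans_forall (p := fun z : U => (z : E) ∈ K') (segK hKc' hKU' (v := R) hqK hzK)
          (segK hKc' hKU' hzK hz'))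
      have h4 := Av_trans _ _ (Av_trans _ _ h1 h2) h3
      have e1 : cls (segPath y P (hseg hKc hKU hyK hpK)) ⬝
          cls (segPath P y (hseg hBc hrU hpB hyB)) = Path.Homotopic.Quotient.refl y := by
        rw [← cls_refl]
        have : segment ℝ (P : E) y = segment ℝ (y : E) P := segment_symm _ _ _
        refine cls_eq_of_convex hKc hKU _ _ (trans_forall (p := fun z : U => (z : E) ∈ K)
          (segK hKc hKU hyK hpK) (fun t => ?_)) (fun t => hyK)
        exact hKc.segment_subset hpK hyK (segPath_mem_segment P y _ t)
      have e2 : cls (segPath z R (hseg hBc hrU hzB hqB)) ⬝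
          cls (segPath R z (hseg hKc' hKU' hqK hzK)) = Path.Homotopic.Quotient.refl z := by
        rw [← cls_refl]
        refine cls_eq_of_convex hKc' hKU' _ _ (trans_forall (p := fun z : U => (z : E) ∈ K')
          (fun t => ?_) (segK hKc' hKU' hqK hzK)) (fun t => hzK)
        exact hKc'.segment_subset hzK hqK (segPath_mem_segment z R _ t)
      convert h4 using 1
      simp only [cls_trans, Path.Homotopic.Quotient.trans_assoc]
      rw [← Path.Homotopic.Quotient.trans_assoc (cls (segPath y P _)), e1,
        ← Path.Homotopic.Quotient.trans_assoc (cls (segPath z R _)), e2]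
      simp
  obtain ⟨r, hr, hrU⟩ := Metric.isOpen_iff.1 hU x x.2
  obtain ⟨s, hs, hsU⟩ := Metric.isOpen_iff.1 hU y y.2
  have := main _ _ Metric.isOpen_ball Metric.isOpen_ball (convex_ball _ _) (convex_ball _ _) hrU hsU
    (Metric.mem_ball_self hr) (Metric.mem_ball_self hs) x y (Metric.mem_ball_self hr)
    (Metric.mem_ball_self hs) hx hy
  have hself : ∀ (z : U) (h : segment ℝ (z : E) z ⊆ U),
      cls (segPath z z h) = Path.Homotopic.Quotient.refl z := by
    intro z h
    rw [← cls_refl]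
    refine cls_eq_of_convex (convex_singleton (z : E)) (by simp) _ _ (fun t => ?_) (fun t => rfl)
    simp [segPath_apply, ← add_smul]
  rw [hself, hself] at this
  rwa [Path.Homotopic.Quotient.refl_trans, Path.Homotopic.Quotient.trans_refl] at this

end GeneralPosition

section Roots

open Polynomial

variable {B : Type*} [TopologicalSpace B]

/-- A family of finite subsets of the plane which is locally given by disjoint continuous
functions. -/
def LocTriv (Z : B → Set ℂ) : Prop :=
  ∀ b₁, ∃ (n : ℕ) (N : Set B) (a : Fin n → B → ℂ), IsOpen N ∧ b₁ ∈ N ∧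
    (∀ k, ContinuousOn (a k) N) ∧ (∀ b ∈ N, Function.Injective fun k => a k b) ∧
    ∀ b ∈ N, Z b = range fun k => a k b

/-- A family of complex polynomials of constant degree with continuous coefficients. -/
structure PolyFam (n : ℕ) (g : B → ℂ[X]) : Prop where
  cont : ∀ k, Continuous fun b => (g b).coeff k
  deg : ∀ b, (g b).natDegree = n
  ne_zero : ∀ b, g b ≠ 0

lemma continuous_eval_of_coeff {g : B → ℂ[X]} {n : ℕ} (cont : ∀ k, Continuous fun b => (g b).coeff
    k)
    (deg : ∀ b, (g b).natDegree ≤ n) {T : Type*} [TopologicalSpace T] {φ : T → B} {ψ : T → ℂ}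
    (hφ : Continuous φ) (hψ : Continuous ψ) : Continuous fun t => (g (φ t)).eval (ψ t) := by
  have : (fun t => (g (φ t)).eval (ψ t)) =
      fun t => ∑ k ∈ Finset.range (n + 1), (g (φ t)).coeff k * ψ t ^ k := by
    funext t
    exact eval_eq_sum_range' (Nat.lt_succ_of_le (deg _)) _
  rw [this]
  exact continuous_finsetSum _ fun k _ => ((cont k).comp hφ).mul (hψ.pow k)

variable {n : ℕ} {g : B → ℂ[X]}

/-- Roots persist in families of constant degree. -/
theorem PolyFam.root_near (hg : PolyFam n g) {b₁ : B} {c : ℂ} (hc : (g b₁).eval c = 0) {ε : ℝ}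
    (hε : 0 < ε) : ∀ᶠ b in 𝓝 b₁, ∃ y, dist y c < ε ∧ (g b).eval y = 0 := by
  have h1 : Continuous fun b => ‖(g b).eval c‖ :=
    (continuous_eval_of_coeff hg.cont (fun b => (hg.deg b).le) continuous_id
      continuous_const).norm
  have h2 : Continuous fun b => ‖(g b).coeff n‖ * ε ^ n := ((hg.cont n).norm).mul continuous_const
  have hlc : ∀ b, (g b).coeff n ≠ 0 := fun b => by
    rw [← hg.deg b]; exact leadingCoeff_ne_zero.2 (hg.ne_zero b)
  have h3 : ‖(g b₁).eval c‖ < ‖(g b₁).coeff n‖ * ε ^ n := by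
    rw [hc, norm_zero]
    exact mul_pos (norm_pos_iff.2 (hlc b₁)) (pow_pos hε n)
  filter_upwards [h1.continuousAt.eventually_lt h2.continuousAt h3] with b hb
  by_contra! hcon
  have hs : (g b).Splits := IsAlgClosed.splits _
  have hcard : Multiset.card (g b).roots = n := by
    rw [← hs.natDegree_eq_card_roots, hg.deg]
  have : ∀ s : Multiset ℂ, (∀ y ∈ s, ε ≤ ‖c - y‖) →
      ε ^ Multiset.card s ≤ ‖(s.map fun y => c - y).prod‖ := by
    intro s
    induction s using Multiset.induction with
    | empty => simp
    | cons y s ih =>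
      intro h
      simp only [Multiset.card_cons, Multiset.map_cons, Multiset.prod_cons, norm_mul]
      rw [pow_succ']
      exact mul_le_mul (h y (by simp)) (ih fun z hz => h z (by simp [hz])) (by positivity)
        (norm_nonneg _)
  have h4 := this (g b).roots fun y hy => by
    rw [← dist_eq_norm, dist_comm]
    by_contra! hlt
    exact hcon y hlt (by simpa using (mem_roots'.1 hy).2)
  rw [hcard] at h4
  have h5 := hs.eval_eq_prod_roots c
  rw [leadingCoeff, hg.deg] at h5
  have : ‖(g b).coeff n‖ * ε ^ n ≤ ‖(g b).eval c‖ := by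
    rw [h5, norm_mul]
    exact mul_le_mul_of_nonneg_left h4 (norm_nonneg _)
  exact absurd hb (not_lt.2 this)

/-- The roots of a family of separable polynomials are locally trivial. -/
theorem PolyFam.locTriv (hg : PolyFam n g) (hsep : ∀ b, (g b).Separable) :
    LocTriv fun b => {y | (g b).eval y = 0} := by
  intro b₁
  have hcard : ∀ b, (g b).roots.toFinset.card = n := fun b => by
    rw [Multiset.toFinset_card_of_nodup (nodup_roots (hsep b)),
      ← (IsAlgClosed.splits (g b)).natDegree_eq_card_roots, hg.deg]
  have hmem : ∀ b y, y ∈ (g b).roots.toFinset ↔ (g b).eval y = 0 := fun b y => by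
    simp [hg.ne_zero b]
  let e := ((g b₁).roots.toFinset.equivFinOfCardEq (hcard b₁)).symm
  let c : Fin n → ℂ := fun k => (e k : ℂ)
  have hcinj : Function.Injective c := Subtype.val_injective.comp e.injective
  have hc0 : ∀ k, (g b₁).eval (c k) = 0 := fun k => (hmem _ _).1 (e k).2
  obtain ⟨ε, hε, hsepc⟩ : ∃ ε > 0, ∀ k l, k ≠ l → 2 * ε ≤ dist (c k) (c l) := by
    by_cases h : ∃ p : Fin n × Fin n, p.1 ≠ p.2
    · have hne : (Finset.univ.filter fun p : Fin n × Fin n => p.1 ≠ p.2).Nonempty := by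
        obtain ⟨p, hp⟩ := h
        exact ⟨p, by simp [hp]⟩
      obtain ⟨p, hp, hmin⟩ := Finset.exists_min_image _ (fun p => dist (c p.1) (c p.2)) hne
      refine ⟨dist (c p.1) (c p.2) / 2, ?_, ?_⟩
      · have := dist_pos.2 (hcinj.ne (Finset.mem_filter.1 hp).2)
        positivity
      · intro k l hkl
        have := hmin (k, l) (by simp [hkl])
        linarith
    · push Not at h
      exact ⟨1, one_pos, fun k l hkl => absurd (h (k, l)) hkl⟩
  have hev : ∀ᶠ b in 𝓝 b₁, ∀ k, ∃ y, dist y (c k) < ε ∧ (g b).eval y = 0 :=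
    eventually_all.2 fun k => hg.root_near (hc0 k) hε
  obtain ⟨N, hN, hNo, hbN⟩ := eventually_nhds_iff.1 hev
  have hN' : ∀ b k, ∃ y, b ∈ N → dist y (c k) < ε ∧ (g b).eval y = 0 := by
    intro b k
    by_cases hb : b ∈ N
    · obtain ⟨y, hy⟩ := hN b hb k
      exact ⟨y, fun _ => hy⟩
    · exact ⟨0, fun h => absurd h hb⟩
  choose A hA using hN'
  have hinj : ∀ b ∈ N, Function.Injective fun k => A b k := by
    intro b hb k l hkl
    by_contra hne
    have h1 := (hA b k hb).1
    have h2 := (hA b l hb).1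
    have hkl : A b k = A b l := hkl
    rw [hkl] at h1
    have := hsepc k l hne
    have := dist_triangle_left (c k) (c l) (A b l)
    linarith
  have hran : ∀ b ∈ N, {y | (g b).eval y = 0} = range fun k => A b k := by
    intro b hb
    have hsub : Finset.univ.image (fun k => A b k) ⊆ (g b).roots.toFinset := by
      intro y hy
      obtain ⟨k, -, rfl⟩ := Finset.mem_image.1 hy
      exact (hmem _ _).2 (hA b k hb).2
    have heq := Finset.eq_of_subset_of_card_le hsub (by
      rw [hcard, Finset.card_image_of_injective _ (hinj b hb), Finset.card_univ, Fintype.card_fin])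
    ext y
    rw [mem_ofPred_eq, ← hmem, ← heq]
    simp
  refine ⟨n, N, fun k b => A b k, hNo, hbN, ?_, hinj, hran⟩
  intro k b hb
  rw [Metric.continuousWithinAt_iff']
  intro ε' hε'
  have hδ : 0 < min ε' (ε - dist (A b k) (c k)) := lt_min hε' (by linarith [(hA b k hb).1])
  have := hg.root_near (hA b k hb).2 hδ
  filter_upwards [mem_nhdsWithin_of_mem_nhds this, self_mem_nhdsWithin] with b' hb' hb'N
  obtain ⟨y, hy, hy0⟩ := hb'
  have : y ∈ range fun k => A b' k := by
    rw [← hran b' hb'N]; exact hy0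
  obtain ⟨l, rfl⟩ := this
  have hlk : l = k := by
    by_contra hne
    have h1 := (hA b' l hb'N).1
    have h2 := hy.trans_le (min_le_right _ _)
    have := hsepc l k hne
    have := dist_triangle_left (c l) (c k) (A b' l)
    have := dist_triangle (A b' l) (A b k) (c k)
    linarith
  subst hlk
  exact hy.trans_le (min_le_left _ _)

/-- Distinct points of a locally trivial family are locally uniformly apart. -/
theorem LocTriv.gap {Z : B → Set ℂ} (hZ : LocTriv Z) (b₁ : B) :
    ∃ δ > 0, ∀ᶠ b in 𝓝 b₁, ∀ y ∈ Z b, ∀ y' ∈ Z b, y ≠ y' → δ < dist y y' := by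
  obtain ⟨n, N, a, hN, hb, hcont, hinj, hran⟩ := hZ b₁
  have key : ∀ p : Fin n × Fin n, ∃ δ > 0, ∀ᶠ b in 𝓝 b₁, p.1 ≠ p.2 →
      δ < dist (a p.1 b) (a p.2 b) := by
    intro p
    by_cases h : p.1 = p.2
    · exact ⟨1, one_pos, by simp [h]⟩
    · have hpos := dist_pos.2 ((hinj b₁ hb).ne h)
      have hc : ContinuousAt (fun b => dist (a p.1 b) (a p.2 b)) b₁ :=
        ((hcont p.1).continuousAt (hN.mem_nhds hb)).dist ((hcont p.2).continuousAt (hN.mem_nhds hb))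
      refine ⟨_, half_pos hpos, ?_⟩
      filter_upwards [hc.eventually (lt_mem_nhds (half_lt_self hpos))] with b hb _ using hb
  choose δ hδ hev using key
  obtain ⟨δ₀, hδ₀, hle⟩ : ∃ δ₀ > 0, ∀ p, δ₀ ≤ δ p := by
    by_cases hne : Nonempty (Fin n × Fin n)
    · obtain ⟨p, hp⟩ := Finite.exists_min δ
      exact ⟨δ p, hδ p, hp⟩
    · exact ⟨1, one_pos, fun p => absurd ⟨p⟩ hne⟩
  refine ⟨δ₀, hδ₀, ?_⟩
  filter_upwards [eventually_all.2 hev, hN.mem_nhds hb] with b hb hbN y hy y' hy' hne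
  rw [hran b hbN] at hy hy'
  obtain ⟨k, rfl⟩ := hy
  obtain ⟨l, rfl⟩ := hy'
  exact (hle (k, l)).trans_lt (hb (k, l) fun h => hne (by simp only at h; rw [h]))

lemma LocTriv.comp {B' : Type*} [TopologicalSpace B'] {Z : B → Set ℂ} (hZ : LocTriv Z)
    {φ : B' → B} (hφ : Continuous φ) : LocTriv fun b => Z (φ b) := by
  intro b₁
  obtain ⟨n, N, a, hN, hb, hcont, hinj, hran⟩ := hZ (φ b₁)
  exact ⟨n, φ ⁻¹' N, fun k b => a k (φ b), hN.preimage hφ, hb,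
    fun k => (hcont k).comp hφ.continuousOn fun _ h => h, fun b h => hinj _ h, fun b h => hran _ h⟩

end Roots

/-- The diagonal of a square is homotopic to the bottom side followed by the right side. -/
theorem cls_diag {X : Type*} [TopologicalSpace X] {x₀₀ x₁₀ x₁₁ : X} (Q : I × I → X)
    (hQ : Continuous Q) (b : Path x₀₀ x₁₀) (r : Path x₁₀ x₁₁) (d : Path x₀₀ x₁₁)
    (hb : ∀ s, Q (s, 0) = b s) (hr : ∀ s, Q (1, s) = r s) (hd : ∀ s, Q (s, s) = d s) :
    cls d = cls b ⬝ cls r := by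
  have := cls_square (fun p : I × I => Q (p.1, p.1 * p.2)) (by fun_prop) b r (Path.refl x₀₀) d
    (by simpa using hb) (by simpa using hr) (by simpa using (hd 0)) (by simpa using hd)
  simpa using this.symm

section Trivialization

variable {B : Type*} [TopologicalSpace B]

/-- A locally trivial family of finite sets is carried to a fixed one by a continuous family of
homeomorphisms of the plane. -/
theorem LocTriv.exists_trivialization {Z : B → Set ℂ} (hZ : LocTriv Z) (b₁ : B) :
    ∃ (N : Set B) (Φ Ψ : B → ℂ → ℂ), IsOpen N ∧ b₁ ∈ N ∧
      ContinuousOn (fun q : B × ℂ => Φ q.1 q.2) (N ×ˢ univ) ∧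
      ContinuousOn (fun q : B × ℂ => Ψ q.1 q.2) (N ×ˢ univ) ∧
      (∀ b ∈ N, ∀ w, Φ b (Ψ b w) = w) ∧ (∀ b ∈ N, ∀ w, Φ b w ∈ Z b ↔ w ∈ Z b₁) := by
  obtain ⟨n, N₀, a, hN₀, hb₁, hcont, hinj, hran⟩ := hZ b₁
  obtain ⟨r, hr, hgap⟩ : ∃ r > 0, ∀ k l, k ≠ l → r < dist (a k b₁) (a l b₁) := by
    obtain ⟨δ, hδ, h⟩ := hZ.gap b₁
    refine ⟨δ, hδ, fun k l hkl => ?_⟩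
    have := h.self_of_nhds
    rw [hran b₁ hb₁] at this
    exact this _ ⟨k, rfl⟩ _ ⟨l, rfl⟩ ((hinj b₁ hb₁).ne hkl)
  let ρ : Fin n → ℂ → ℝ := fun k w => max 0 (1 - dist w (a k b₁) / r)
  have hρcont : ∀ k, Continuous (ρ k) := fun k => by fun_prop
  have hρlip : ∀ k w w', |ρ k w - ρ k w'| ≤ dist w w' / r := by
    intro k w w'
    refine (abs_max_sub_max_le_max _ _ _ _).trans ?_
    rw [sub_self, abs_zero, max_eq_right (abs_nonneg _)]
    have : (1 - dist w (a k b₁) / r) - (1 - dist w' (a k b₁) / r) =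
        (dist w' (a k b₁) - dist w (a k b₁)) / r := by ring
    rw [this, abs_div, abs_of_pos hr]
    gcongr
    rw [dist_comm w w']
    exact abs_dist_sub_le _ _ _
  have hρ : ∀ k l, ρ k (a l b₁) = if k = l then 1 else 0 := by
    intro k l
    split_ifs with h
    · subst h; simp [ρ]
    · have := hgap l k (fun e => h e.symm)
      simp only [ρ]
      rw [max_eq_left]
      rw [sub_nonpos, one_le_div hr]
      exact this.le
  let h : B → ℂ → ℂ := fun b w => ∑ k, (ρ k w : ℂ) * (a k b - a k b₁)
  have hsum : ContinuousAt (fun b => ∑ k, ‖a k b - a k b₁‖) b₁ := by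
    refine tendsto_finsetSum _ fun k _ => ?_
    exact ((((hcont k).continuousAt (hN₀.mem_nhds hb₁)).sub continuousAt_const).norm)
  have hev : ∀ᶠ b in 𝓝 b₁, ∑ k, ‖a k b - a k b₁‖ < r / 2 :=
    hsum.eventually (gt_mem_nhds (by simpa using half_pos hr))
  obtain ⟨N₁, hN₁, hN₁o, hbN₁⟩ := eventually_nhds_iff.1 hev
  have hcontr : ∀ b ∈ N₁, ∀ w w', dist (h b w) (h b w') ≤ 1 / 2 * dist w w' := by
    intro b hb w w'
    rw [dist_eq_norm]
    have e : h b w - h b w' = ∑ k, ((ρ k w - ρ k w' : ℝ) : ℂ) * (a k b - a k b₁) := by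
      simp only [h, ← Finset.sum_sub_distrib]
      refine Finset.sum_congr rfl fun k _ => ?_
      push_cast; ring
    rw [e]
    calc _ ≤ ∑ k, ‖((ρ k w - ρ k w' : ℝ) : ℂ) * (a k b - a k b₁)‖ := norm_sum_le _ _
      _ ≤ ∑ k, dist w w' / r * ‖a k b - a k b₁‖ := by
          refine Finset.sum_le_sum fun k _ => ?_
          rw [norm_mul, Complex.norm_real, Real.norm_eq_abs]
          exact mul_le_mul_of_nonneg_right (hρlip k w w') (norm_nonneg _)
      _ = dist w w' / r * ∑ k, ‖a k b - a k b₁‖ := by rw [Finset.mul_sum]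
      _ ≤ dist w w' / r * (r / 2) :=
          mul_le_mul_of_nonneg_left (hN₁ b hb).le (by positivity)
      _ = 1 / 2 * dist w w' := by field_simp
  let Φ : B → ℂ → ℂ := fun b w => w + h b w
  have hanti : ∀ b ∈ N₁, ∀ w w', dist w w' ≤ 2 * dist (Φ b w) (Φ b w') := by
    intro b hb w w'
    have h1 := hcontr b hb w w'
    have h2 : dist w w' ≤ dist (Φ b w) (Φ b w') + dist (h b w) (h b w') := by
      simp only [dist_eq_norm, Φ]
      calc ‖w - w'‖ = ‖(w + h b w - (w' + h b w')) - (h b w - h b w')‖ := by congr 1; ring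
        _ ≤ _ := norm_sub_le _ _
    linarith
  have hsurj : ∀ b ∈ N₁, ∀ y, ∃ w, Φ b w = y := by
    intro b hb y
    have hc : ContractingWith (1 / 2) fun w => y - h b w := by
      refine ⟨by norm_num, LipschitzWith.of_dist_le_mul fun w w' => ?_⟩
      rw [dist_sub_left]
      simpa using hcontr b hb w w'
    refine ⟨hc.fixedPoint, ?_⟩
    have : y - h b hc.fixedPoint = hc.fixedPoint := hc.fixedPoint_isFixedPt
    show hc.fixedPoint + h b hc.fixedPoint = y
    nth_rewrite 1 [← this]
    ring
  have hsurj' : ∀ b y, ∃ w, b ∈ N₁ → Φ b w = y := by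
    intro b y
    by_cases hb : b ∈ N₁
    · obtain ⟨w, hw⟩ := hsurj b hb y
      exact ⟨w, fun _ => hw⟩
    · exact ⟨0, fun e => absurd e hb⟩
  choose Ψ hΨ using hsurj'
  have hΦc : ContinuousOn (fun q : B × ℂ => Φ q.1 q.2) ((N₀ ∩ N₁) ×ˢ univ) := by
    refine continuousOn_snd.add (continuousOn_finsetSum _ fun k _ => ?_)
    refine ContinuousOn.mul ?_ (ContinuousOn.sub ?_ continuousOn_const)
    · exact (Complex.continuous_ofReal.comp ((hρcont k).comp continuous_snd)).continuousOn
    · exact (hcont k).comp continuousOn_fst fun q hq => hq.1.1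
  refine ⟨N₀ ∩ N₁, Φ, Ψ, hN₀.inter hN₁o, ⟨hb₁, hbN₁⟩, hΦc, ?_, fun b hb w => hΨ b w hb.2, ?_⟩
  · rintro ⟨b₀, y₀⟩ hq
    have hcomp : ContinuousWithinAt (fun q : B × ℂ => Φ q.1 (Ψ b₀ y₀)) ((N₀ ∩ N₁) ×ˢ univ)
        (b₀, y₀) := by
      refine ContinuousWithinAt.comp (g := fun q : B × ℂ => Φ q.1 q.2)
        (f := fun q : B × ℂ => (q.1, Ψ b₀ y₀)) (x := (b₀, y₀))
        (t := (N₀ ∩ N₁) ×ˢ univ) (hΦc (b₀, Ψ b₀ y₀) ⟨hq.1, trivial⟩)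
        (Continuous.continuousWithinAt (by fun_prop)) ?_
      intro q hq
      exact ⟨hq.1, trivial⟩
    have hlim : Tendsto (fun q : B × ℂ => 2 * dist q.2 (Φ q.1 (Ψ b₀ y₀)))
        (𝓝[(N₀ ∩ N₁) ×ˢ univ] (b₀, y₀)) (𝓝 0) := by
      have := ((continuous_snd.continuousWithinAt (s := (N₀ ∩ N₁) ×ˢ univ)
        (x := (b₀, y₀))).dist hcomp).const_mul 2
      have e : 2 * dist y₀ (Φ b₀ (Ψ b₀ y₀)) = 0 := by rw [hΨ b₀ y₀ hq.1.2, dist_self, mul_zero]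
      rw [← e]
      exact this
    refine tendsto_iff_dist_tendsto_zero.2 ?_
    refine squeeze_zero' (Eventually.of_forall fun _ => dist_nonneg) ?_ hlim
    filter_upwards [self_mem_nhdsWithin] with q hq'
    have := hanti q.1 hq'.1.2 (Ψ q.1 q.2) (Ψ b₀ y₀)
    rwa [hΨ q.1 q.2 hq'.1.2] at this
  · intro b hb w
    have hΦa : ∀ l, Φ b (a l b₁) = a l b := by
      intro l
      simp only [Φ, h, hρ]
      rw [Finset.sum_eq_single l] <;> simp +contextual
    rw [hran b hb.1, hran b₁ hb₁]
    constructor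
    · rintro ⟨l, hl⟩
      refine ⟨l, ?_⟩
      have := hanti b hb.2 (a l b₁) w
      rw [hΦa, ← hl] at this
      simpa using this
    · rintro ⟨l, rfl⟩
      exact ⟨l, (hΦa l).symm⟩

/-- The complement of a family of subsets of the plane. -/
abbrev Compl (Z : B → Set ℂ) := {q : B × ℂ // q.2 ∉ Z q.1}

/-- Moving a path to a fibre of the complement of a locally trivial family, along a section. -/
theorem LocTriv.exists_move {Z : B → Set ℂ} (hZ : LocTriv Z) (sec : C(B, Compl Z))
    (hs : ∀ b, (sec b).1.1 = b) {w w' : Compl Z} (g : PC w w') {b : B} (u : Path (sec b) w)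
    (hu : ∀ t, (u t).1.1 = b) :
    ∃ (b' : B) (β : Path b b') (u' : Path (sec b') w'), (∀ t, (u' t).1.1 = b') ∧
      cls u ⬝ g = cls (β.map sec.continuous) ⬝ cls u' := by
  let C : ∀ {w w' : Compl Z}, PC w w' → Prop := fun {w w'} g =>
    ∀ (b : B) (u : Path (sec b) w), (∀ t, (u t).1.1 = b) →
    ∃ (b' : B) (β : Path b b') (u' : Path (sec b') w'), (∀ t, (u' t).1.1 = b') ∧
      cls u ⬝ g = cls (β.map sec.continuous) ⬝ cls u'
  have main : C g := by
    refine PC.induction_local C ?_ ?_ g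
    · intro x y z g h hg hh b u hu
      obtain ⟨b', β, u', hu', e⟩ := hg b u hu
      obtain ⟨b'', β', u'', hu'', e'⟩ := hh b' u' hu'
      refine ⟨b'', β.trans β', u'', hu'', ?_⟩
      rw [Path.map_trans, cls_trans, ← Path.Homotopic.Quotient.trans_assoc, e,
        Path.Homotopic.Quotient.trans_assoc, e', Path.Homotopic.Quotient.trans_assoc]
    · intro x
      obtain ⟨N, Φ, Ψ, hN, hb, hΦ, hΨ, hΦΨ, hmem⟩ := hZ.exists_trivialization x.1.1
      refine ⟨(fun q : Compl Z => q.1.1) ⁻¹' N, (hN.preimage (by fun_prop)).mem_nhds hb, ?_⟩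
      intro y z γ hγ b u hu
      have hyb : y.1.1 = b := by have := hu 1; simpa using this
      have hyN : y.1.1 ∈ N := by have := hγ ⟨0, rfl⟩; simpa using this
      have hzN : z.1.1 ∈ N := by have := hγ ⟨1, rfl⟩; simpa using this
      let δ : Path (sec b) z := u.trans γ
      have hδN : ∀ t, (δ t).1.1 ∈ N := trans_forall (p := fun q : Compl Z => q.1.1 ∈ N)
        (fun t => by rw [hu, ← hyb]; exact hyN) (fun t => hγ ⟨t, rfl⟩)
      let β : I → B := fun t => (δ t).1.1
      have hβ : Continuous β := by fun_prop
      have hΨm : ∀ b ∈ N, ∀ v ∉ Z b, Ψ b v ∉ Z x.1.1 := by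
        intro b hb v hv hcon
        rw [← hmem b hb, hΦΨ b hb] at hcon
        exact hv hcon
      have hsq : ∀ f : I → ℂ, Continuous f → (∀ t, f t ∉ Z x.1.1) →
          ∃ Q : I × I → Compl Z, Continuous Q ∧
            ∀ p, (Q p).1 = (β p.1, Φ (β p.1) (f p.2)) := by
        intro f hf hfZ
        refine ⟨fun p => ⟨(β p.1, Φ (β p.1) (f p.2)), ?_⟩, ?_, fun p => rfl⟩
        · intro hcon
          exact hfZ p.2 ((hmem (β p.1) (hδN p.1) _).1 hcon)
        · refine Continuous.subtype_mk ?_ _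
          refine (hβ.comp continuous_fst).prodMk ?_
          exact hΦ.comp_continuous (f := fun p : I × I => (β p.1, f p.2)) (by fun_prop)
            fun p => ⟨hδN p.1, trivial⟩
      have hΨc : ∀ τ : I → Compl Z, Continuous τ → (∀ t, (τ t).1.1 ∈ N) →
          Continuous fun t => Ψ (τ t).1.1 (τ t).1.2 := by
        intro τ hτ hτN
        exact hΨ.comp_continuous (f := fun t : I => ((τ t).1.1, (τ t).1.2)) (by fun_prop)
            fun p => ⟨hτN p, trivial⟩
      obtain ⟨Q₁, hQ₁, hQ₁v⟩ := hsq (fun t => Ψ (δ t).1.1 (δ t).1.2)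
        (hΨc δ δ.continuous hδN) fun t => hΨm _ (hδN t) _ (δ t).2
      have hsN : ∀ t, (sec (β t)).1.1 ∈ N := fun t => by rw [hs]; exact hδN t
      obtain ⟨Q₂, hQ₂, hQ₂v⟩ := hsq (fun t => Ψ (sec (β t)).1.1 (sec (β t)).1.2)
        (hΨc (fun t => sec (β t)) (by fun_prop) hsN) fun t => hΨm _ (hsN t) _ (sec (β t)).2
      have hβ0 : β 0 = b := by simp [β, hs]
      have hβ1 : β 1 = z.1.1 := by simp [β]
      let βp : Path b z.1.1 := ⟨⟨β, hβ⟩, hβ0, hβ1⟩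
      have hd1 : ∀ t, Q₁ (t, t) = δ t := fun t => Subtype.ext (by
        rw [hQ₁v]
        exact Prod.ext rfl (hΦΨ _ (hδN t) _))
      have hd2 : ∀ t, Q₂ (t, t) = sec (β t) := fun t => Subtype.ext (by
        rw [hQ₂v]
        have : (sec (β t)).1.1 = β t := hs _
        refine Prod.ext this.symm ?_
        simp only [this]
        exact hΦΨ _ (hδN t) _)
      have hb12 : ∀ s, Q₂ (s, 0) = Q₁ (s, 0) := fun s => Subtype.ext (by
        rw [hQ₁v, hQ₂v]
        have : sec (β 0) = δ 0 := by rw [hβ0]; simp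
        simp only [this])
      let h : Path (sec b) (Q₁ (1, 0)) :=
        ⟨⟨fun s => Q₁ (s, 0), by fun_prop⟩, by simp [hd1], rfl⟩
      let v : Path (Q₁ (1, 0)) z := ⟨⟨fun s => Q₁ (1, s), by fun_prop⟩, rfl, by simp [hd1]⟩
      let k : Path (Q₁ (1, 0)) (sec z.1.1) :=
        ⟨⟨fun s => Q₂ (1, s), by fun_prop⟩, by simp [hb12], by simp [hd2, hβ1]⟩
      have e1 : cls δ = cls h ⬝ cls v :=
        cls_diag Q₁ hQ₁ h v δ (fun _ => rfl) (fun _ => rfl) hd1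
      have e2 : cls (βp.map sec.continuous) = cls h ⬝ cls k :=
        cls_diag Q₂ hQ₂ h k _ (fun s => hb12 s) (fun _ => rfl) (fun t => hd2 t)
      refine ⟨z.1.1, βp, k.symm.trans v, ?_, ?_⟩
      · refine trans_forall (p := fun q : Compl Z => q.1.1 = z.1.1) ?_ ?_
        · intro t
          show (Q₂ (1, unitInterval.symm t)).1.1 = _
          rw [hQ₂v]; exact hβ1
        · intro t
          show (Q₁ (1, t)).1.1 = _
          rw [hQ₁v]; exact hβ1
      · rw [← cls_trans]
        show cls δ = _
        rw [e1, e2, cls_trans, cls_symm]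
        simp [Path.Homotopic.Quotient.trans_assoc]
  exact main b u hu

end Trivialization

section LinePoly

/-- The restriction of a ternary polynomial to the line through a generic point in a fixed
direction. -/
noncomputable def univLinePoly (F : MvPolynomial (Fin 3) ℂ) (e : Fin 3 → ℂ) :
    Polynomial (MvPolynomial (Fin 3) ℂ) :=
  MvPolynomial.aeval
    (fun i => Polynomial.C (MvPolynomial.X i) + Polynomial.C (MvPolynomial.C (e i)) * Polynomial.X)
        F

/-- The restriction `t ↦ F (v + t • e)`. -/
noncomputable def linePoly (F : MvPolynomial (Fin 3) ℂ) (e v : Fin 3 → ℂ) : Polynomial ℂ :=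
  MvPolynomial.aeval (fun i => Polynomial.C (v i) + Polynomial.C (e i) * Polynomial.X) F

variable (F : MvPolynomial (Fin 3) ℂ) (e v : Fin 3 → ℂ)

lemma univLinePoly_map : (univLinePoly F e).map (MvPolynomial.eval v) = linePoly F e v := by
  unfold univLinePoly linePoly
  induction F using MvPolynomial.induction_on with
  | C c =>
    simp [IsScalarTower.algebraMap_apply ℂ (MvPolynomial (Fin 3) ℂ)
      (Polynomial (MvPolynomial (Fin 3) ℂ))]
  | add p q hp hq => simp only [map_add, Polynomial.map_add, hp, hq]
  | mul_X p i hp => simp [hp]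

@[simp] lemma linePoly_eval (t : ℂ) :
    (linePoly F e v).eval t = MvPolynomial.eval (v + t • e) F := by
  unfold linePoly
  induction F using MvPolynomial.induction_on with
  | C c => rw [MvPolynomial.aeval_C, MvPolynomial.eval_C, Polynomial.algebraMap_eq,
      Polynomial.eval_C]
  | add p q hp hq => simp only [map_add, Polynomial.eval_add, hp, hq]
  | mul_X p i hp => simp [hp, mul_comm (e i) t]

lemma linePoly_coeff (k : ℕ) :
    (linePoly F e v).coeff k = MvPolynomial.eval v ((univLinePoly F e).coeff k) := by
  rw [← univLinePoly_map, Polynomial.coeff_map]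

variable {F}

lemma eval_smul_of_homogeneous {d : ℕ} (hF : F.IsHomogeneous d) (c : ℂ) (v : Fin 3 → ℂ) :
    MvPolynomial.eval (c • v) F = c ^ d * MvPolynomial.eval v F := by
  rw [MvPolynomial.eval_eq, MvPolynomial.eval_eq, Finset.mul_sum]
  refine Finset.sum_congr rfl fun m hm => ?_
  have h := hF (MvPolynomial.mem_support_iff.1 hm)
  rw [Finsupp.weight_apply, Finsupp.sum_fintype _ _ (by simp)] at h
  simp only [Pi.smul_apply, smul_eq_mul, mul_pow, Finset.prod_mul_distrib,
    Finset.prod_pow_eq_pow_sum]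
  simp only [Pi.one_apply, smul_eq_mul, mul_one] at h
  rw [Finset.sum_subset (Finset.subset_univ m.support) (by simp), h]
  ring

lemma linePoly_natDegree_le {d : ℕ} (hF : F.IsHomogeneous d) : (linePoly F e v).natDegree ≤ d := by
  have := MvPolynomial.aeval_natDegree_le (m := d) (n := 1) F hF.totalDegree_le
    (fun i => Polynomial.C (v i) + Polynomial.C (e i) * Polynomial.X) fun i => by compute_degree
  rwa [mul_one] at this

lemma linePoly_coeff_top {d : ℕ} (hF : F.IsHomogeneous d) :
    (linePoly F e v).coeff d = MvPolynomial.eval e F := by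
  have h1 : Tendsto (fun s : ℂ => MvPolynomial.eval (e + s • v) F) (𝓝[≠] 0)
      (𝓝 (MvPolynomial.eval e F)) := by
    have : Continuous fun s : ℂ => MvPolynomial.eval (e + s • v) F :=
      (MvPolynomial.continuous_eval F).comp (by fun_prop)
    have h := this.tendsto 0
    simp only [zero_smul, add_zero] at h
    exact h.mono_left nhdsWithin_le_nhds
  have h2 : Tendsto (fun s : ℂ => (Polynomial.reflect d (linePoly F e v)).eval s) (𝓝[≠] 0)
      (𝓝 ((linePoly F e v).coeff d)) := by
    have h := (Polynomial.reflect d (linePoly F e v)).continuous.tendsto 0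
    have e0 : (Polynomial.reflect d (linePoly F e v)).eval 0 = (linePoly F e v).coeff d := by
      rw [← Polynomial.coeff_zero_eq_eval_zero, Polynomial.coeff_reflect]
      simp [Polynomial.revAt_le]
    rw [e0] at h
    exact h.mono_left nhdsWithin_le_nhds
  refine tendsto_nhds_unique (h2.congr' ?_) h1
  filter_upwards [self_mem_nhdsWithin] with s hs
  have hs : s ≠ 0 := hs
  let _ : Invertible s⁻¹ := invertibleOfNonzero (inv_ne_zero hs)
  have := Polynomial.eval₂_reflect_mul_pow (RingHom.id ℂ) s⁻¹ d (linePoly F e v)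
    (linePoly_natDegree_le e v hF)
  rw [invOf_eq_inv, inv_inv, Polynomial.eval₂_id, Polynomial.eval₂_id, linePoly_eval] at this
  have e1 : e + s • v = s • (v + s⁻¹ • e) := by
    rw [smul_add, smul_smul, mul_inv_cancel₀ hs, one_smul, add_comm]
  rw [e1, eval_smul_of_homogeneous hF, ← this, inv_pow]
  field_simp

lemma linePoly_natDegree {d : ℕ} (hF : F.IsHomogeneous d) (he : MvPolynomial.eval e F ≠ 0) :
    (linePoly F e v).natDegree = d :=
  le_antisymm (linePoly_natDegree_le e v hF)
    (Polynomial.le_natDegree_of_ne_zero (by rwa [linePoly_coeff_top e v hF]))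

lemma linePoly_ne_zero {d : ℕ} (hF : F.IsHomogeneous d) (he : MvPolynomial.eval e F ≠ 0) :
    linePoly F e v ≠ 0 := fun h => he (by rw [← linePoly_coeff_top e v hF, h,
        Polynomial.coeff_zero])

variable {e}

lemma polyFam_linePoly {d : ℕ} (hF : F.IsHomogeneous d) (he : MvPolynomial.eval e F ≠ 0)
    {B : Type*} [TopologicalSpace B] {β : B → Fin 3 → ℂ} (hβ : Continuous β) :
    PolyFam d fun b => linePoly F e (β b) where
  cont k := by
    simp only [linePoly_coeff]
    exact (MvPolynomial.continuous_eval _).comp hβ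
  deg b := linePoly_natDegree _ _ hF he
  ne_zero b := linePoly_ne_zero _ _ hF he

/-- The zero set of a polynomial is thin. -/
lemma thin_zeros (Q : MvPolynomial (Fin 3) ℂ) : Thin {v | MvPolynomial.eval v Q = 0} := by
  intro v hv w
  have hne : linePoly Q (w - v) v ≠ 0 := fun h => hv (by
    have := linePoly_eval Q (w - v) v 0
    rw [h] at this
    simpa using this.symm)
  refine (linePoly Q (w - v) v).roots.toFinset.finite_toSet.subset fun t ht => ?_
  simpa [hne] using ht

/-- A polynomial whose zeros are the points with inseparable restriction to the line in the
direction `e`. -/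
noncomputable def lineDisc (F : MvPolynomial (Fin 3) ℂ) (e : Fin 3 → ℂ) (d : ℕ) :
    MvPolynomial (Fin 3) ℂ :=
  (univLinePoly F e).resultant (univLinePoly F e).derivative d (d - 1)

lemma resultant_ne_zero_iff {p q : Polynomial ℂ} {m n : ℕ} (hp : p.natDegree = m) (hp0 : p ≠ 0)
    (hq : q.natDegree ≤ n) :
    p.resultant q m n ≠ 0 ↔ ∀ x, p.eval x = 0 → q.eval x ≠ 0 := by
  subst hp
  rw [Polynomial.resultant_eq_prod_eval p q n hq (IsAlgClosed.splits p)]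
  rw [Ne, mul_eq_zero, not_or]
  constructor
  · rintro ⟨-, h⟩ x hx hqx
    refine h (Multiset.prod_eq_zero (Multiset.mem_map.2 ⟨x, ?_, hqx⟩))
    simp [hp0, hx]
  · intro h
    refine ⟨pow_ne_zero _ (Polynomial.leadingCoeff_ne_zero.2 hp0), fun h0 => ?_⟩
    obtain ⟨x, hx, hx0⟩ := Multiset.mem_map.1 (Multiset.prod_eq_zero_iff.1 h0)
    exact h x (by simpa using (Polynomial.mem_roots'.1 hx).2) hx0

lemma separable_iff_roots {p : Polynomial ℂ} :
    p.Separable ↔ (∀ x, p.eval x = 0 → p.derivative.eval x ≠ 0) := by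
  constructor
  · rintro ⟨a, b, hab⟩ x hx hx'
    have := congrArg (Polynomial.eval x) hab
    simp [hx, hx'] at this
  · intro h
    refine isCoprime_of_dvd _ _ ?_ ?_
    · rintro ⟨rfl, -⟩
      exact h 0 (by simp) (by simp)
    · intro q hq _ hqp hqd
      have hdeg : q.degree ≠ 0 := fun h0 => hq (Polynomial.isUnit_iff_degree_eq_zero.2 h0)
      obtain ⟨x, hx⟩ := IsAlgClosed.exists_root q hdeg
      exact h x (Polynomial.eval_eq_zero_of_dvd_of_eval_eq_zero hqp hx)
        (Polynomial.eval_eq_zero_of_dvd_of_eval_eq_zero hqd hx)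

lemma lineDisc_eval_ne_zero {d : ℕ} (hF : F.IsHomogeneous d) (he : MvPolynomial.eval e F ≠ 0) :
    MvPolynomial.eval v (lineDisc F e d) ≠ 0 ↔ (linePoly F e v).Separable := by
  unfold lineDisc
  rw [← Polynomial.resultant_map_map, ← Polynomial.derivative_map, univLinePoly_map,
    resultant_ne_zero_iff (linePoly_natDegree e v hF he) (linePoly_ne_zero e v hF he)
      ((Polynomial.natDegree_derivative_le _).trans
        (Nat.sub_le_sub_right (linePoly_natDegree_le e v hF) 1)), separable_iff_roots]

end LinePoly

/-- A continuous map into a subtype. -/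
def subMap {X Y : Type*} [TopologicalSpace X] [TopologicalSpace Y] {p : Y → Prop} (f : X → Y)
    (hf : Continuous f) (h : ∀ x, p (f x)) : C(X, {y // p y}) :=
  ⟨fun x => ⟨f x, h x⟩, hf.subtype_mk h⟩

@[simp] lemma subMap_apply {X Y : Type*} [TopologicalSpace X] [TopologicalSpace Y] {p : Y → Prop}
    (f : X → Y) (hf : Continuous f) (h : ∀ x, p (f x)) (x : X) : subMap f hf h x = ⟨f x, h x⟩ := rfl

section LineRep

variable {F : MvPolynomial (Fin 3) ℂ} {e : Fin 3 → ℂ} {d : ℕ}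

/-- The complement of the zero set of a polynomial. -/
def Cpl (F : MvPolynomial (Fin 3) ℂ) : Set (Fin 3 → ℂ) := {v | MvPolynomial.eval v F ≠ 0}

@[simp] lemma mem_cpl {v : Fin 3 → ℂ} : v ∈ Cpl F ↔ MvPolynomial.eval v F ≠ 0 := Iff.rfl

/-- The points at which the restriction to the line in the direction `e` is separable. -/
abbrev SepBase (F : MvPolynomial (Fin 3) ℂ) (e : Fin 3 → ℂ) :=
  {v : Fin 3 → ℂ // (linePoly F e v).Separable}

lemma isOpen_cpl : IsOpen (Cpl F) :=
  isOpen_ne_fun (MvPolynomial.continuous_eval F) continuous_const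

/-- Far away in the direction `e` the polynomial does not vanish. -/
lemma exists_far_bound (hF : F.IsHomogeneous d) (he : MvPolynomial.eval e F ≠ 0) :
    ∃ K : ℝ, 0 < K ∧ ∀ (v : Fin 3 → ℂ) (y : ℂ), y ≠ 0 → K * ‖v‖ ≤ ‖y‖ →
      MvPolynomial.eval (v + y • e) F ≠ 0 := by
  obtain ⟨r, hr, h⟩ := Metric.isOpen_iff.1 (isOpen_cpl (F := F)) e he
  refine ⟨2 / r, by positivity, fun v y hy hvy hcon => ?_⟩
  have e1 : v + y • e = y • (e + y⁻¹ • v) := by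
    rw [smul_add, smul_smul, mul_inv_cancel₀ hy, one_smul, add_comm]
  rw [e1, eval_smul_of_homogeneous hF] at hcon
  have hmem : e + y⁻¹ • v ∈ Metric.ball e r := by
    rw [mem_ball_iff_norm, add_sub_cancel_left, norm_smul, norm_inv]
    have hy' : 0 < ‖y‖ := norm_pos_iff.2 hy
    rw [inv_mul_lt_iff₀ hy']
    rw [div_mul_eq_mul_div, div_le_iff₀ hr] at hvy
    nlinarith [norm_nonneg v]
  exact (mul_ne_zero (pow_ne_zero d hy) (h hmem)) hcon

/-- Every loop in the complement is homotopic to one in the line through its base point. -/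
theorem exists_line_rep (hF : F.IsHomogeneous d) (he : MvPolynomial.eval e F ≠ 0) (q : Cpl F)
    (hq : (linePoly F e q).Separable) (a : PC q q) :
    ∃ γ : Path q q, (∀ t, ∃ y : ℂ, (γ t : Fin 3 → ℂ) = q + y • e) ∧ cls γ = a := by
  have hsep : ∀ v, v ∉ {v | MvPolynomial.eval v (lineDisc F e d) = 0} ↔
      (linePoly F e v).Separable := fun v => lineDisc_eval_ne_zero v hF he
  obtain ⟨γ, hγ, rfl⟩ := (thin_zeros (lineDisc F e d)).exists_avoiding_rep isOpen_cpl
    ((hsep _).2 hq) ((hsep _).2 hq) a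
  simp only [hsep] at hγ
  let Z : SepBase F e → Set ℂ := fun b => {y | (linePoly F e b.1).eval y = 0}
  have hZ : LocTriv Z :=
    (polyFam_linePoly hF he (continuous_subtype_val (p := fun v => (linePoly F e
        v).Separable))).locTriv
      fun b => b.2
  obtain ⟨K, hK, hfar⟩ := exists_far_bound hF he
  let η : (Fin 3 → ℂ) → ℂ := fun v => ((K * (‖v‖ + 1) : ℝ) : ℂ)
  have hηc : Continuous η := Complex.continuous_ofReal.comp (by fun_prop)
  have hη : ∀ v, MvPolynomial.eval (v + η v • e) F ≠ 0 := fun v => by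
    have hpos : 0 < K * (‖v‖ + 1) := by positivity
    refine hfar v _ ?_ ?_
    · exact Complex.ofReal_ne_zero.2 hpos.ne'
    · rw [Complex.norm_real, Real.norm_eq_abs, abs_of_pos hpos]
      nlinarith
  let far : C(Fin 3 → ℂ, Cpl F) := subMap (fun v => v + η v • e) (by fun_prop) hη
  let sec : C(SepBase F e, Compl Z) := subMap (fun b => (b, η b.1)) (by fun_prop)
    fun b => by simpa [Z] using hη b.1
  let pr : C(Compl Z, Cpl F) := subMap (fun w => w.1.1.1 + w.1.2 • e) (by fun_prop)
    fun w => by simpa [Z] using w.2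
  let qB : SepBase F e := ⟨q, hq⟩
  let w : Compl Z := ⟨(qB, 0), by simpa [Z, qB] using mem_cpl.1 q.2⟩
  let g : Path w w :=
    { toFun := fun t => ⟨(⟨γ t, hγ t⟩, 0), by simpa [Z] using mem_cpl.1 (γ t).2⟩
      continuous_toFun := by
        refine Continuous.subtype_mk (Continuous.prodMk ?_ continuous_const) _
        exact Continuous.subtype_mk (by fun_prop) _
      source' := by simp [w, qB]
      target' := by simp [w, qB] }
  have hfib : JoinedIn ({v : ℂ | v ∉ Z qB}) (η q) 0 := by
    have hT : Thin (Z qB) := by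
      intro v hv u
      by_cases huv : u - v = 0
      · simp only [huv, smul_zero, add_zero]
        convert finite_empty
        ext; simp [hv]
      have hfin : (Z qB).Finite := by
        refine (linePoly F e q).roots.toFinset.finite_toSet.subset fun t ht => ?_
        simpa [Z, qB, linePoly_ne_zero e q.1 hF he, Z, qB] using ht
      refine Finite.preimage (f := fun t : ℂ => v + t • (u - v)) ?_ hfin
      intro s _ t _ hst
      simpa [huv] using hst
    have := hT.joinedIn isOpen_univ convex_univ (mem_univ (η q)) (mem_univ 0)
      (sec qB).2 w.2
    refine this.mono fun v hv => hv.2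
  let u : Path (sec qB) w :=
    { toFun := fun t => ⟨(qB, hfib.somePath t), hfib.somePath_mem t⟩
      continuous_toFun := Continuous.subtype_mk (by fun_prop) _
      source' := Subtype.ext (by simp; rfl)
      target' := Subtype.ext (by simp [w]) }
  obtain ⟨b', β, u', hu', heq⟩ := hZ.exists_move sec (fun _ => rfl) (cls g) u fun _ => rfl
  have hb' : b' = qB := by
    have := hu' 1
    simpa [w] using this.symm
  subst hb'
  have hprg : (cls g).map pr = (cls γ).cast (Subtype.ext (by simp [pr, w, qB]))
      (Subtype.ext (by simp [pr, w, qB])) := by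
    rw [PC.map_cls, ← cls_cast]
    congr 1
    ext t i
    show (γ t : Fin 3 → ℂ) i + ((0 : ℂ) • e) i = (γ t : Fin 3 → ℂ) i
    simp
  have hnull : (cls (β.map sec.continuous)).map pr = Path.Homotopic.Quotient.refl _ := by
    have h1 : (cls (β.map sec.continuous)).map pr =
        (cls (β.map continuous_subtype_val)).map far := rfl
    have h2 : cls (β.map continuous_subtype_val) = Path.Homotopic.Quotient.refl (qB : Fin 3 → ℂ) :=
      Subsingleton.elim _ _
    rw [h1, h2]
    rfl
  have heq' := congrArg (fun z => z.map pr) heq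
  simp only [PC.map_trans, hnull, Path.Homotopic.Quotient.refl_trans, PC.map_cls] at heq'
  have hprw : q = pr w := Subtype.ext (by simp [pr, w, qB])
  refine ⟨((u.map pr.continuous).symm.trans (u'.map pr.continuous)).cast hprw hprw, ?_, ?_⟩
  · intro t
    refine trans_forall (p := fun z : Cpl F => ∃ y : ℂ, (z : Fin 3 → ℂ) = q + y • e) ?_ ?_ t
    · intro s
      exact ⟨_, rfl⟩
    · intro s
      refine ⟨(u' s).1.2, ?_⟩
      show (u' s).1.1.1 + _ = _
      rw [hu' s]
  · rw [cls_cast, cls_trans, ← heq', cls_symm, PC.symm_trans_cancel]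
    rw [PC.map_cls] at hprg
    rw [hprg]
    rfl

end LineRep

section Covering

variable {B : Type*} [TopologicalSpace B]

/-- The total space of a family of subsets of the plane. -/
abbrev Tot (Z : B → Set ℂ) := {q : B × ℂ // q.2 ∈ Z q.1}

/-- The projection from the total space of a family of subsets of the plane. -/
def Tot.proj (Z : B → Set ℂ) (q : Tot Z) : B := q.1.1

lemma LocTriv.isCoveringMap {Z : B → Set ℂ} (hZ : LocTriv Z) : IsCoveringMap (Tot.proj Z) := by
  intro b₁
  obtain ⟨n, N, a, hN, hb, hac, hinj, hZN⟩ := hZ b₁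
  suffices h : IsEvenlyCovered (Tot.proj Z) b₁ (Fin n) from h.to_isEvenlyCovered_preimage
  have hpc : Continuous (Tot.proj Z) := continuous_fst.comp continuous_subtype_val
  have hex : ∀ q : Tot.proj Z ⁻¹' N, ∃ k, a k (Tot.proj Z q) = q.1.1.2 := fun q => by
    have := q.1.2
    have h := hZN (Tot.proj Z q) q.2
    change Z q.1.1.1 = _ at h
    rw [h] at this
    exact this
  choose κ hκ using hex
  have hκ' : ∀ q k, a k (Tot.proj Z q.1) = q.1.1.2 ↔ κ q = k := fun q k =>
    ⟨fun h => hinj _ q.2 ((hκ q).trans h.symm), fun h => h ▸ hκ q⟩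
  have hac' : ∀ k, Continuous fun q : Tot.proj Z ⁻¹' N => a k (Tot.proj Z q.1) := fun k =>
    (hac k).comp_continuous (hpc.comp continuous_subtype_val) fun q => q.2
  have hκc : Continuous κ := by
    refine continuous_discrete_rng.2 fun k => ?_
    have hcl : ∀ k, IsClosed (κ ⁻¹' {k}) := fun k => by
      have : κ ⁻¹' {k} = {q | a k (Tot.proj Z q.1) = q.1.1.2} := by
        ext q; exact (hκ' q k).symm
      rw [this]
      exact isClosed_eq (hac' k) (by fun_prop)
    have : κ ⁻¹' {k} = (⋃ j ∈ ({k}ᶜ : Set (Fin n)), κ ⁻¹' {j})ᶜ := by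
      ext q; simp [not_imp_not, eq_comm]
    rw [this]
    exact (Set.Finite.isClosed_biUnion (Set.toFinite _) fun j _ => hcl j).isOpen_compl
  refine ⟨inferInstance, N, hb, hN, hN.preimage hpc,
    { toFun := fun q => (⟨Tot.proj Z q.1, q.2⟩, κ q)
      invFun := fun p => ⟨⟨(p.1, a p.2 p.1), by
        show _ ∈ Z p.1
        rw [hZN _ p.1.2]; exact ⟨p.2, rfl⟩⟩, p.1.2⟩
      left_inv := fun q => Subtype.ext (Subtype.ext (Prod.ext rfl (hκ q)))
      right_inv := fun p => Prod.ext rfl ((hκ' _ _).1 rfl)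
      continuous_toFun := by fun_prop
      continuous_invFun := ?_ }, fun _ => rfl⟩
  refine Continuous.subtype_mk (Continuous.subtype_mk (Continuous.prodMk (by fun_prop) ?_) _) _
  refine continuous_prod_of_discrete_right.2 fun k => ?_
  exact (hac k).comp_continuous continuous_subtype_val fun q => q.2

end Covering

section Specialization

open Polynomial


/-- Every polynomial over the fraction field is a multiple of an integral one. -/
lemma exists_integral_multiple {A K : Type*} [CommRing A] [IsDomain A] [Field K] [Algebra A K]
    [IsFractionRing A K] (P : K[X]) :
    ∃ (c : A) (P' : A[X]), c ≠ 0 ∧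
      P'.map (algebraMap A K) = Polynomial.C (algebraMap A K c) * P := by
  obtain ⟨b, hb, h⟩ := IsLocalization.integerNormalization_spec (nonZeroDivisors A) P
  refine ⟨b, _, nonZeroDivisors.ne_zero hb, h.trans ?_⟩
  ext k
  simp [Algebra.smul_def]

/-- Up to denominators, a polynomial over a domain of characteristic zero has the same irreducible
factors as a separable one. -/
lemma exists_separable_model {A : Type*} [CommRing A] [IsDomain A] [CharZero A] {G : A[X]}
    (hG : G ≠ 0) :
    ∃ (R U V Q P : A[X]) (c₁ c₂ c₃ : A) (n : ℕ), R ≠ 0 ∧ c₁ ≠ 0 ∧ c₂ ≠ 0 ∧ c₃ ≠ 0 ∧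
      U * R + V * derivative R = Polynomial.C c₁ ∧ R * Q = Polynomial.C c₂ * G ∧
      G * P = Polynomial.C c₃ * R ^ n := by
  obtain ⟨K, _, _, _⟩ : ∃ (K : Type _) (_ : Field K) (_ : Algebra A K), IsFractionRing A K :=
    ⟨FractionRing A, inferInstance, inferInstance, inferInstance⟩
  set φ : A →+* K := algebraMap _ _ with hφdef
  have hφ : Function.Injective φ := IsFractionRing.injective A K
  classical
  have hK : CharZero K := charZero_of_injective_algebraMap hφ
  have hφX : Function.Injective (Polynomial.map φ) := Polynomial.map_injective _ hφ
  have hGK : G.map φ ≠ 0 := fun h => hG (hφX (by simpa using h))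
  obtain ⟨n, hn⟩ := UniqueFactorizationMonoid.exists_dvd_radical_self_pow hGK
  obtain ⟨c, R, hc, hR⟩ := exists_integral_multiple (A := A)
    (UniqueFactorizationMonoid.radical (G.map φ))
  have hunit : IsUnit (Polynomial.C (φ c)) :=
    Polynomial.isUnit_C.2 (isUnit_iff_ne_zero.2 fun h => hc (hφ (by simpa using h)))
  rw [← hφdef] at hR
  have hassoc : Associated (R.map φ) (UniqueFactorizationMonoid.radical (G.map φ)) := by
    rw [hR]
    exact (associated_isUnit_mul_left_iff hunit).2 (Associated.refl _)
  have hR0 : R ≠ 0 := by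
    rintro rfl
    rw [Polynomial.map_zero] at hassoc
    exact UniqueFactorizationMonoid.radical_ne_zero ((associated_zero_iff_eq_zero _).1 hassoc.symm)
  have hsep : (R.map φ).Separable := by
    rw [PerfectField.separable_iff_squarefree]
    exact (hassoc.squarefree_iff).2 UniqueFactorizationMonoid.squarefree_radical
  obtain ⟨U, V, hUV⟩ := hsep
  obtain ⟨c1, U', hc1, hU'⟩ := exists_integral_multiple (A := A) U
  obtain ⟨c2, V', hc2, hV'⟩ := exists_integral_multiple (A := A) V
  obtain ⟨Q, hQ⟩ : R.map φ ∣ G.map φ :=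
    hassoc.dvd.trans UniqueFactorizationMonoid.radical_dvd_self
  obtain ⟨c3, Q', hc3, hQ'⟩ := exists_integral_multiple (A := A) Q
  obtain ⟨P, hP⟩ : G.map φ ∣ (R.map φ) ^ n := hn.trans (hassoc.symm.pow_pow.dvd)
  obtain ⟨c4, P', hc4, hP'⟩ := exists_integral_multiple (A := A) P
  rw [← hφdef] at hU' hV' hQ' hP'
  refine ⟨R, Polynomial.C c2 * U', Polynomial.C c1 * V', Q', P', c1 * c2, c3, c4, n, hR0,
    mul_ne_zero hc1 hc2, hc3, hc4, hφX ?_, hφX ?_, hφX ?_⟩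
  · simp only [Polynomial.map_add, Polynomial.map_mul, Polynomial.map_C, hU', hV',
      ← derivative_map, map_mul]
    linear_combination (Polynomial.C (φ c1) * Polynomial.C (φ c2)) * hUV
  · simp only [Polynomial.map_mul, Polynomial.map_C, hQ', hQ]
    ring
  · simp only [Polynomial.map_mul, Polynomial.map_pow, Polynomial.map_C, hP', hP]
    ring

/-- Outside finitely many parameters, the zero sets of a one-parameter algebraic family of
polynomials in one variable are locally trivial. -/
theorem exists_finite_locTriv {G : ℂ[X][X]} (hG : G ≠ 0) :
    ∃ D : Set ℂ, D.Finite ∧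
      LocTriv fun a : {a : ℂ // a ∉ D} => {x | (G.map (evalRingHom a.1)).eval x = 0} := by
  obtain ⟨R, U, V, Q, P, c1, c2, c3, n, hR0, hc1, hc2, hc3, e1, e2, e3⟩ := exists_separable_model hG
  set b : ℂ[X] := c1 * c2 * c3 * R.leadingCoeff
  have hb : b ≠ 0 := by
    simp only [b, mul_ne_zero_iff, ne_eq, leadingCoeff_eq_zero]
    exact ⟨⟨⟨hc1, hc2⟩, hc3⟩, hR0⟩
  refine ⟨b.rootSet ℂ, b.rootSet_finite ℂ, ?_⟩
  have hD : ∀ a : {a : ℂ // a ∉ b.rootSet ℂ}, c1.eval a.1 ≠ 0 ∧ c2.eval a.1 ≠ 0 ∧ c3.eval a.1 ≠ 0 ∧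
      R.leadingCoeff.eval a.1 ≠ 0 := by
    rintro ⟨a, ha⟩
    simp only [mem_rootSet, ne_eq, hb, not_false_eq_true, true_and, Polynomial.coe_aeval_eq_eval,
        b, Polynomial.eval_mul,
      mul_eq_zero, not_or] at ha
    tauto
  have hlead : ∀ a : {a : ℂ // a ∉ b.rootSet ℂ}, evalRingHom a.1 R.leadingCoeff ≠ 0 := fun a =>
    (hD a).2.2.2
  have hfam : PolyFam R.natDegree fun a : {a : ℂ // a ∉ b.rootSet ℂ} => R.map (evalRingHom a.1) :=
      by
    refine ⟨fun k => ?_, fun a => ?_, fun a h => ?_⟩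
    · simp only [Polynomial.coeff_map, coe_evalRingHom]
      fun_prop
    · exact natDegree_map_of_leadingCoeff_ne_zero _ (hlead a)
    · apply hlead a
      rw [← coeff_natDegree, ← Polynomial.coeff_map, h, Polynomial.coeff_zero]
  have hzero : ∀ (a : {a : ℂ // a ∉ b.rootSet ℂ}) (x : ℂ), (G.map (evalRingHom a.1)).eval x = 0 ↔
      (R.map (evalRingHom a.1)).eval x = 0 := by
    intro a x
    obtain ⟨h1, h2, h3, -⟩ := hD a
    constructor
    · intro h
      have := congrArg (fun p => (p.map (evalRingHom a.1)).eval x) e3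
      simp only [Polynomial.map_mul, Polynomial.map_pow, Polynomial.map_C, Polynomial.eval_mul,
          Polynomial.eval_pow, Polynomial.eval_C,
        h, coe_evalRingHom, zero_mul] at this
      exact eq_zero_of_pow_eq_zero ((mul_eq_zero.1 this.symm).resolve_left h3)
    · intro h
      have := congrArg (fun p => (p.map (evalRingHom a.1)).eval x) e2
      simp only [Polynomial.map_mul, Polynomial.map_C, Polynomial.eval_mul, Polynomial.eval_C, h,
          coe_evalRingHom,
        zero_mul] at this
      exact (mul_eq_zero.1 this.symm).resolve_left h2
  simp only [hzero]
  refine hfam.locTriv fun a => ?_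
  rw [separable_iff_roots]
  intro x hx hx'
  have := congrArg (fun p => (p.map (evalRingHom a.1)).eval x) e1
  rw [derivative_map] at hx'
  simp only [Polynomial.map_add, Polynomial.map_mul, Polynomial.map_C, Polynomial.eval_mul,
      Polynomial.eval_add, Polynomial.eval_C, hx, hx',
    coe_evalRingHom, mul_zero, add_zero] at this
  exact (hD a).1 this.symm

end Specialization

section Lifts

variable {E X : Type*} [TopologicalSpace E] [TopologicalSpace X] {p : E → X}

lemma exists_path_lift (cov : IsCoveringMap p) {b b' : X} (γ : Path b b') {e : E} (he : p e = b) :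
    ∃ (e' : E) (Γ : Path e e'), ∀ t, p (Γ t) = γ t := by
  have h0 : (γ : C(I, X)) 0 = p e := by simp [he]
  exact ⟨_, ⟨cov.liftPath γ e h0, cov.liftPath_zero .., rfl⟩, congrFun (cov.liftPath_lifts γ e h0)⟩

lemma lift_endpoint_eq (cov : IsCoveringMap p) {b b' : X} {γ γ' : Path b b'}
    (h : cls γ = cls γ') {e e' e'' : E} (Γ : Path e e') (Γ' : Path e e'')
    (hΓ : ∀ t, p (Γ t) = γ t) (hΓ' : ∀ t, p (Γ' t) = γ' t) : e' = e'' := by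
  have hb : p e = b := by simpa using hΓ 0
  have h0 : (γ : C(I, X)) 0 = p e := by simp [hb]
  have h0' : (γ' : C(I, X)) 0 = p e := by simp [hb]
  have h1 : (Γ : C(I, E)) = cov.liftPath γ e h0 :=
    (cov.eq_liftPath_iff' h0).2 ⟨funext hΓ, Γ.source⟩
  have h1' : (Γ' : C(I, E)) = cov.liftPath γ' e h0' :=
    (cov.eq_liftPath_iff' h0').2 ⟨funext hΓ', Γ'.source⟩
  have h2 : cov.liftPath (γ : C(I, X)) e h0 1 = cov.liftPath (γ' : C(I, X)) e h0' 1 :=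
    cov.liftPath_apply_one_eq_of_homotopicRel (cls_eq.1 h) e h0 h0'
  have h3 := (DFunLike.congr_fun h1 1).trans (h2.trans (DFunLike.congr_fun h1' 1).symm)
  simpa using h3

lemma lift_cls_eq (cov : IsCoveringMap p) {b b' : X} {γ γ' : Path b b'}
    (h : cls γ = cls γ') {e e' : E} (Γ Γ' : Path e e')
    (hΓ : ∀ t, p (Γ t) = γ t) (hΓ' : ∀ t, p (Γ' t) = γ' t) : cls Γ = cls Γ' := by
  have hb : p e = b := by simpa using hΓ 0
  have hb' : p e' = b' := by simpa using hΓ 1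
  subst hb hb'
  refine cov.injective_path_homotopic_map e e' ?_
  have e1 : Γ.map cov.continuous = γ := by ext t; exact hΓ t
  have e2 : Γ'.map cov.continuous = γ' := by ext t; exact hΓ' t
  show cls (Γ.map cov.continuous) = cls (Γ'.map cov.continuous)
  rw [e1, e2, h]

lemma lifts_trans {e e' e'' : E} {b b' b'' : X} {Γ : Path e e'} {Γ' : Path e' e''} {γ : Path b b'}
    {γ' : Path b' b''} (hΓ : ∀ t, p (Γ t) = γ t) (hΓ' : ∀ t, p (Γ' t) = γ' t) (t : I) :
    p (Γ.trans Γ' t) = γ.trans γ' t := by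
  simp only [Path.trans_apply]
  split_ifs <;> simp [hΓ, hΓ']

end Lifts

lemma _root_.Set.Finite.thin {A : Set ℂ} (hA : A.Finite) : Thin A := by
  intro v hv w
  by_cases hvw : w - v = 0
  · simp [hvw, hv]
  · refine Finite.preimage (f := fun t : ℂ => v + t • (w - v)) (fun s _ t _ hst => ?_) hA
    simpa [hvw] using hst

section Pencil

variable (F : MvPolynomial (Fin 3) ℂ) (e u w : Fin 3 → ℂ)

/-- The plane section of a ternary polynomial as a family of polynomials on parallel lines. -/
noncomputable def fib (x : ℂ) : Polynomial ℂ := linePoly F e (w + x • u)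

/-- A point of the affine plane through `w` spanned by `u` and `e`. -/
def pt (x y : ℂ) : Fin 3 → ℂ := w + x • u + y • e

@[fun_prop] lemma continuous_pt {T : Type*} [TopologicalSpace T] {f g : T → ℂ} (hf : Continuous f)
    (hg : Continuous g) : Continuous fun t => pt e u w (f t) (g t) := by
  unfold pt; fun_prop

@[simp] lemma fib_eval (x y : ℂ) :
    (fib F e u w x).eval y = MvPolynomial.eval (pt e u w x y) F := by
  simp [fib, pt]

lemma linePoly_add_smul (v : Fin 3 → ℂ) (y : ℂ) :
    linePoly F e (v + y • e) = (linePoly F e v).comp (Polynomial.X + Polynomial.C y) := by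
  refine Polynomial.funext fun t => ?_
  simp only [linePoly_eval, Polynomial.eval_comp, Polynomial.eval_add, Polynomial.eval_X,
    Polynomial.eval_C, add_smul]
  congr 2
  rw [add_assoc, add_comm (y • e)]

lemma separable_add_smul (v : Fin 3 → ℂ) (y : ℂ) (h : (linePoly F e v).Separable) :
    (linePoly F e (v + y • e)).Separable := by
  rw [linePoly_add_smul, separable_iff_roots] at *
  intro x hx
  simpa [Polynomial.derivative_comp] using h (x + y) (by simpa using hx)

/-- Points of the affine plane curve, off the fibres which are not transverse, whose translates by
`s` do not lie on the curve. -/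
abbrev Push (s : ℂ → ℂ) := {p : ℂ × ℂ // (fib F e u w p.1).Separable ∧
  (fib F e u w p.1).eval p.2 = 0 ∧ (fib F e u w p.1).eval (p.2 + s p.1) ≠ 0}

/-- Translation along the fibres. -/
noncomputable def push (s : ℂ → ℂ) (hs : Continuous s) : C(Push F e u w s, Cpl F) :=
  subMap (fun p => pt e u w p.1.1 (p.1.2 + s p.1.1)) (by fun_prop)
    fun p => by simpa using p.2.2.2

variable {F e u w}

section Incidence

variable (F e u w)

open Polynomial in
/-- A polynomial detecting the pairs `(a, x)` such that translation by `s₀ + a (x - x₀)` in a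
transverse fibre separates it from itself. -/
noncomputable def incidence (d : ℕ) (x₀ s₀ : ℂ) : ℂ[X][X] :=
  let ψ : MvPolynomial (Fin 3) ℂ →ₐ[ℂ] ℂ[X][X] :=
    MvPolynomial.aeval fun i => Polynomial.C (Polynomial.C (w i)) + Polynomial.C (Polynomial.C (u
        i)) * Polynomial.X
  let g := (univLinePoly F e).map ψ.toRingHom
  ψ (lineDisc F e d) * g.resultant (g.comp (Polynomial.X + Polynomial.C (Polynomial.C (Polynomial.C
      s₀) +
    Polynomial.C Polynomial.X * (Polynomial.X - Polynomial.C (Polynomial.C x₀))))) d d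

end Incidence

variable {d : ℕ}

lemma eval_incidence_ne_zero (hF : F.IsHomogeneous d) (he : MvPolynomial.eval e F ≠ 0)
    (x₀ s₀ a x : ℂ) :
    ((incidence F e u w d x₀ s₀).map (Polynomial.evalRingHom a)).eval x ≠ 0 ↔
      (fib F e u w x).Separable ∧ ∀ y, (fib F e u w x).eval y = 0 →
        (fib F e u w x).eval (y + (s₀ + a * (x - x₀))) ≠ 0 := by
  let ε : Polynomial (Polynomial ℂ) →+* ℂ :=
    (Polynomial.evalRingHom x).comp (Polynomial.mapRingHom (Polynomial.evalRingHom a))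
  let ψ : MvPolynomial (Fin 3) ℂ →ₐ[ℂ] Polynomial (Polynomial ℂ) :=
    MvPolynomial.aeval fun i => Polynomial.C (Polynomial.C (w i)) + Polynomial.C (Polynomial.C (u
        i)) * Polynomial.X
  have hψ : ε.comp ψ.toRingHom = MvPolynomial.eval (w + x • u) := by
    refine MvPolynomial.ringHom_ext (fun c => ?_) fun i => ?_
    · have : ψ (MvPolynomial.C c) = Polynomial.C (Polynomial.C c) := by
        rw [MvPolynomial.algHom_C]; rfl
      simp [ε, this]
    · simp [ε, ψ, mul_comm (u i) x]
  have hg : ((univLinePoly F e).map ψ.toRingHom).map ε = fib F e u w x := by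
    rw [Polynomial.map_map, hψ, univLinePoly_map]; rfl
  show ε (incidence F e u w d x₀ s₀) ≠ 0 ↔ _
  have hs : ε (Polynomial.C (Polynomial.C s₀) +
      Polynomial.C Polynomial.X * (Polynomial.X - Polynomial.C (Polynomial.C x₀))) =
      s₀ + a * (x - x₀) := by simp [ε]
  have hdeg : (fib F e u w x).natDegree = d := linePoly_natDegree e (w + x • u) hF he
  rw [incidence, map_mul, ← Polynomial.resultant_map_map, Polynomial.map_comp, hg,
    Polynomial.map_add, Polynomial.map_X, Polynomial.map_C, hs, mul_ne_zero_iff]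
  refine and_congr ?_ ?_
  · have h1 : ε (ψ (lineDisc F e d)) = MvPolynomial.eval (w + x • u) (lineDisc F e d) :=
      RingHom.congr_fun hψ _
    show ε (ψ (lineDisc F e d)) ≠ 0 ↔ _
    rw [h1]
    exact lineDisc_eval_ne_zero _ hF he
  · rw [resultant_ne_zero_iff hdeg (show fib F e u w x ≠ 0 from linePoly_ne_zero _ _ hF he)]
    · simp only [Polynomial.eval_comp, Polynomial.eval_add, Polynomial.eval_X, Polynomial.eval_C]
    · rw [Polynomial.natDegree_comp, Polynomial.natDegree_X_add_C, mul_one]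
      exact hdeg.le

end Pencil

section Decomposition

variable {F : MvPolynomial (Fin 3) ℂ} {e u w : Fin 3 → ℂ} {d : ℕ}

lemma finite_zeros_map (G : Polynomial (Polynomial ℂ)) (a x : ℂ)
    (h : (G.map (Polynomial.evalRingHom a)).eval x ≠ 0) :
    {x | (G.map (Polynomial.evalRingHom a)).eval x = 0}.Finite := by
  have h0 : G.map (Polynomial.evalRingHom a) ≠ 0 := fun h0 => h (by rw [h0, Polynomial.eval_zero])
  refine (G.map (Polynomial.evalRingHom a)).roots.toFinset.finite_toSet.subset fun y hy => ?_
  simpa [h0] using hy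

/-- A loop in the complement of the cone, based at a translate of a point of the plane curve,
is a product of two translates of paths on the curve. -/
theorem exists_push_decomposition (hF : F.IsHomogeneous d) (he : MvPolynomial.eval e F ≠ 0)
    (he0 : e ≠ 0) {x₀ x₁ s₀ : ℂ} (hx : x₀ ≠ x₁) (h0 : (fib F e u w x₀).Separable)
    (h1 : (fib F e u w x₁).Separable)
    (hs0 : ∀ y, (fib F e u w x₀).eval y = 0 → (fib F e u w x₀).eval (y + s₀) ≠ 0) :
    ∃ D : Set ℂ, D.Finite ∧ ∀ a₀ ∉ D, ∀ (hs : Continuous fun x => s₀ + a₀ * (x - x₀))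
      (p₁ : Push F e u w fun x => s₀ + a₀ * (x - x₀)), p₁.1.1 = x₁ →
      ∀ l : PC (push F e u w _ hs p₁) (push F e u w _ hs p₁), ∃ p₀ : Push F e u w _,
        p₀.1.1 = x₀ ∧
        ∃ v v' : Path p₀ p₁, (cls v).map (push F e u w _ hs) ⬝ l =
          (cls v').map (push F e u w _ hs) := by
  set G := incidence F e u w d x₀ s₀ with hG
  have hinc := fun a x => eval_incidence_ne_zero (u := u) (w := w) hF he x₀ s₀ a x
  rw [← hG] at hinc
  have hsec : ∀ a, (G.map (Polynomial.evalRingHom a)).eval x₀ ≠ 0 := fun a =>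
    (hinc a x₀).2 ⟨h0, by simpa using hs0⟩
  have hG0 : G ≠ 0 := fun h => hsec 0 (by simp [h])
  obtain ⟨D, hD, hloc⟩ := exists_finite_locTriv hG0
  set A₁ : Set ℂ := {a | (G.map (Polynomial.evalRingHom a)).eval x₁ = 0} with hA₁
  have hx' : x₁ - x₀ ≠ 0 := sub_ne_zero.2 hx.symm
  have hA₁fin : A₁.Finite := by
    have hr : {y | (fib F e u w x₁).eval y = 0}.Finite := by
      refine (fib F e u w x₁).roots.toFinset.finite_toSet.subset fun y hy => ?_
      have := h1.ne_zero
      simpa [this] using hy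
    refine ((hr.prod hr).image fun q : ℂ × ℂ => (q.2 - q.1 - s₀) / (x₁ - x₀)).subset fun a ha => ?_
    have := (not_congr (hinc a x₁)).1 (not_not.2 ha)
    push Not at this
    obtain ⟨y, hy, hy'⟩ := this h1
    exact ⟨(y, _), ⟨hy, hy'⟩, by field_simp; ring⟩
  refine ⟨D ∪ A₁, hD.union hA₁fin, fun a₀ ha₀ hs p₁ hp₁ l => ?_⟩
  obtain ⟨⟨x₁', y₁⟩, hp1, hp2, hp3⟩ := p₁
  obtain rfl : x₁' = x₁ := hp₁
  rename' x₁' => x₁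
  -- the loop moves the parameter `a`
  let U : Set ℂ := {a | pt e u w x₁ (y₁ + (s₀ + a * (x₁ - x₀))) ∈ Cpl F}
  have hU : IsOpen U := isOpen_cpl.preimage (by fun_prop)
  let κU : C(U, Cpl F) := subMap (fun a => pt e u w x₁ (y₁ + (s₀ + a * (x₁ - x₀)))) (by fun_prop)
    fun a => a.2
  have ha₀U : a₀ ∈ U := by simpa [U] using hp3
  obtain ⟨α, hα, hαl⟩ : ∃ α : Path (⟨a₀, ha₀U⟩ : U) ⟨a₀, ha₀U⟩, (∀ t, (α t : ℂ) ∉ D ∪ A₁) ∧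
      (cls α).map κU = l := by
    obtain ⟨γ, hγ, rfl⟩ := exists_line_rep hF he _ (by
      exact separable_add_smul F e (w + x₁ • u) (y₁ + (s₀ + a₀ * (x₁ - x₀))) hp1) l
    obtain ⟨i, hi⟩ := Function.ne_iff.1 he0
    let q : Fin 3 → ℂ := pt e u w x₁ (y₁ + (s₀ + a₀ * (x₁ - x₀)))
    let Y : I → ℂ := fun t => ((γ t : Fin 3 → ℂ) i - q i) / e i
    have hγc : Continuous fun t => (γ t : Fin 3 → ℂ) := continuous_subtype_val.comp γ.continuous
    have hY : Continuous Y := (((continuous_apply i).comp hγc).sub continuous_const).div_const _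
    have hYγ : ∀ t, (γ t : Fin 3 → ℂ) = q + Y t • e := by
      intro t
      obtain ⟨y, hy⟩ := hγ t
      have hi' : e i ≠ 0 := hi
      have : Y t = y := by
        simp only [Y]
        rw [hy]
        change (q i + y * e i - q i) / e i = y
        field_simp
        ring
      rw [this]
      exact hy
    have hYpt : ∀ t, pt e u w x₁ (y₁ + (s₀ + (a₀ + Y t / (x₁ - x₀)) * (x₁ - x₀))) = γ t := by
      intro t
      rw [hYγ]
      have : y₁ + (s₀ + (a₀ + Y t / (x₁ - x₀)) * (x₁ - x₀)) =
        (y₁ + (s₀ + a₀ * (x₁ - x₀))) + Y t := by field_simp; ring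
      rw [this]
      simp only [q, pt, add_smul, add_assoc]
    have hY0 : Y 0 = 0 := by
      have : (γ 0 : Fin 3 → ℂ) = q := congrArg Subtype.val γ.source
      simp only [Y]
      rw [this, sub_self, zero_div]
    have hY1 : Y 1 = 0 := by
      have : (γ 1 : Fin 3 → ℂ) = q := congrArg Subtype.val γ.target
      simp only [Y]
      rw [this, sub_self, zero_div]
    let α : Path (⟨a₀, ha₀U⟩ : U) ⟨a₀, ha₀U⟩ :=
      { toFun := fun t => ⟨a₀ + Y t / (x₁ - x₀), by
          change pt e u w x₁ _ ∈ Cpl F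
          rw [hYpt]; exact (γ t).2⟩
        continuous_toFun := by fun_prop
        source' := Subtype.ext (by simp [hY0])
        target' := Subtype.ext (by simp [hY1]) }
    obtain ⟨α', hα', hαα'⟩ := (hD.union hA₁fin).thin.exists_avoiding_rep hU ha₀ ha₀ (cls α)
    refine ⟨α', hα', ?_⟩
    rw [hαα', PC.map_cls]
    exact congrArg cls (Path.ext (funext fun t => Subtype.ext (hYpt t)))
  -- the family of admissible `x` parametrized by `a`
  let B := {a : ℂ // a ∉ D ∪ A₁}
  let Z : B → Set ℂ := fun a => {x | (G.map (Polynomial.evalRingHom a.1)).eval x = 0}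
  have hZ : LocTriv Z := hloc.comp (φ := fun a : B => (⟨a.1, fun h => a.2 (Or.inl h)⟩ : {a // a ∉
      D}))
    (by fun_prop)
  let b₀ : B := ⟨a₀, ha₀⟩
  let sec : C(B, Compl Z) := ⟨fun a => ⟨(a, x₀), hsec a.1⟩, by fun_prop⟩
  let w₁ : Compl Z := ⟨(b₀, x₁), fun h => ha₀ (Or.inr h)⟩
  let g : Path w₁ w₁ :=
    { toFun := fun t => ⟨(⟨α t, hα t⟩, x₁), fun h => hα t (Or.inr h)⟩
      continuous_toFun := by fun_prop
      source' := by simp [w₁, b₀]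
      target' := by simp [w₁, b₀] }
  obtain ⟨v, hv⟩ : ∃ v : Path (sec b₀) w₁, ∀ t, (v t).1.1 = b₀ := by
    have hj := (finite_zeros_map G a₀ x₀ (hsec _)).thin.joinedIn isOpen_univ convex_univ
      (mem_univ x₀) (mem_univ x₁) (hsec _) fun h => ha₀ (Or.inr h)
    exact ⟨{ toFun := fun t => ⟨(b₀, hj.somePath t), (hj.somePath_mem t).2⟩
             continuous_toFun := by fun_prop
             source' := by simp [sec]
             target' := by simp [w₁] }, fun t => rfl⟩
  obtain ⟨b', β, v', hv', hmove⟩ := hZ.exists_move sec (fun b => rfl) (cls g) v hv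
  obtain rfl : b' = b₀ := by rw [← hv' 1, v'.target]
  -- the curve as a covering
  let ZW : Compl Z → Set ℂ := fun q => {y | (fib F e u w q.1.2).eval y = 0}
  have hsepW : ∀ q : Compl Z, (fib F e u w q.1.2).Separable := fun q => ((hinc q.1.1 q.1.2).1 q.2).1
  have hcov : IsCoveringMap (Tot.proj ZW) :=
    ((polyFam_linePoly hF he (β := fun q : Compl Z => w + q.1.2 • u) (by fun_prop)).locTriv
      hsepW).isCoveringMap
  let e₁ : Tot ZW := ⟨(w₁, y₁), hp2⟩
  obtain ⟨e₀, V, hV⟩ := exists_path_lift hcov v.symm (e := e₁) rfl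
  obtain ⟨y₀, hy₀, rfl⟩ : ∃ y₀ hy₀, e₀ = ⟨(sec b₀, y₀), hy₀⟩ := by
    have h : e₀.1.1 = sec b₀ := by simpa [Tot.proj] using hV 1
    obtain ⟨⟨q, y₀⟩, hy₀⟩ := e₀
    obtain rfl : q = sec b₀ := h
    exact ⟨y₀, hy₀, rfl⟩
  let S : Path (⟨(sec b₀, y₀), hy₀⟩ : Tot ZW) ⟨(sec b₀, y₀), hy₀⟩ :=
    { toFun := fun t => ⟨(sec (β t), y₀), hy₀⟩
      continuous_toFun := by fun_prop
      source' := by simp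
      target' := by simp }
  let L : Path e₁ e₁ :=
    { toFun := fun t => ⟨(g t, y₁), hp2⟩
      continuous_toFun := by fun_prop
      source' := by simp [e₁]
      target' := by simp [e₁] }
  obtain ⟨e₁', V', hV'⟩ := exists_path_lift hcov v' (e := ⟨(sec b₀, y₀), hy₀⟩) rfl
  have hVs : ∀ t, Tot.proj ZW (V.symm t) = v t := fun t => by
    
    have := hV (unitInterval.symm t)
    simpa using this
  have hl1 := lifts_trans hVs (Γ' := L) (γ' := g) fun t => rfl
  have hl2 := lifts_trans (p := Tot.proj ZW) (Γ := S) (γ := β.map sec.continuous) (fun t => rfl) hV'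
  obtain rfl := lift_endpoint_eq hcov hmove (V.symm.trans L) (S.trans V') hl1 hl2
  have hcls := lift_cls_eq hcov hmove (V.symm.trans L) (S.trans V') hl1 hl2
  have hBc : Continuous fun q : Tot ZW => (q.1.1.1.1.1 : ℂ) :=
    continuous_subtype_val.comp (by fun_prop : Continuous fun q : Tot ZW => q.1.1.1.1)
  let κ : C(Tot ZW, Cpl F) := subMap
    (fun q => pt e u w q.1.1.1.2 (q.1.2 + (s₀ + q.1.1.1.1.1 * (q.1.1.1.2 - x₀))))
    (continuous_pt _ _ _ (by fun_prop) (.add (by fun_prop) (.add continuous_const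
      (hBc.mul (by fun_prop)))))
    fun q => by
      have := ((hinc q.1.1.1.1.1 q.1.1.1.2).1 q.1.1.2).2 _ q.2
      simpa using this
  have hκ := congrArg (fun c => Path.Homotopic.Quotient.map c κ) hcls
  simp only [cls_trans, PC.map_trans] at hκ
  have hS : (cls S).map κ = cls (Path.refl _) := by
    rw [PC.map_cls]
    refine congrArg cls (Path.ext (funext fun t => Subtype.ext ?_))
    show pt e u w x₀ (y₀ + (s₀ + (β t).1 * (x₀ - x₀))) = pt e u w x₀ (y₀ + (s₀ + a₀ * (x₀ - x₀)))
    simp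
  have hL : (cls L).map κ = l := by
    rw [← hαl, PC.map_cls, PC.map_cls]
    rfl
  let V₀ := V.symm
  have hVa : ∀ t, (V₀ t).1.1.1.1 = b₀ := fun t => by
    rw [show (V₀ t).1.1 = v t from hVs t, hv]
  have hVa' : ∀ t, (V' t).1.1.1.1 = b₀ := fun t => by
    rw [show (V' t).1.1 = v' t from hV' t, hv']
  have hSV : (cls S).map κ ⬝ (cls V').map κ = (cls V').map κ := by
    rw [hS, cls_refl, Path.Homotopic.Quotient.refl_trans]
  let ρ : {q : Tot ZW // q.1.1.1.1 = b₀} → Push F e u w fun x => s₀ + a₀ * (x - x₀) := fun q =>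
    ⟨(q.1.1.1.1.2, q.1.1.2), hsepW _, q.1.2, by
      have := ((hinc q.1.1.1.1.1 q.1.1.1.1.2).1 q.1.1.1.2).2 _ q.1.2
      rwa [q.2] at this⟩
  have hρ : Continuous ρ := Continuous.subtype_mk
    (by fun_prop : Continuous fun q : {q : Tot ZW // q.1.1.1.1 = b₀} => (q.1.1.1.1.2, q.1.1.2)) _
  let P₀ : Push F e u w fun x => s₀ + a₀ * (x - x₀) := ρ ⟨⟨(sec b₀, y₀), hy₀⟩, rfl⟩
  let P₁ : Push F e u w fun x => s₀ + a₀ * (x - x₀) := ρ ⟨e₁, rfl⟩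
  let T : Path P₀ P₁ :=
    { toFun := fun t => ρ ⟨V₀ t, hVa t⟩
      continuous_toFun := hρ.comp (V₀.continuous.subtype_mk _)
      source' := congrArg ρ (Subtype.ext V₀.source)
      target' := congrArg ρ (Subtype.ext V₀.target) }
  let T' : Path P₀ P₁ :=
    { toFun := fun t => ρ ⟨V' t, hVa' t⟩
      continuous_toFun := hρ.comp (V'.continuous.subtype_mk _)
      source' := congrArg ρ (Subtype.ext V'.source)
      target' := congrArg ρ (Subtype.ext V'.target) }
  refine ⟨P₀, rfl, T, T', ?_⟩
  have hT : (cls T).map (push F e u w _ hs) = (cls V₀).map κ :=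
    congrArg cls (Path.ext (funext fun t => Subtype.ext (by
      show pt e u w _ (_ + (s₀ + a₀ * _)) = pt e u w _ (_ + (s₀ + (V₀ t).1.1.1.1.1 * _))
      rw [hVa]; rfl)))
  have hT' : (cls T').map (push F e u w _ hs) = (cls V').map κ :=
    congrArg cls (Path.ext (funext fun t => Subtype.ext (by
      show pt e u w _ (_ + (s₀ + a₀ * _)) = pt e u w _ (_ + (s₀ + (V' t).1.1.1.1.1 * _))
      rw [hVa']; rfl)))
  exact (congrArg (· ⬝ l) hT).trans
    ((congrArg ((cls V₀).map κ ⬝ ·) hL.symm).trans (hκ.trans (hSV.trans hT'.symm)))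

end Decomposition

section Meridian

/-- The punctured disc of radius `‖τ.2‖` centred at `τ.1` in a vertical line is contained in `Ω`. -/
def PDisc (Ω : Set (ℂ × ℂ)) (τ : (ℂ × ℂ) × ℂ) : Prop :=
  τ.2 ≠ 0 ∧ ∀ ζ : ℂ, ζ ≠ 0 → ‖ζ‖ ≤ ‖τ.2‖ → (τ.1.1, τ.1.2 + ζ) ∈ Ω

variable {Ω Ω' : Set (ℂ × ℂ)}

lemma PDisc.mono {τ : (ℂ × ℂ) × ℂ} (h : PDisc Ω τ) (hsub : Ω ⊆ Ω') : PDisc Ω' τ :=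
  ⟨h.1, fun ζ h0 hζ => hsub (h.2 ζ h0 hζ)⟩

lemma PDisc.of_le {p : ℂ × ℂ} {a b : ℂ} (h : PDisc Ω (p, a)) (hb : b ≠ 0) (hab : ‖b‖ ≤ ‖a‖) :
    PDisc Ω (p, b) :=
  ⟨hb, fun ζ h0 hζ => h.2 ζ h0 (hζ.trans hab)⟩

/-- The end point of the radius of a punctured disc. -/
def tip (τ : {τ // PDisc Ω τ}) : Ω :=
  ⟨(τ.1.1.1, τ.1.1.2 + τ.1.2), τ.2.2 _ τ.2.1 le_rfl⟩

lemma continuous_tip : Continuous (tip (Ω := Ω)) := by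
  unfold tip
  fun_prop

/-- The boundary circle of a punctured disc. -/
noncomputable def mer (τ : {τ // PDisc Ω τ}) : Path (tip τ) (tip τ) where
  toFun t := ⟨(τ.1.1.1, τ.1.1.2 + τ.1.2 * Complex.exp (2 * Real.pi * Complex.I * (t : ℝ))),
    τ.2.2 _ (mul_ne_zero τ.2.1 (Complex.exp_ne_zero _)) (by simp [Complex.norm_exp])⟩
  continuous_toFun := by fun_prop
  source' := by simp [tip]
  target' := by simp [tip]

lemma mer_mem {τ : {τ // PDisc Ω τ}} (h : PDisc Ω' τ.1) (t : I) : (mer τ t : ℂ × ℂ) ∈ Ω' :=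
  h.2 _ (mul_ne_zero τ.2.1 (Complex.exp_ne_zero _)) (by simp [Complex.norm_exp])

lemma mer_transport {τ τ' : {τ // PDisc Ω τ}} (Γ : Path τ τ') :
    cls (mer τ) ⬝ cls (Γ.map continuous_tip) = cls (Γ.map continuous_tip) ⬝ cls (mer τ') := by
  refine cls_square (fun q : I × I => mer (Γ q.2) q.1) ?_ _ _ _ _ ?_ ?_ ?_ ?_
  · refine Continuous.subtype_mk ?_ _
    have : Continuous fun q : I × I => (Γ q.2 : (ℂ × ℂ) × ℂ) := by fun_prop
    fun_prop
  all_goals intro t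
  · show mer (Γ 0) t = _
    rw [Γ.source]
  · show mer (Γ t) 1 = _
    simp
  · show mer (Γ t) 0 = _
    simp
  · show mer (Γ 1) t = _
    rw [Γ.target]

/-- Two punctured discs with the same centre are connected by a family of punctured discs. -/
lemma PDisc.exists_path {p : ℂ × ℂ} {a b : ℂ} (ha : PDisc Ω (p, a)) (hb : PDisc Ω (p, b))
    (hsub : Ω ⊆ Ω') :
    ∃ Γ : Path (⟨(p, a), ha.mono hsub⟩ : {τ // PDisc Ω' τ}) ⟨(p, b), hb.mono hsub⟩,
      ∀ t, PDisc Ω (Γ t).1 := by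
  have key : ∀ t : I,
      PDisc Ω (p, Complex.exp ((1 - (t : ℝ) : ℝ) * Complex.log a + (t : ℝ) * Complex.log b)) := by
    intro t
    have hn : ‖Complex.exp ((1 - (t : ℝ) : ℝ) * Complex.log a + (t : ℝ) * Complex.log b)‖ =
        Real.exp ((1 - (t : ℝ)) * Real.log ‖a‖ + t * Real.log ‖b‖) := by
      rw [Complex.norm_exp, Complex.add_re, Complex.re_ofReal_mul, Complex.re_ofReal_mul,
        Complex.log_re, Complex.log_re]
    have h0 := t.2.1
    have h1 := t.2.2
    rcases le_total ‖a‖ ‖b‖ with h | h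
    · refine hb.of_le (Complex.exp_ne_zero _) ?_
      have hl := Real.log_le_log (norm_pos_iff.2 ha.1) h
      rw [hn, ← Real.le_log_iff_exp_le (norm_pos_iff.2 hb.1)]
      nlinarith
    · refine ha.of_le (Complex.exp_ne_zero _) ?_
      have hl := Real.log_le_log (norm_pos_iff.2 hb.1) h
      rw [hn, ← Real.le_log_iff_exp_le (norm_pos_iff.2 ha.1)]
      nlinarith
  exact ⟨{ toFun := fun t => ⟨_, (key t).mono hsub⟩
           continuous_toFun := by fun_prop
           source' := by simp [Complex.exp_log ha.1]
           target' := by simp [Complex.exp_log hb.1] }, key⟩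

lemma PC.eq_of_conj {X : Type*} [TopologicalSpace X] {x y : X} {m n : PC x x} {c : PC y y}
    {t r : PC x y} (h1 : m ⬝ t = t ⬝ c) (h2 : n ⬝ r = r ⬝ c)
    (hc : (r.symm ⬝ t) ⬝ c = c ⬝ (r.symm ⬝ t)) : m = n := by
  refine PC.trans_right_cancel (a := t) ?_
  have h3 : r ⬝ ((r.symm ⬝ t) ⬝ c) = r ⬝ (c ⬝ (r.symm ⬝ t)) := congrArg (r ⬝ ·) hc
  rw [← Path.Homotopic.Quotient.trans_assoc r c, ← h2] at h3
  rw [h1]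
  simpa using h3

lemma PC.conj_transport {X : Type*} [TopologicalSpace X] {x x' y y' : X} {m : PC x x} {c : PC y y}
    {c' : PC y' y'} {t : PC x y} (a : PC x x') {b : PC y y'} (h1 : m ⬝ t = t ⬝ c)
    (h2 : c ⬝ b = b ⬝ c') :
    (a.symm ⬝ m ⬝ a) ⬝ (a.symm ⬝ t ⬝ b) = (a.symm ⬝ t ⬝ b) ⬝ c' := by
  have h3 : m ⬝ (t ⬝ b) = t ⬝ (c ⬝ b) := by
    rw [← Path.Homotopic.Quotient.trans_assoc, h1, Path.Homotopic.Quotient.trans_assoc]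
  simp only [Path.Homotopic.Quotient.trans_assoc, ← h2, PC.trans_symm_cancel, h3]

lemma PC.conj_trans {X : Type*} [TopologicalSpace X] {x y z : X} {m : PC x x} {c : PC y y}
    {t : PC x y} {c' : PC z z} {b : PC y z} (h1 : m ⬝ t = t ⬝ c) (h2 : c ⬝ b = b ⬝ c') :
    m ⬝ (t ⬝ b) = (t ⬝ b) ⬝ c' := by
  rw [← Path.Homotopic.Quotient.trans_assoc, h1, Path.Homotopic.Quotient.trans_assoc, h2,
    Path.Homotopic.Quotient.trans_assoc]

lemma PC.conj_eq {X : Type*} [TopologicalSpace X] {x x' : X} {m : PC x x} {m' : PC x' x'}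
    {a : PC x x'} (h : m ⬝ a = a ⬝ m') : a.symm ⬝ m ⬝ a = m' := by
  rw [Path.Homotopic.Quotient.trans_assoc, h, PC.symm_trans_cancel]

lemma PC.eq_of_conj_eq {X : Type*} [TopologicalSpace X] {x x' : X} {m : PC x x} {m' : PC x' x'}
    {a : PC x x'} (h : a.symm ⬝ m ⬝ a = m') : m ⬝ a = a ⬝ m' := by
  rw [← h]
  simp

lemma PC.refl_conj {X : Type*} [TopologicalSpace X] {x : X} (m : PC x x) :
    m ⬝ cls (Path.refl x) = cls (Path.refl x) ⬝ m := by
  rw [cls_refl, Path.Homotopic.Quotient.trans_refl, Path.Homotopic.Quotient.refl_trans]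

end Meridian

section Global

variable {Ω : Set (ℂ × ℂ)} {T : Type*} [TopologicalSpace T] {P : T → ℂ × ℂ} {s : T → ℂ}

/-- Meridians are transported to meridians along a path in the curve, even across the regions `W i`
where the radius is not small, as soon as loops commute in suitable charts `V i`. -/
theorem mer_transport_global (hP : Continuous P) (hs : Continuous s)
    (hΩ : ∀ t, ((P t).1, (P t).2 + s t) ∈ Ω) {ι : Type*} (W : ι → Set T) (V : ι → Set (ℂ × ℂ))
    (hV : ∀ i, V i ⊆ Ω)
    (hcov : ∀ t₀, (∀ᶠ t in 𝓝 t₀, PDisc Ω (P t, s t)) ∨ ∃ i, W i ∈ 𝓝 t₀)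
    (hdisj : ∀ t i j, t ∈ W i → t ∈ W j → i = j)
    (htip : ∀ i, ∀ t ∈ W i, ((P t).1, (P t).2 + s t) ∈ V i)
    (htiny : ∀ i, ∀ t₀ ∈ W i, ∃ δ > 0, ∀ᶠ t in 𝓝 t₀, ∀ a : ℂ, a ≠ 0 → ‖a‖ ≤ δ →
      PDisc (V i) (P t, a))
    (hcons : ∀ i, ∀ t ∈ W i, PDisc Ω (P t, s t) → PDisc (V i) (P t, s t))
    (hab : ∀ i (x : Ω) (α β : Path x x), (∀ t, (α t : ℂ × ℂ) ∈ V i) → (∀ t, (β t : ℂ × ℂ) ∈ V i) →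
      cls α ⬝ cls β = cls β ⬝ cls α)
    {t t' : T} (a : PC t t') (h : PDisc Ω (P t, s t)) (h' : PDisc Ω (P t', s t')) :
    cls (mer ⟨(P t, s t), h⟩) ⬝ a.map (subMap (fun t => ((P t).1, (P t).2 + s t)) (by fun_prop) hΩ)
        =
      a.map (subMap (fun t => ((P t).1, (P t).2 + s t)) (by fun_prop) hΩ) ⬝
        cls (mer ⟨(P t', s t'), h'⟩) := by
  set π : C(T, Ω) := subMap (fun t => ((P t).1, (P t).2 + s t)) (by fun_prop) hΩ with hπ
  let Chart : ι → (t : T) → PC (π t) (π t) → Prop := fun i t m =>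
    ∃ (c : ℂ) (hc : PDisc (V i) (P t, c)) (τ : Path (π t) (tip ⟨(P t, c), hc.mono (hV i)⟩)),
      (∀ r, (τ r : ℂ × ℂ) ∈ V i) ∧ m ⬝ cls τ = cls τ ⬝ cls (mer _)
  let Good : (t : T) → PC (π t) (π t) → Prop := fun t m =>
    (∃ h : PDisc Ω (P t, s t), m = cls (mer ⟨(P t, s t), h⟩)) ∨ ∃ i, t ∈ W i ∧ Chart i t m
  have radial : ∀ i, ∀ t ∈ W i, ∀ (h : PDisc Ω (P t, s t)),
      Chart i t (cls (mer ⟨(P t, s t), h⟩)) := by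
    intro i t ht h
    have hc := hcons i t ht h
    refine ⟨s t, hc, Path.refl _, fun r => ?_, ?_⟩
    · exact htip i t ht
    · exact PC.refl_conj _
  have good_chart : ∀ i, ∀ t ∈ W i, ∀ m, Good t m → Chart i t m := by
    rintro i t ht m (⟨h, rfl⟩ | ⟨j, hj, hm⟩)
    · exact radial i t ht h
    · rwa [hdisj t i j ht hj]
  have good_disc : ∀ t (h : PDisc Ω (P t, s t)) m, Good t m → m = cls (mer ⟨(P t, s t), h⟩) := by
    rintro t h m (⟨_, rfl⟩ | ⟨i, hi, c, hc, τ, hτ, hm⟩)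
    · rfl
    · have hd := hcons i t hi h
      obtain ⟨Γ, hΓ⟩ := hd.exists_path hc (hV i)
      have hΓV : ∀ r, (Γ.map continuous_tip r : ℂ × ℂ) ∈ V i := fun r =>
        (hΓ r).2 _ (Γ r).2.1 le_rfl
      refine PC.eq_of_conj hm (mer_transport Γ) ?_
      exact hab i _ ((Γ.map continuous_tip).symm.trans τ) (mer _)
        (trans_forall (p := fun x : Ω => (x : ℂ × ℂ) ∈ V i) (fun r => hΓV _) hτ)
        fun r => mer_mem (τ := ⟨(P t, c), hc.mono (hV i)⟩) hc r
  have hC : ∀ {t t' : T} (a : PC t t') m, Good t m →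
      Good t' ((a.map π).symm ⬝ m ⬝ a.map π) := by
    intro t t' a
    refine PC.induction_local (fun {t t'} a => ∀ m, Good t m →
      Good t' ((a.map π).symm ⬝ m ⬝ a.map π)) ?_ ?_ a
    · intro t₁ t₂ t₃ a b ha hb m hm
      have := hb _ (ha m hm)
      simpa [PC.map_trans, Path.Homotopic.Quotient.trans_assoc] using this
    · intro t₀
      rcases hcov t₀ with h | ⟨i, hi⟩
      · refine ⟨_, h, fun {y z} γ hγ m hm => Or.inl ⟨hγ ⟨1, by simp⟩, ?_⟩⟩
        obtain rfl := good_disc y (hγ ⟨0, by simp⟩) m hm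
        let Γ : Path (⟨(P y, s y), hγ ⟨0, by simp⟩⟩ : {τ // PDisc Ω τ})
            ⟨(P z, s z), hγ ⟨1, by simp⟩⟩ :=
          { toFun := fun r => ⟨(P (γ r), s (γ r)), hγ ⟨r, rfl⟩⟩
            continuous_toFun := by fun_prop
            source' := by simp
            target' := by simp }
        exact PC.conj_eq (mer_transport Γ)
      · obtain ⟨δ, hδ, hnhds⟩ := htiny i t₀ (mem_of_mem_nhds hi)
        refine ⟨_, inter_mem hi hnhds, fun {y z} γ hγ m hm => ?_⟩
        have hW : ∀ r, γ r ∈ W i := fun r => (hγ ⟨r, rfl⟩).1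
        have hyz : y ∈ W i ∧ z ∈ W i := ⟨by simpa using hW 0, by simpa using hW 1⟩
        obtain ⟨c, hc, τ, hτ, hm⟩ := good_chart i y hyz.1 m hm
        set c' : ℂ := ((min ‖c‖ δ : ℝ) : ℂ)
        have hc0 : 0 < min ‖c‖ δ := lt_min (norm_pos_iff.2 hc.1) hδ
        have hd : ∀ r, PDisc (V i) (P (γ r), c') := fun r =>
          (hγ ⟨r, rfl⟩).2 c' (Complex.ofReal_ne_zero.2 hc0.ne')
            (by rw [Complex.norm_real, Real.norm_of_nonneg hc0.le]; exact min_le_right _ _)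
        have hdy : PDisc (V i) (P y, c') := by simpa using hd 0
        have hdz : PDisc (V i) (P z, c') := by simpa using hd 1
        obtain ⟨Γ, hΓ⟩ := hc.exists_path hdy (hV i)
        let Δ : Path (⟨(P y, c'), hdy.mono (hV i)⟩ : {τ // PDisc Ω τ})
            ⟨(P z, c'), hdz.mono (hV i)⟩ :=
          { toFun := fun r => ⟨(P (γ r), c'), (hd r).mono (hV i)⟩
            continuous_toFun := by fun_prop
            source' := by simp
            target' := by simp }
        refine Or.inr ⟨i, hyz.2, c', hdz, (γ.map π.continuous).symm.trans
          ((τ.trans (Γ.map continuous_tip)).trans (Δ.map continuous_tip)), ?_, ?_⟩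
        · refine trans_forall (p := fun x : Ω => (x : ℂ × ℂ) ∈ V i)
            (fun r => htip i _ (hW _)) (trans_forall (p := fun x : Ω => (x : ℂ × ℂ) ∈ V i)
            (trans_forall (p := fun x : Ω => (x : ℂ × ℂ) ∈ V i) hτ fun r => ?_) fun r => ?_)
          · exact (hΓ r).2 _ (Γ r).2.1 le_rfl
          · exact (hd r).2 _ (hd r).1 le_rfl
        · have := PC.conj_transport (cls (γ.map π.continuous))
            (PC.conj_trans hm (mer_transport Γ)) (mer_transport Δ)
          simpa only [cls_trans, cls_symm, PC.map_cls, Path.Homotopic.Quotient.trans_assoc] using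
              this
  have h1 := good_disc t' h' _ (hC a _ (Or.inl ⟨h, rfl⟩))
  exact PC.eq_of_conj_eq h1


end Global

section Malcev

/-- A space with a continuous Mal'cev operation. -/
def Malcev (S : Type*) [TopologicalSpace S] : Prop :=
  ∃ μ : S → S → S → S, Continuous (fun q : S × S × S => μ q.1 q.2.1 q.2.2) ∧
    (∀ x y, μ x y y = x) ∧ ∀ x y, μ x x y = y

variable {S S' : Type*} [TopologicalSpace S] [TopologicalSpace S']

lemma Malcev.of_retract (h : Malcev S') {f : S → S'} {g : S' → S} (hf : Continuous f)
    (hg : Continuous g) (hgf : ∀ x, g (f x) = x) : Malcev S := by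
  obtain ⟨μ, hμ, h1, h2⟩ := h
  refine ⟨fun x y z => g (μ (f x) (f y) (f z)), ?_, fun x y => by simp [h1, hgf],
    fun x y => by simp [h2, hgf]⟩
  exact hg.comp (hμ.comp (by fun_prop :
    Continuous fun q : S × S × S => (f q.1, f q.2.1, f q.2.2)))

lemma Malcev.prod (h : Malcev S) (h' : Malcev S') : Malcev (S × S') := by
  obtain ⟨μ, hμ, h1, h2⟩ := h
  obtain ⟨ν, hν, h1', h2'⟩ := h'
  refine ⟨fun x y z => (μ x.1 y.1 z.1, ν x.2 y.2 z.2), ?_, fun x y => by simp [h1, h1'],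
    fun x y => by simp [h2, h2']⟩
  exact (hμ.comp (by fun_prop : Continuous fun q : (S × S') × (S × S') × S × S' =>
    (q.1.1, q.2.1.1, q.2.2.1))).prodMk (hν.comp (by fun_prop :
    Continuous fun q : (S × S') × (S × S') × S × S' => (q.1.2, q.2.1.2, q.2.2.2)))

lemma malcev_complex : Malcev ℂ :=
  ⟨fun x y z => x - y + z, by fun_prop, by simp, by simp⟩

lemma malcev_complex_ne_zero : Malcev {z : ℂ // z ≠ 0} := by
  refine ⟨fun x y z => ⟨x / y * z, by
    have := x.2; have := y.2; have := z.2; positivity⟩, ?_, fun x y => ?_, fun x y => ?_⟩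
  · refine Continuous.subtype_mk (Continuous.mul (Continuous.div (by fun_prop) (by fun_prop)
      fun q => q.2.1.2) (by fun_prop)) _
  · have := y.2
    ext; simp [this]
  · have := x.2
    ext; simp [this]

lemma Malcev.commute (h : Malcev S) {x : S} (α β : Path x x) :
    cls α ⬝ cls β = cls β ⬝ cls α := by
  obtain ⟨μ, hμ, h1, h2⟩ := h
  refine cls_square (fun q : I × I => μ (α q.1) x (β q.2)) ?_ _ _ _ _ ?_ ?_ ?_ ?_
  · exact hμ.comp (by fun_prop : Continuous fun q : I × I => (α q.1, x, β q.2))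
  all_goals intro t; simp [h1, h2]

/-- The open disc of radius `R` about the origin, punctured unless `sm` holds. -/
abbrev PBall (sm : Prop) (R : ℝ) := {z : ℂ // (z ≠ 0 ∨ sm) ∧ ‖z‖ < R}

lemma malcev_pball (sm : Prop) {R : ℝ} (hR : 0 < R) : Malcev (PBall sm R) := by
  have base : Malcev {z : ℂ // z ≠ 0 ∨ sm} := by
    by_cases hs : sm
    · exact malcev_complex.of_retract (f := Subtype.val) (g := fun z => ⟨z, Or.inr hs⟩)
        (by fun_prop) (by fun_prop) fun _ => rfl
    · exact malcev_complex_ne_zero.of_retract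
        (f := fun z => ⟨z, z.2.resolve_right hs⟩) (g := fun z => ⟨z, Or.inl z.2⟩)
        (by fun_prop) (by fun_prop) fun _ => rfl
  have h1 : ∀ z : PBall sm R, ((R - ‖(z : ℂ)‖ : ℝ) : ℂ) ≠ 0 := fun z =>
    Complex.ofReal_ne_zero.2 (sub_pos.2 z.2.2).ne'
  have h2 : ∀ z : ℂ, ((1 + ‖z‖ : ℝ) : ℂ) ≠ 0 := fun z =>
    Complex.ofReal_ne_zero.2 (by positivity)
  have hRc : (R : ℂ) ≠ 0 := Complex.ofReal_ne_zero.2 hR.ne'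
  refine base.of_retract
    (f := fun z => ⟨(z : ℂ) / ((R - ‖(z : ℂ)‖ : ℝ) : ℂ),
      z.2.1.imp_left fun h => div_ne_zero h (h1 z)⟩)
    (g := fun z => ⟨R * z / ((1 + ‖(z : ℂ)‖ : ℝ) : ℂ),
      z.2.imp_left fun h => div_ne_zero (mul_ne_zero hRc h) (h2 z), ?_⟩) ?_ ?_ fun z => ?_
  · have : (0 : ℝ) < 1 + ‖(z : ℂ)‖ := by positivity
    rw [norm_div, norm_mul, Complex.norm_real, Complex.norm_real, Real.norm_of_nonneg hR.le,
      Real.norm_of_nonneg this.le, div_lt_iff₀ this]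
    nlinarith
  · have : Continuous fun z : PBall sm R => (z : ℂ) / ((R - ‖(z : ℂ)‖ : ℝ) : ℂ) :=
      Continuous.div (by fun_prop) (by fun_prop) h1
    exact this.subtype_mk _
  · have : Continuous fun z : {z : ℂ // z ≠ 0 ∨ sm} =>
        R * (z : ℂ) / ((1 + ‖(z : ℂ)‖ : ℝ) : ℂ) :=
      Continuous.div (by fun_prop) (by fun_prop) fun z => h2 z
    exact this.subtype_mk _
  · ext
    have h3 := sub_pos.2 z.2.2
    have h4 : (1 + ‖(z : ℂ) / ((R - ‖(z : ℂ)‖ : ℝ) : ℂ)‖ : ℝ) = R / (R - ‖(z : ℂ)‖) := by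
      rw [norm_div, Complex.norm_real, Real.norm_of_nonneg h3.le]
      field_simp
      ring
    have h5 := h1 z
    simp only [h4]
    push_cast at h5 ⊢
    field_simp

end Malcev

section Chart

/-- Near `c`, loops in `Ω` with the same base point commute. -/
def LocComm {X : Type*} [TopologicalSpace X] (Ω : Set X) (c : X) : Prop :=
  ∃ N ∈ 𝓝 c, ∀ (x : Ω) (α β : Path x x), (∀ t, (α t : X) ∈ N) → (∀ t, (β t : X) ∈ N) →
    cls α ⬝ cls β = cls β ⬝ cls α

lemma Malcev.commute_of_forall_mem {X : Type*} [TopologicalSpace X] {S Ω : Set X} (h : Malcev S)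
    (hS : S ⊆ Ω) {x : Ω} (α β : Path x x) (hα : ∀ t, (α t : X) ∈ S) (hβ : ∀ t, (β t : X) ∈ S) :
    cls α ⬝ cls β = cls β ⬝ cls α := by
  have hx : (x : X) ∈ S := by simpa using hα 0
  let α' : Path (⟨x, hx⟩ : S) ⟨x, hx⟩ :=
    { toFun := fun t => ⟨α t, hα t⟩
      continuous_toFun := by fun_prop
      source' := by simp
      target' := by simp }
  let β' : Path (⟨x, hx⟩ : S) ⟨x, hx⟩ :=
    { toFun := fun t => ⟨β t, hβ t⟩
      continuous_toFun := by fun_prop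
      source' := by simp
      target' := by simp }
  let j : C(S, Ω) := ⟨Set.inclusion hS, continuous_inclusion hS⟩
  have := congrArg (fun a => Path.Homotopic.Quotient.map a j) (h.commute α' β')
  simp only [PC.map_trans] at this
  exact this

theorem locComm_of_chart {E : Type*} [NormedAddCommGroup E] [NormedSpace ℂ E] [CompleteSpace E]
    {Ω : Set E} {c : E} {Θ : E → ℂ × ℂ} {L : E ≃L[ℂ] ℂ × ℂ}
    (hΘ : HasStrictFDerivAt Θ (L : E →L[ℂ] ℂ × ℂ) c) (h0 : Θ c = 0) (sm : Prop)
    (hΩ : ∀ᶠ q in 𝓝 c, q ∈ Ω ↔ (Θ q).1 ≠ 0 ∧ ((Θ q).2 ≠ 0 ∨ sm)) : LocComm Ω c := by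
  set Φ := hΘ.toOpenPartialHomeomorph Θ with hΦ
  have hΦc : ∀ q, Φ q = Θ q := fun q => rfl
  have hcs : c ∈ Φ.source := hΘ.mem_toOpenPartialHomeomorph_source
  have hct : (0 : ℂ × ℂ) ∈ Φ.target := by
    have := Φ.map_source hcs
    rwa [hΦc, h0] at this
  have hsymm : Φ.symm 0 = c := by rw [← h0, ← hΦc, Φ.left_inv hcs]
  have hev : ∀ᶠ v in 𝓝 (0 : ℂ × ℂ), v ∈ Φ.target ∧
      (Φ.symm v ∈ Ω ↔ (Θ (Φ.symm v)).1 ≠ 0 ∧ ((Θ (Φ.symm v)).2 ≠ 0 ∨ sm)) := by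
    refine (Φ.open_target.eventually_mem hct).and ?_
    have hc := Φ.continuousAt_symm hct
    rw [ContinuousAt, hsymm] at hc
    exact hc.eventually hΩ
  obtain ⟨R, hR, hball⟩ := Metric.eventually_nhds_iff.1 hev
  have hball' : ∀ v : ℂ × ℂ, ‖v.1‖ < R → ‖v.2‖ < R → v ∈ Φ.target ∧
      (Φ.symm v ∈ Ω ↔ v.1 ≠ 0 ∧ (v.2 ≠ 0 ∨ sm)) := by
    intro v h1 h2
    obtain ⟨h3, h4⟩ := hball (y := v) (by rw [dist_zero_right]; exact max_lt h1 h2)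
    refine ⟨h3, ?_⟩
    rwa [← hΦc, Φ.right_inv h3] at h4
  let S : Set E := {q | q ∈ Φ.source ∧ ((Θ q).1 ≠ 0 ∧ ‖(Θ q).1‖ < R) ∧
    ((Θ q).2 ≠ 0 ∨ sm) ∧ ‖(Θ q).2‖ < R}
  have hSΩ : S ⊆ Ω := by
    rintro q ⟨hq, ⟨h1, h2⟩, h3, h4⟩
    have := (hball' (Θ q) h2 h4).2.2 ⟨h1, h3⟩
    rwa [← hΦc, Φ.left_inv hq] at this
  have hΘS : Continuous fun q : S => Θ q :=
    (Φ.continuousOn.mono fun q (hq : q ∈ S) => hq.1).domRestrict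
  have hM : Malcev S := by
    refine ((malcev_pball False hR).prod (malcev_pball sm hR)).of_retract
      (f := fun q => (⟨(Θ q).1, Or.inl q.2.2.1.1, q.2.2.1.2⟩, ⟨(Θ q).2, q.2.2.2⟩))
      (g := fun v => ⟨Φ.symm (v.1, v.2), ?_⟩) ?_ ?_ fun q => ?_
    · have h := hball' (v.1, v.2) v.1.2.2 v.2.2.2
      refine ⟨Φ.map_target h.1, ?_⟩
      rw [← hΦc, Φ.right_inv h.1]
      exact ⟨⟨v.1.2.1.resolve_right id, v.1.2.2⟩, v.2.2⟩
    · exact ((continuous_fst.comp hΘS).subtype_mk _).prodMk ((continuous_snd.comp hΘS).subtype_mk _)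
    · refine Continuous.subtype_mk ?_ _
      exact Φ.continuousOn_symm.comp_continuous (by fun_prop) fun v =>
        (hball' (v.1, v.2) v.1.2.2 v.2.2.2).1
    · ext
      exact Φ.left_inv q.2.1
  have hN : ∀ᶠ q in 𝓝 c, q ∈ Φ.source ∧ ‖(Θ q).1‖ < R ∧ ‖(Θ q).2‖ < R ∧
      (q ∈ Ω ↔ (Θ q).1 ≠ 0 ∧ ((Θ q).2 ≠ 0 ∨ sm)) := by
    have hc : ContinuousAt Θ c := hΘ.hasFDerivAt.continuousAt
    refine (Φ.open_source.eventually_mem hcs).and (Eventually.and ?_ (Eventually.and ?_ hΩ))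
    · exact (hc.fst.norm).eventually_lt continuousAt_const (by simp [h0, hR])
    · exact (hc.snd.norm).eventually_lt continuousAt_const (by simp [h0, hR])
  refine ⟨_, hN, fun x α β hα hβ => hM.commute_of_forall_mem hSΩ α β (fun t => ?_) fun t => ?_⟩
  · obtain ⟨h1, h2, h3, h4⟩ := hα t
    have := h4.1 (α t).2
    exact ⟨h1, ⟨this.1, h2⟩, this.2, h3⟩
  · obtain ⟨h1, h2, h3, h4⟩ := hβ t
    have := h4.1 (β t).2
    exact ⟨h1, ⟨this.1, h2⟩, this.2, h3⟩

end Chart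

section Taylor

lemma hasStrictFDerivAt_eval {ι : Type*} [Fintype ι] (F : MvPolynomial ι ℂ) (p : ι → ℂ) :
    HasStrictFDerivAt (fun v => MvPolynomial.eval v F)
      (∑ i, MvPolynomial.eval p (pderiv i F) • (ContinuousLinearMap.proj i : (ι → ℂ) →L[ℂ] ℂ)) p :=
          by
  classical
  induction F using MvPolynomial.induction_on with
  | C a =>
    simp only [eval_C]
    exact (hasStrictFDerivAt_const a p).congr_fderiv (ContinuousLinearMap.ext fun v => by simp)
  | add f g hf hg =>
    simp only [map_add]
    refine (hf.add hg).congr_fderiv (ContinuousLinearMap.ext fun v => ?_)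
    simp [add_mul, Finset.sum_add_distrib]
  | mul_X f j hf =>
    have h := hf.mul (ContinuousLinearMap.proj (R := ℂ) (φ := fun _ : ι => ℂ) j).hasStrictFDerivAt
      (x := p)
    simp only [map_mul, eval_X]
    refine h.congr_fderiv (ContinuousLinearMap.ext fun v => ?_)
    simp [pderiv_X, add_mul, Finset.sum_add_distrib, Finset.mul_sum, Pi.single_apply, mul_assoc,
        apply_ite]

lemma exists_taylor_two (g : MvPolynomial (Fin 2) ℂ) (q : Fin 2 → ℂ) :
    ∃ A B C : (Fin 2 → ℂ) → ℂ, ContDiff ℂ 1 A ∧ ContDiff ℂ 1 B ∧ ContDiff ℂ 1 C ∧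
      (∀ v, MvPolynomial.eval v g = MvPolynomial.eval q g +
        MvPolynomial.eval q (pderiv 0 g) * (v 0 - q 0) +
        MvPolynomial.eval q (pderiv 1 g) * (v 1 - q 1) + A v * (v 0 - q 0) ^ 2 +
        B v * (v 0 - q 0) * (v 1 - q 1) + C v * (v 1 - q 1) ^ 2) ∧
      2 * A q = MvPolynomial.eval q (pderiv 0 (pderiv 0 g)) ∧
      B q = MvPolynomial.eval q (pderiv 1 (pderiv 0 g)) ∧
      B q = MvPolynomial.eval q (pderiv 0 (pderiv 1 g)) ∧
      2 * C q = MvPolynomial.eval q (pderiv 1 (pderiv 1 g)) := by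
  induction g using MvPolynomial.induction_on with
  | C a =>
    refine ⟨fun _ => 0, fun _ => 0, fun _ => 0, contDiff_const, contDiff_const, contDiff_const, ?_⟩
    simp only [eval_C, pderiv_C, map_zero]
    exact ⟨fun _ => by ring, by ring, trivial, trivial, by ring⟩
  | add f g hf hg =>
    obtain ⟨A, B, C, hA, hB, hC, h, h1, h2, h3, h4⟩ := hf
    obtain ⟨A', B', C', hA', hB', hC', h', h1', h2', h3', h4'⟩ := hg
    refine ⟨A + A', B + B', C + C', hA.add hA', hB.add hB', hC.add hC', fun v => ?_, ?_, ?_, ?_, ?_⟩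
    · rw [map_add, h v, h' v]
      simp only [map_add, Pi.add_apply]
      ring
    · simp only [map_add, ← h1, ← h1', Pi.add_apply]; ring
    · simp only [map_add, ← h2, ← h2', Pi.add_apply]
    · simp only [map_add, ← h3, ← h3', Pi.add_apply]
    · simp only [map_add, ← h4, ← h4', Pi.add_apply]; ring
  | mul_X f j hf =>
    obtain ⟨A, B, C, hA, hB, hC, h, h1, h2, h3, h4⟩ := hf
    have hj : ContDiff ℂ 1 fun v : Fin 2 → ℂ => v j := by fun_prop
    set a := MvPolynomial.eval q (pderiv 0 f)
    set b := MvPolynomial.eval q (pderiv 1 f)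
    fin_cases j
    · refine ⟨fun v => A v * v 0 + a, fun v => B v * v 0 + b, fun v => C v * v 0,
        by fun_prop, by fun_prop, by fun_prop, fun v => ?_, ?_, ?_, ?_, ?_⟩
      · simp [h v, pderiv_X]
        ring
      · simp [pderiv_X, ← h1]
        ring
      · simp [pderiv_X, ← h2]
        ring
      · simp [pderiv_X, ← h3]
        ring
      · simp [pderiv_X, ← h4]
        ring
    · refine ⟨fun v => A v * v 1, fun v => B v * v 1 + a, fun v => C v * v 1 + b,
        by fun_prop, by fun_prop, by fun_prop, fun v => ?_, ?_, ?_, ?_, ?_⟩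
      · simp [h v, pderiv_X]
        ring
      · simp [pderiv_X, ← h1]
        ring
      · simp [pderiv_X, ← h2]
        ring
      · simp [pderiv_X, ← h3]
        ring
      · simp [pderiv_X, ← h4]
        ring

lemma exists_local_sqrt {E : Type*} [NormedAddCommGroup E] [NormedSpace ℂ E] {D : E → ℂ} {q : E}
    (hD : ContDiffAt ℂ 1 D q) (h0 : D q ≠ 0) (B : ℂ) :
    ∃ R : E → ℂ, ContDiffAt ℂ 1 R q ∧ (∀ v, R v ^ 2 = D v ∨ D v = 0) ∧ R q ≠ 0 ∧ B + R q ≠ 0 := by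
  obtain ⟨r, hr⟩ := IsAlgClosed.exists_pow_nat_eq (D q) (n := 2) two_pos
  have hr0 : r ≠ 0 := by
    rintro rfl
    exact h0 (by rw [← hr]; simp)
  obtain ⟨s, hs, hs0, hBs⟩ : ∃ s : ℂ, s ^ 2 = D q ∧ s ≠ 0 ∧ B + s ≠ 0 := by
    by_cases h : B + r = 0
    · refine ⟨-r, by rw [neg_sq, hr], neg_ne_zero.2 hr0, fun h' => hr0 ?_⟩
      linear_combination (h - h') / 2
    · exact ⟨r, hr, hr0, h⟩
  have hq : Complex.exp (Complex.log (D q / D q) / 2) = 1 := by simp [h0]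
  refine ⟨fun v => s * Complex.exp (Complex.log (D v / D q) / 2), ?_, fun v => ?_, ?_, ?_⟩
  · have h1 : ContDiffAt ℂ 1 (fun v => D v / D q) q := hD.div_const _
    have h2 : ContDiffAt ℂ 1 (fun v => Complex.log (D v / D q)) q :=
      (Complex.contDiffAt_log (by simp [h0])).comp q h1
    exact contDiffAt_const.mul (h2.div_const 2).cexp
  · by_cases h : D v = 0
    · exact Or.inr h
    · left
      rw [mul_pow, hs, ← Complex.exp_nat_mul]
      push_cast
      rw [mul_div_cancel₀ _ two_ne_zero, Complex.exp_log (div_ne_zero h h0), mul_div_cancel₀ _ h0]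
  · simpa [hq] using hs0
  · simpa [hq] using hBs

end Taylor

section Local

lemma exists_equiv_of_injective {L : ℂ × ℂ →L[ℂ] ℂ × ℂ} (h : ∀ v, L v = 0 → v = 0) :
    ∃ L' : (ℂ × ℂ) ≃L[ℂ] ℂ × ℂ, (L' : ℂ × ℂ →L[ℂ] ℂ × ℂ) = L := by
  have hinj : Function.Injective (L : ℂ × ℂ →ₗ[ℂ] ℂ × ℂ) :=
    (injective_iff_map_eq_zero _).2 h
  exact ⟨(LinearEquiv.ofInjectiveEndo _ hinj).toContinuousLinearEquiv, by ext <;> rfl⟩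

/-- Local normal form of a plane curve at a node. -/
lemma exists_node_chart {g : MvPolynomial (Fin 2) ℂ} {q : Fin 2 → ℂ}
    (hg : MvPolynomial.eval q g = 0) (h0 : ∀ j, MvPolynomial.eval q (pderiv j g) = 0)
    (hdet : Matrix.det !![MvPolynomial.eval q (pderiv 0 (pderiv 0 g)),
      MvPolynomial.eval q (pderiv 1 (pderiv 0 g)); MvPolynomial.eval q (pderiv 0 (pderiv 1 g)),
      MvPolynomial.eval q (pderiv 1 (pderiv 1 g))] ≠ 0) :
    ∃ (Θ : (Fin 2 → ℂ) → ℂ × ℂ) (L : (Fin 2 → ℂ) →L[ℂ] ℂ × ℂ), HasStrictFDerivAt Θ L q ∧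
      Θ q = 0 ∧ (∀ v, L v = 0 → v = 0) ∧
      ∀ᶠ v in 𝓝 q, MvPolynomial.eval v g ≠ 0 ↔ (Θ v).1 ≠ 0 ∧ (Θ v).2 ≠ 0 := by
  obtain ⟨A, B, C, hA, hB, hC, h, h1, h2, h3, h4⟩ := exists_taylor_two g q
  simp only [hg, h0, zero_mul, zero_add] at h
  rw [Matrix.det_fin_two_of, ← h1, ← h2, ← h3, ← h4] at hdet
  have hdisc : B q ^ 2 - 4 * A q * C q ≠ 0 := fun h => hdet (by linear_combination -h)
  obtain ⟨R, hR, hR2, hR0, hBR⟩ := exists_local_sqrt (D := fun v => B v ^ 2 - 4 * A v * C v)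
    (by fun_prop) hdisc (B q)
  have hRq := (hR2 q).resolve_right hdisc
  have hE : ContDiffAt ℂ 1 (fun v => (B v + R v) / 2) q := by fun_prop
  have strict : ∀ {f : (Fin 2 → ℂ) → ℂ}, ContDiffAt ℂ 1 f q → ∀ j : Fin 2,
      HasStrictFDerivAt (fun v => f v * (v j - q j))
        (f q • (ContinuousLinearMap.proj j : (Fin 2 → ℂ) →L[ℂ] ℂ)) q := by
    intro f hf j
    refine ((hf.hasStrictFDerivAt one_ne_zero).mul
      ((ContinuousLinearMap.proj (R := ℂ) (φ := fun _ : Fin 2 => ℂ) j).hasStrictFDerivAt.sub_const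
        (q j))).congr_fderiv (ContinuousLinearMap.ext fun v => ?_)
    simp
  refine ⟨fun v => ((B v + R v) / 2 * (v 1 - q 1) + A v * (v 0 - q 0),
    C v * (v 1 - q 1) + (B v + R v) / 2 * (v 0 - q 0)), _,
    ((strict hE 1).add (strict hA.contDiffAt 0)).prodMk
      ((strict hC.contDiffAt 1).add (strict hE 0)), by simp, fun v hv => ?_, ?_⟩
  · simp only [ContinuousLinearMap.prod_apply, Prod.mk_eq_zero] at hv
    obtain ⟨hv1, hv2⟩ := hv
    simp at hv1 hv2
    have hd : (B q + R q) * R q ≠ 0 := mul_ne_zero hBR hR0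
    have e0 : (B q + R q) * R q * v 0 = 0 := by
      linear_combination (-2 * C q) * hv1 + (B q + R q) * hv2 + v 0 / 2 * hRq
    have e1 : (B q + R q) * R q * v 1 = 0 := by
      linear_combination (-2 * A q) * hv2 + (B q + R q) * hv1 + v 1 / 2 * hRq
    have e0' := (mul_eq_zero.1 e0).resolve_left hd
    have e1' := (mul_eq_zero.1 e1).resolve_left hd
    ext j
    fin_cases j
    · exact e0'
    · exact e1'
  · have c1 : ∀ᶠ v in 𝓝 q, B v ^ 2 - 4 * A v * C v ≠ 0 := by
      have : ContinuousAt (fun v => B v ^ 2 - 4 * A v * C v) q :=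
        (by fun_prop : ContDiffAt ℂ 1 (fun v => B v ^ 2 - 4 * A v * C v) q).continuousAt
      exact this.eventually_ne hdisc
    have c2 : ∀ᶠ v in 𝓝 q, B v + R v ≠ 0 := by
      have : ContinuousAt (fun v => B v + R v) q :=
        (by fun_prop : ContDiffAt ℂ 1 (fun v => B v + R v) q).continuousAt
      exact this.eventually_ne hBR
    filter_upwards [c1, c2] with v hv1 hv2
    have hRv := (hR2 v).resolve_right hv1
    rw [← mul_ne_zero_iff]
    have : ((B v + R v) / 2 * (v 1 - q 1) + A v * (v 0 - q 0)) *
        (C v * (v 1 - q 1) + (B v + R v) / 2 * (v 0 - q 0)) =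
        (B v + R v) / 2 * MvPolynomial.eval v g := by
      rw [h v]
      linear_combination ((v 0 - q 0) * (v 1 - q 1) / 4) * hRv
    rw [this]
    simp [hv2]

end Local

section Curve

lemma locComm_of_injective {Ω : Set (ℂ × ℂ)} {c : ℂ × ℂ} {Θ : ℂ × ℂ → ℂ × ℂ}
    {L : ℂ × ℂ →L[ℂ] ℂ × ℂ} (hΘ : HasStrictFDerivAt Θ L c) (hL : ∀ v, L v = 0 → v = 0)
    (h0 : Θ c = 0) (sm : Prop)
    (hΩ : ∀ᶠ q in 𝓝 c, q ∈ Ω ↔ (Θ q).1 ≠ 0 ∧ ((Θ q).2 ≠ 0 ∨ sm)) : LocComm Ω c := by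
  obtain ⟨L, rfl⟩ := exists_equiv_of_injective hL
  exact locComm_of_chart hΘ h0 sm hΩ

lemma eq_or_eq_chartIncl (k i : Fin 3) : i = k ∨ ∃ j, i = chartIncl k j := by
  revert k i
  decide

variable {F : MvPolynomial (Fin 3) ℂ} {e u w : Fin 3 → ℂ} {d : ℕ}

lemma eval_dehom (hF : F.IsHomogeneous d) (k : Fin 3) {v : Fin 3 → ℂ} (hv : v k ≠ 0) :
    MvPolynomial.eval v F =
      v k ^ d * MvPolynomial.eval (fun j => v (chartIncl k j) / v k) (dehom k F) := by
  have h1 : MvPolynomial.eval (fun j => v (chartIncl k j) / v k) (dehom k F) =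
      MvPolynomial.eval ((v k)⁻¹ • v) F := by
    rw [dehom, ← MvPolynomial.coe_aeval_eq_eval, ← MvPolynomial.coe_aeval_eq_eval]
    show MvPolynomial.aeval _ (MvPolynomial.aeval _ F) = MvPolynomial.aeval _ F
    rw [← AlgHom.comp_apply, MvPolynomial.comp_aeval]
    congr 2
    funext i
    have hinv : (v k)⁻¹ * v k = 1 := inv_mul_cancel₀ hv
    fin_cases k <;> fin_cases i <;> simp [chartIncl] <;>
      first | exact hinv.symm | exact div_eq_inv_mul _ _
  rw [h1, eval_smul_of_homogeneous hF, inv_pow, mul_inv_cancel_left₀ (pow_ne_zero _ hv)]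

/-- The derivative of a polynomial at a point, as a linear functional. -/
noncomputable def grad (F : MvPolynomial (Fin 3) ℂ) (p : Fin 3 → ℂ) : (Fin 3 → ℂ) →L[ℂ] ℂ :=
  ∑ i, MvPolynomial.eval p (pderiv i F) • ContinuousLinearMap.proj i

lemma grad_apply (p v : Fin 3 → ℂ) :
    grad F p v = ∑ i, MvPolynomial.eval p (pderiv i F) * v i := by
  simp [grad]

lemma grad_self (hF : F.IsHomogeneous d) (p : Fin 3 → ℂ) :
    grad F p p = d * MvPolynomial.eval p F := by
  have := congrArg (MvPolynomial.eval p) hF.sum_X_mul_pderiv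
  simpa [grad_apply, mul_comm] using this

lemma grad_ne_zero (hli : LinearIndependent ℂ ![u, e, w]) (hF : F.IsHomogeneous d) {x y : ℂ}
    (h0 : MvPolynomial.eval (pt e u w x y) F = 0)
    (hs : ∃ i, MvPolynomial.eval (pt e u w x y) (pderiv i F) ≠ 0) :
    grad F (pt e u w x y) u ≠ 0 ∨ grad F (pt e u w x y) e ≠ 0 := by
  by_contra! h
  obtain ⟨hu, he⟩ := h
  have hp := grad_self hF (pt e u w x y)
  rw [h0, mul_zero] at hp
  have hw : grad F (pt e u w x y) w = 0 := by
    have h1 : grad F (pt e u w x y) (w + x • u + y • e) = 0 := hp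
    simpa only [map_add, map_smul, hu, he, smul_zero, add_zero] using h1
  have hspan := hli.span_eq_top_of_card_eq_finrank (by simp)
  have hz : (grad F (pt e u w x y) : (Fin 3 → ℂ) →ₗ[ℂ] ℂ) = 0 := by
    refine LinearMap.ext_on_range hspan fun i => ?_
    fin_cases i <;> simpa
  obtain ⟨i, hi⟩ := hs
  refine hi ?_
  have := LinearMap.congr_fun hz (Pi.single i 1)
  simpa [grad_apply, Pi.single_apply] using this

lemma hasStrictFDerivAt_pt (c : ℂ × ℂ) :
    HasStrictFDerivAt (fun q : ℂ × ℂ => pt e u w q.1 q.2)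
      ((ContinuousLinearMap.fst ℂ ℂ ℂ).smulRight u + (ContinuousLinearMap.snd ℂ ℂ ℂ).smulRight e)
      c := by
  have h := (((ContinuousLinearMap.fst ℂ ℂ ℂ).smulRight u +
    (ContinuousLinearMap.snd ℂ ℂ ℂ).smulRight e).hasStrictFDerivAt (x := c)).const_add w
  refine h.congr_of_eventuallyEq (Eventually.of_forall fun q => ?_)
  simp [pt, add_assoc]

theorem locComm_curve (hF : F.IsHomogeneous d) (hli : LinearIndependent ℂ ![u, e, w])
    (hnodal : ∀ p : Fin 3 → ℂ, p ≠ 0 → MvPolynomial.eval p F = 0 →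
      (∀ i, MvPolynomial.eval p (pderiv i F) = 0) → IsOrdinaryNodeAt F p)
    {c : ℂ × ℂ} (hc : (fib F e u w c.1).eval c.2 = 0) :
    LocComm {q : ℂ × ℂ | (fib F e u w q.1).eval q.2 ≠ 0} c := by
  rw [fib_eval] at hc
  have hli' : ∀ a b t : ℂ, a • u + b • e + t • pt e u w c.1 c.2 = 0 → a = 0 ∧ b = 0 ∧ t = 0 := by
    intro a b t h
    have h3 := Fintype.linearIndependent_iff.1 hli ![a + t * c.1, b + t * c.2, t] (by
      rw [Fin.sum_univ_three, ← h]
      simp only [pt, Matrix.cons_val_zero, Matrix.cons_val_one, Matrix.cons_val]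
      module)
    have h30 := h3 0
    have h31 := h3 1
    have h32 := h3 2
    simp at h30 h31 h32
    subst h32
    simp at h30 h31
    exact ⟨h30, h31, rfl⟩
  by_cases hs : ∀ i, MvPolynomial.eval (pt e u w c.1 c.2) (pderiv i F) = 0
  · have hp0 : pt e u w c.1 c.2 ≠ 0 := by
      intro h
      have := hli' 0 0 1 (by simp [h])
      simp at this
    obtain ⟨k, hk, h1, h2⟩ := hnodal _ hp0 hc hs
    set p := pt e u w c.1 c.2 with hp
    have hg : MvPolynomial.eval (fun j => p (chartIncl k j) / p k) (dehom k F) = 0 := by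
      have := eval_dehom hF k hk
      rw [hc] at this
      exact (mul_eq_zero.1 this.symm).resolve_left (pow_ne_zero _ hk)
    obtain ⟨Θ, L, hΘ, hΘ0, hL, hev⟩ := exists_node_chart hg h1 h2
    have hpt := hasStrictFDerivAt_pt (e := e) (u := u) (w := w) c
    set M := (ContinuousLinearMap.fst ℂ ℂ ℂ).smulRight u +
      (ContinuousLinearMap.snd ℂ ℂ ℂ).smulRight e with hM
    have hcoord : ∀ i, HasStrictFDerivAt (fun q : ℂ × ℂ => pt e u w q.1 q.2 i)
        ((ContinuousLinearMap.proj i).comp M) c := fun i =>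
      (ContinuousLinearMap.proj (R := ℂ) (φ := fun _ : Fin 3 => ℂ) i).hasStrictFDerivAt.comp c hpt
    set π : ℂ × ℂ → Fin 2 → ℂ := fun q j =>
      pt e u w q.1 q.2 (chartIncl k j) / pt e u w q.1 q.2 k with hπ
    have hk' : ∀ᶠ q : ℂ × ℂ in 𝓝 c, pt e u w q.1 q.2 k ≠ 0 :=
      (hcoord k).hasFDerivAt.continuousAt.eventually_ne hk
    have hpoly : ∀ i, ContDiff ℂ 1 fun q : ℂ × ℂ => pt e u w q.1 q.2 i := by
      intro i
      simp only [pt, Pi.add_apply, Pi.smul_apply]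
      fun_prop
    have hQ : HasStrictFDerivAt π (fderiv ℂ π c) c := by
      refine ContDiffAt.hasStrictFDerivAt (n := 1) (contDiffAt_pi.2 fun j => ?_) one_ne_zero
      exact (hpoly _).contDiffAt.div (hpoly _).contDiffAt hk
    set Q := fderiv ℂ π c
    have hQM : ∀ j v, M v (chartIncl k j) = p k * Q v j + M v k * π c j := by
      intro j v
      have h1 := (hcoord k).hasFDerivAt.mul
        ((ContinuousLinearMap.proj (R := ℂ) (φ := fun _ : Fin 2 => ℂ) j).hasFDerivAt.comp c
          hQ.hasFDerivAt)
      have h2 : HasFDerivAt (fun q : ℂ × ℂ => pt e u w q.1 q.2 (chartIncl k j)) _ c :=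
        h1.congr_of_eventuallyEq (by
          filter_upwards [hk'] with q hq
          simp only [Pi.mul_apply, hπ, Function.comp_apply, ContinuousLinearMap.proj_apply]
          rw [mul_div_cancel₀ _ hq])
      have h3 := congrArg (fun L => L v) ((hcoord (chartIncl k j)).hasFDerivAt.unique h2)
      simp only [ContinuousLinearMap.comp_apply, ContinuousLinearMap.proj_apply,
        add_apply, smul_apply, smul_eq_mul,
        Function.comp_apply] at h3
      rw [h3, mul_comm (M v k)]
    refine locComm_of_injective (hΘ.comp c hQ) (fun v hv => ?_) hΘ0 False ?_
    · have hv' : Q v = 0 := hL _ hv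
      have hall : ∀ i, p k * M v i = M v k * p i := by
        intro i
        rcases eq_or_eq_chartIncl k i with rfl | ⟨j, rfl⟩
        · ring
        · rw [hQM j v, hv']
          simp only [Pi.zero_apply, mul_zero, zero_add, hπ, ← hp]
          field_simp
      obtain ⟨h3, h4, -⟩ := hli' (p k * v.1) (p k * v.2) (-(M v k)) (by
        ext i
        have := hall i
        simp only [hM, add_apply, ContinuousLinearMap.smulRight_apply,
          ContinuousLinearMap.coe_fst', ContinuousLinearMap.coe_snd', Pi.add_apply,
          Pi.smul_apply, smul_eq_mul, Pi.zero_apply] at this ⊢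
        linear_combination this)
      exact Prod.ext ((mul_eq_zero.1 h3).resolve_left hk) ((mul_eq_zero.1 h4).resolve_left hk)
    · filter_upwards [hk', hQ.hasFDerivAt.continuousAt.eventually hev] with q hq hq'
      simp only [fib_eval, or_false]
      rw [← hq', eval_dehom hF k hq]
      simp [hq, hπ]
  · push Not at hs
    set a := grad F (pt e u w c.1 c.2) u with ha
    set b := grad F (pt e u w c.1 c.2) e with hb
    have hab : a ≠ 0 ∨ b ≠ 0 := grad_ne_zero hli hF hc hs
    have hst := (hasStrictFDerivAt_eval F (pt e u w c.1 c.2)).comp c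
      (hasStrictFDerivAt_pt (e := e) (u := u) (w := w) c)
    obtain ⟨r, s, hrs⟩ : ∃ r s : ℂ, a * s - b * r ≠ 0 := by
      rcases hab with h | h
      · exact ⟨0, 1, by simpa using h⟩
      · exact ⟨1, 0, by simpa using h⟩
    have hlin := (((r • ContinuousLinearMap.fst ℂ ℂ ℂ + s • ContinuousLinearMap.snd ℂ ℂ ℂ)
      ).hasStrictFDerivAt (x := c)).sub_const (r * c.1 + s * c.2)
    refine locComm_of_injective (hst.prodMk hlin) (fun v hv => ?_) ?_ True ?_
    · have h1 : grad F (pt e u w c.1 c.2) (v.1 • u + v.2 • e) = 0 := congrArg Prod.fst hv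
      have h2' : r * v.1 + s * v.2 = 0 := congrArg Prod.snd hv
      have h1' : a * v.1 + b * v.2 = 0 := by
        rw [map_add, map_smul, map_smul, smul_eq_mul, smul_eq_mul] at h1
        rw [← h1, mul_comm a, mul_comm b]
      have e1 : (a * s - b * r) * v.1 = 0 := by linear_combination s * h1' - b * h2'
      have e2 : (a * s - b * r) * v.2 = 0 := by linear_combination a * h2' - r * h1'
      exact Prod.ext ((mul_eq_zero.1 e1).resolve_left hrs) ((mul_eq_zero.1 e2).resolve_left hrs)
    · simp [hc]
    · exact Eventually.of_forall fun q => by simp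

end Curve

section Coordinates

variable {F : MvPolynomial (Fin 3) ℂ} {d : ℕ}

/-- An irreducible polynomial over a unique factorization domain of characteristic zero satisfies a
Bézout identity with its derivative, up to a constant. -/
lemma exists_bezout_derivative {A : Type*} [CommRing A] [IsDomain A] [NormalizedGCDMonoid A]
    [CharZero A] {p : Polynomial A} (hp : Irreducible p) (hdeg : p.natDegree ≠ 0) :
    ∃ (U V : Polynomial A) (r : A), r ≠ 0 ∧ U * p + V * p.derivative = Polynomial.C r := by
  set φ : A →+* FractionRing A := algebraMap _ _ with hφdef
  have hφ : Function.Injective φ := IsFractionRing.injective A (FractionRing A)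
  have hK : CharZero (FractionRing A) := charZero_of_injective_algebraMap hφ
  have hirr : Irreducible (p.map φ) :=
    ((hp.isPrimitive hdeg).irreducible_iff_irreducible_map_fraction_map).1 hp
  obtain ⟨U, V, hUV⟩ := hirr.separable
  obtain ⟨c1, U', hc1, hU'⟩ := exists_integral_multiple (A := A) U
  obtain ⟨c2, V', hc2, hV'⟩ := exists_integral_multiple (A := A) V
  rw [← hφdef] at hU' hV'
  refine ⟨Polynomial.C c2 * U', Polynomial.C c1 * V', c1 * c2, mul_ne_zero hc1 hc2,
    Polynomial.map_injective _ hφ ?_⟩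
  simp only [Polynomial.map_add, Polynomial.map_mul, Polynomial.map_C, hU', hV',
    ← Polynomial.derivative_map, map_mul]
  linear_combination (Polynomial.C (φ c1) * Polynomial.C (φ c2)) * hUV

/-- The substitution `X_i ↦ X_i + e_i T`, as an endomorphism of `ℂ[X₀, X₁, X₂][T]`. -/
noncomputable def shear (e : Fin 3 → ℂ) :
    Polynomial (MvPolynomial (Fin 3) ℂ) →+* Polynomial (MvPolynomial (Fin 3) ℂ) :=
  Polynomial.eval₂RingHom
    (MvPolynomial.aeval (R := ℂ) fun i => Polynomial.C (MvPolynomial.X i) +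
      Polynomial.C (MvPolynomial.C (e i)) * Polynomial.X).toRingHom Polynomial.X

lemma shear_C (e : Fin 3 → ℂ) (G : MvPolynomial (Fin 3) ℂ) :
    shear e (Polynomial.C G) = univLinePoly G e := by
  simp [shear, univLinePoly]

lemma shear_X (e : Fin 3 → ℂ) : shear e Polynomial.X = Polynomial.X := by
  simp [shear]

lemma shear_neg_shear (e : Fin 3 → ℂ) (p : Polynomial (MvPolynomial (Fin 3) ℂ)) :
    shear (-e) (shear e p) = p := by
  induction p using Polynomial.induction_on' with
  | add p q hp hq => simp only [map_add, hp, hq]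
  | monomial n G =>
    rw [← Polynomial.C_mul_X_pow_eq_monomial]
    simp only [map_mul, map_pow, shear_X, shear_C]
    congr 1
    induction G using MvPolynomial.induction_on with
    | C c =>
      have h : univLinePoly (MvPolynomial.C c) e = Polynomial.C (MvPolynomial.C c) := by
        simp [univLinePoly, IsScalarTower.algebraMap_apply ℂ (MvPolynomial (Fin 3) ℂ)
          (Polynomial (MvPolynomial (Fin 3) ℂ))]
      have h' : univLinePoly (MvPolynomial.C c) (-e) = Polynomial.C (MvPolynomial.C c) := by
        simp [univLinePoly, IsScalarTower.algebraMap_apply ℂ (MvPolynomial (Fin 3) ℂ)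
          (Polynomial (MvPolynomial (Fin 3) ℂ))]
      rw [h, shear_C, h']
    | add p q hp hq =>
      rw [show univLinePoly (p + q) e = univLinePoly p e + univLinePoly q e by
        simp [univLinePoly], map_add, hp, hq, map_add]
    | mul_X p i hp =>
      rw [show univLinePoly (p * MvPolynomial.X i) e = univLinePoly p e *
        (Polynomial.C (MvPolynomial.X i) + Polynomial.C (MvPolynomial.C (e i)) * Polynomial.X) by
        simp [univLinePoly], map_mul, hp, map_mul]
      congr 1
      have h' : univLinePoly (MvPolynomial.C (e i)) (-e) = Polynomial.C (MvPolynomial.C (e i)) := by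
        simp [univLinePoly, IsScalarTower.algebraMap_apply ℂ (MvPolynomial (Fin 3) ℂ)
          (Polynomial (MvPolynomial (Fin 3) ℂ))]
      rw [map_add, map_mul, shear_X, shear_C, shear_C, h']
      simp [univLinePoly, add_assoc, ← add_mul]

lemma irreducible_univLinePoly (hirr : Irreducible F) (e : Fin 3 → ℂ) :
    Irreducible (univLinePoly F e) := by
  have hC : Irreducible (Polynomial.C F) := (Polynomial.prime_C_iff.2 hirr.prime).irreducible
  let Φ : Polynomial (MvPolynomial (Fin 3) ℂ) ≃+* Polynomial (MvPolynomial (Fin 3) ℂ) :=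
    RingEquiv.ofRingHom (shear e) (shear (-e))
      (RingHom.ext fun p => by simpa using shear_neg_shear (-e) p)
      (RingHom.ext fun p => by simpa using shear_neg_shear e p)
  rw [← shear_C]
  exact (MulEquiv.irreducible_iff Φ.toMulEquiv).2 hC

lemma lineDisc_ne_zero (hF : F.IsHomogeneous d) (hd : 1 ≤ d) (hirr : Irreducible F)
    {e : Fin 3 → ℂ} (he : MvPolynomial.eval e F ≠ 0) : lineDisc F e d ≠ 0 := by
  classical
  obtain ⟨inst⟩ : Nonempty (NormalizedGCDMonoid (MvPolynomial (Fin 3) ℂ)) :=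
    inferInstance
  have hdeg : (univLinePoly F e).natDegree ≠ 0 := by
    have h1 : (linePoly F e 0).natDegree ≤ (univLinePoly F e).natDegree := by
      rw [← univLinePoly_map]
      exact Polynomial.natDegree_map_le
    rw [linePoly_natDegree e 0 hF he] at h1
    omega
  obtain ⟨U, V, r, hr, h⟩ := exists_bezout_derivative (irreducible_univLinePoly hirr e) hdeg
  obtain ⟨v, hv⟩ : ∃ v, MvPolynomial.eval v r ≠ 0 := by
    by_contra! h0
    exact hr (MvPolynomial.funext fun v => by simpa using h0 v)
  have hsep : (linePoly F e v).Separable := by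
    rw [separable_iff_roots]
    intro x hx hx'
    have := congrArg (fun p => (p.map (MvPolynomial.eval v)).eval x) h
    simp only [Polynomial.map_add, Polynomial.map_mul, ← Polynomial.derivative_map,
      univLinePoly_map, Polynomial.eval_add, Polynomial.eval_mul, hx, hx', Polynomial.map_C,
      Polynomial.eval_C, mul_zero, add_zero] at this
    exact hv this.symm
  intro h0
  rw [← lineDisc_eval_ne_zero v hF he, h0, map_zero] at hsep
  exact hsep rfl

lemma linePoly_smul_eval (hF : F.IsHomogeneous d) (e v : Fin 3 → ℂ) {c : ℂ} (hc : c ≠ 0) (t : ℂ) :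
    (linePoly F e (c • v)).eval t = c ^ d * (linePoly F e v).eval (c⁻¹ * t) := by
  rw [linePoly_eval, linePoly_eval, ← eval_smul_of_homogeneous hF]
  congr 2
  rw [smul_add, smul_smul, mul_inv_cancel_left₀ hc]

lemma separable_smul (hF : F.IsHomogeneous d) {e v : Fin 3 → ℂ} {c : ℂ} (hc : c ≠ 0)
    (h : (linePoly F e v).Separable) : (linePoly F e (c • v)).Separable := by
  have heq : linePoly F e (c • v) =
      Polynomial.C (c ^ d) * (linePoly F e v).comp (Polynomial.C c⁻¹ * Polynomial.X) :=
    Polynomial.funext fun t => by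
      rw [linePoly_smul_eval hF e v hc]
      simp
  rw [heq, separable_iff_roots] at *
  intro x hx
  have := h (c⁻¹ * x) (by simpa [hc] using hx)
  rw [Polynomial.derivative_C_mul, Polynomial.derivative_comp]
  simpa [hc] using this

/-- Generic linear coordinates for an irreducible plane curve. -/
theorem exists_coordinates (hF : F.IsHomogeneous d) (hd : 1 ≤ d) (hirr : Irreducible F) :
    ∃ u e w : Fin 3 → ℂ, MvPolynomial.eval e F ≠ 0 ∧ (linePoly F e u).Separable ∧
      LinearIndependent ℂ ![u, e, w] ∧ {x | ¬ (fib F e u w x).Separable}.Finite := by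
  obtain ⟨e, he⟩ : ∃ e, MvPolynomial.eval e F ≠ 0 := by
    by_contra! h0
    exact hirr.ne_zero (MvPolynomial.funext fun v => by simpa using h0 v)
  have he0 : e ≠ 0 := by
    rintro rfl
    have := eval_smul_of_homogeneous hF 0 0
    rw [zero_pow (by omega), zero_mul, smul_zero] at this
    exact he this
  obtain ⟨i, hi⟩ := Function.ne_iff.1 he0
  obtain ⟨j, hj⟩ : ∃ j : Fin 3, j ≠ i := exists_ne i
  set P : MvPolynomial (Fin 3) ℂ :=
    MvPolynomial.C (e i) * MvPolynomial.X j - MvPolynomial.C (e j) * MvPolynomial.X i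
  have hP : P ≠ 0 := by
    intro h
    have := congrArg (MvPolynomial.eval (Pi.single j 1)) h
    simp [P, hj.symm] at this
    exact hi this
  obtain ⟨u, hu⟩ : ∃ u, MvPolynomial.eval u (lineDisc F e d * P) ≠ 0 := by
    by_contra! h0
    exact mul_ne_zero (lineDisc_ne_zero hF hd hirr he) hP
      (MvPolynomial.funext fun v => by simpa using h0 v)
  rw [map_mul] at hu
  have hu1 := (lineDisc_eval_ne_zero u hF he).1 (left_ne_zero_of_mul hu)
  have hu2 := right_ne_zero_of_mul hu
  have hli2 : LinearIndependent ℂ ![u, e] := by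
    rw [LinearIndependent.pair_iff]
    intro s t hst
    have hi' := congrFun hst i
    have hj' := congrFun hst j
    simp only [Pi.add_apply, Pi.smul_apply, smul_eq_mul, Pi.zero_apply] at hi' hj'
    have hs : s = 0 := by
      refine (mul_eq_zero.1 (?_ : s * MvPolynomial.eval u P = 0)).resolve_right hu2
      simp only [P, map_sub, map_mul, MvPolynomial.eval_C, MvPolynomial.eval_X]
      linear_combination e i * hj' - e j * hi'
    subst hs
    simp only [zero_mul, zero_add] at hi'
    exact ⟨rfl, (mul_eq_zero.1 hi').resolve_right hi⟩
  obtain ⟨w, hw⟩ := exists_linearIndependent_snoc_of_lt_finrank hli2 (by simp)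
  refine ⟨u, e, w, he, hu1, ?_, ?_⟩
  · have h : (![u, e, w] : Fin 3 → Fin 3 → ℂ) = Fin.snoc ![u, e] w := by
      funext k
      fin_cases k <;> rfl
    rw [h]
    exact hw
  · have hfin := thin_zeros (lineDisc F e d) u (by simpa using left_ne_zero_of_mul hu) (u + w)
    refine ((hfin.image fun x => x⁻¹).union (Set.finite_singleton (0 : ℂ))).subset fun x hx => ?_
    by_cases hx0 : x = 0
    · exact Or.inr hx0
    · refine Or.inl ⟨x⁻¹, ?_, inv_inv x⟩
      by_contra hne
      have := (lineDisc_eval_ne_zero (u + x⁻¹ • w) hF he).1 (by simpa using hne)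
      refine hx ?_
      have h2 := separable_smul hF hx0 this
      rwa [smul_add, smul_smul, mul_inv_cancel₀ hx0, one_smul, add_comm] at h2

end Coordinates

section Gap

variable {F : MvPolynomial (Fin 3) ℂ} {e u w : Fin 3 → ℂ} {d : ℕ}

lemma isOpen_separable (hF : F.IsHomogeneous d) (he : MvPolynomial.eval e F ≠ 0) :
    IsOpen {v | (linePoly F e v).Separable} := by
  have : {v | (linePoly F e v).Separable} = {v | MvPolynomial.eval v (lineDisc F e d) ≠ 0} :=
    Set.ext fun v => (lineDisc_eval_ne_zero v hF he).symm
  rw [this]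
  exact isOpen_ne_fun (MvPolynomial.continuous_eval _) continuous_const

lemma locTriv_linePoly (hF : F.IsHomogeneous d) (he : MvPolynomial.eval e F ≠ 0) :
    LocTriv fun b : SepBase F e => {y | (linePoly F e b.1).eval y = 0} :=
  (polyFam_linePoly hF he (continuous_subtype_val (p := fun v => (linePoly F e
      v).Separable))).locTriv
    fun b => b.2

/-- Distinct roots stay apart near a line which is transverse to the curve. -/
lemma linePoly_gap (hF : F.IsHomogeneous d) (he : MvPolynomial.eval e F ≠ 0) {v : Fin 3 → ℂ}
    (hv : (linePoly F e v).Separable) :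
    ∃ δ > 0, ∀ᶠ v' in 𝓝 v, ∀ y, (linePoly F e v').eval y = 0 → ∀ y', (linePoly F e v').eval y' = 0 →
      y ≠ y' → δ < dist y y' := by
  obtain ⟨δ, hδ, h⟩ := (locTriv_linePoly hF he).gap ⟨v, hv⟩
  refine ⟨δ, hδ, ?_⟩
  have h1 : ∀ᶠ v' in 𝓝[{v | (linePoly F e v).Separable}] v, ∀ y, (linePoly F e v').eval y = 0 →
      ∀ y', (linePoly F e v').eval y' = 0 → y ≠ y' → δ < dist y y' :=
    (eventually_nhds_subtype_iff {v | (linePoly F e v).Separable} ⟨v, hv⟩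
      (fun v' => ∀ y, (linePoly F e v').eval y = 0 →
      ∀ y', (linePoly F e v').eval y' = 0 → y ≠ y' → δ < dist y y')).1 h
  rwa [(isOpen_separable hF he).nhdsWithin_eq hv] at h1

lemma fib_gap (hF : F.IsHomogeneous d) (he : MvPolynomial.eval e F ≠ 0) {x : ℂ}
    (hx : (fib F e u w x).Separable) :
    ∃ δ > 0, ∀ᶠ x' in 𝓝 x, ∀ y, (fib F e u w x').eval y = 0 → ∀ y', (fib F e u w x').eval y' = 0 →
      y ≠ y' → δ < dist y y' := by
  obtain ⟨δ, hδ, h⟩ := linePoly_gap hF he hx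
  have hc : Continuous fun x : ℂ => w + x • u := by fun_prop
  exact ⟨δ, hδ, hc.continuousAt.eventually h⟩

lemma isOpen_separable_fib (hF : F.IsHomogeneous d) (he : MvPolynomial.eval e F ≠ 0) :
    IsOpen {x | (fib F e u w x).Separable} :=
  (isOpen_separable hF he).preimage (by fun_prop : Continuous fun x : ℂ => w + x • u)

/-- Over a closed set of transverse fibres the distance between distinct roots grows at least
linearly. -/
lemma fib_gap_of_isClosed (hF : F.IsHomogeneous d) (he : MvPolynomial.eval e F ≠ 0)
    (hu : (linePoly F e u).Separable) {S : Set ℂ} (hS : IsClosed S)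
    (hsep : ∀ x ∈ S, (fib F e u w x).Separable) :
    ∃ κ > 0, ∀ x ∈ S, ∀ y, (fib F e u w x).eval y = 0 → ∀ y', (fib F e u w x).eval y' = 0 →
      y ≠ y' → κ * (1 + ‖x‖) < dist y y' := by
  obtain ⟨R, hR, κ, hκ, hinf⟩ : ∃ R > (0 : ℝ), ∃ κ > 0, ∀ x : ℂ, R ≤ ‖x‖ → ∀ y,
      (fib F e u w x).eval y = 0 → ∀ y', (fib F e u w x).eval y' = 0 → y ≠ y' →
      κ * (1 + ‖x‖) < dist y y' := by
    obtain ⟨δ, hδ, h⟩ := linePoly_gap hF he hu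
    have hc : ContinuousAt (fun t : ℂ => u + t • w) 0 := by fun_prop
    have h2 := hc.eventually (p := fun v' => ∀ y, (linePoly F e v').eval y = 0 → ∀ y',
      (linePoly F e v').eval y' = 0 → y ≠ y' → δ < dist y y') (by simpa using h)
    obtain ⟨r, hr, h3⟩ := Metric.eventually_nhds_iff.1 h2
    refine ⟨max 1 (2 / r), by positivity, δ / 2, by positivity, fun x hx y hy y' hy' hne => ?_⟩
    have hx1 : 1 ≤ ‖x‖ := (le_max_left _ _).trans hx
    have hx0 : x ≠ 0 := norm_pos_iff.1 (by linarith)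
    have hxr : ‖x⁻¹‖ < r := by
      rw [norm_inv, inv_lt_comm₀ (by linarith) hr]
      have := (le_max_right _ _).trans hx
      refine lt_of_lt_of_le ?_ this
      rw [inv_eq_one_div]
      gcongr
      norm_num
    have hroot : ∀ y, (fib F e u w x).eval y = 0 →
        (linePoly F e (u + x⁻¹ • w)).eval (x⁻¹ * y) = 0 := by
      intro y hy
      have h4 := linePoly_smul_eval hF e (u + x⁻¹ • w) hx0 y
      rw [smul_add, smul_smul, mul_inv_cancel₀ hx0, one_smul, add_comm (x • u)] at h4
      have h5 : (linePoly F e (w + x • u)).eval y = 0 := hy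
      rw [h5] at h4
      exact (mul_eq_zero.1 h4.symm).resolve_left (pow_ne_zero _ hx0)
    have := h3 (by simpa using hxr) _ (hroot y hy) _ (hroot y' hy')
      (fun h => hne (mul_left_cancel₀ (inv_ne_zero hx0) h))
    rw [dist_eq_norm, ← mul_sub, norm_mul, norm_inv, ← dist_eq_norm,
      lt_inv_mul_iff₀ (by linarith)] at this
    nlinarith
  obtain ⟨κ', hκ', hfin⟩ : ∃ κ' > 0, ∀ x ∈ S ∩ Metric.closedBall 0 R, ∀ y,
      (fib F e u w x).eval y = 0 → ∀ y', (fib F e u w x).eval y' = 0 → y ≠ y' → κ' < dist y y' := by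
    have hK : IsCompact (S ∩ Metric.closedBall 0 R) := (isCompact_closedBall 0 R).inter_left hS
    refine hK.induction_on (p := fun s => ∃ κ' > 0, ∀ x ∈ s, ∀ y,
      (fib F e u w x).eval y = 0 → ∀ y', (fib F e u w x).eval y' = 0 → y ≠ y' → κ' < dist y y')
      ⟨1, one_pos, by simp⟩ ?_ ?_ ?_
    · rintro s t hst ⟨k, hk, h⟩
      exact ⟨k, hk, fun x hx => h x (hst hx)⟩
    · rintro s t ⟨k, hk, h⟩ ⟨k', hk', h'⟩
      refine ⟨min k k', lt_min hk hk', fun x hx y hy y' hy' hne => ?_⟩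
      rcases hx with hx | hx
      · exact (min_le_left _ _).trans_lt (h x hx y hy y' hy' hne)
      · exact (min_le_right _ _).trans_lt (h' x hx y hy y' hy' hne)
    · intro x hx
      obtain ⟨δ, hδ, h⟩ := fib_gap hF he (hsep x hx.1)
      exact ⟨_, mem_nhdsWithin_of_mem_nhds h, δ, hδ, fun x' hx' => hx'⟩
  refine ⟨min κ (κ' / (1 + R)), by positivity, fun x hx y hy y' hy' hne => ?_⟩
  rcases le_total R ‖x‖ with h | h
  · refine lt_of_le_of_lt ?_ (hinf x h y hy y' hy' hne)
    gcongr
    exact min_le_left _ _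
  · refine lt_of_le_of_lt ?_ (hfin x ⟨hx, by simpa using h⟩ y hy y' hy' hne)
    calc min κ (κ' / (1 + R)) * (1 + ‖x‖) ≤ κ' / (1 + R) * (1 + R) := by
          gcongr
          exact min_le_right _ _
      _ = κ' := div_mul_cancel₀ _ (by positivity)

lemma continuous_fib_eval : Continuous fun q : ℂ × ℂ => (fib F e u w q.1).eval q.2 := by
  simp only [fib_eval]
  exact (MvPolynomial.continuous_eval F).comp (by fun_prop)

/-- Upper semicontinuity of roots. -/
lemma fib_roots_near (hF : F.IsHomogeneous d) (he : MvPolynomial.eval e F ≠ 0) (z : ℂ) {ε : ℝ}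
    (hε : 0 < ε) :
    ∀ᶠ x in 𝓝 z, ∀ y, (fib F e u w x).eval y = 0 → ∃ y', (fib F e u w z).eval y' = 0 ∧
      dist y y' < ε := by
  obtain ⟨K, hK, hfar⟩ := exists_far_bound hF he
  set M := K * (‖w + z • u‖ + 1)
  have hKc : IsCompact (Metric.closedBall (0 : ℂ) M ∩
      ⋂ y' ∈ {y' | (fib F e u w z).eval y' = 0}, {y | ε ≤ dist y y'}) := by
    refine (isCompact_closedBall 0 M).inter_right (isClosed_biInter fun y' _ => ?_)
    exact isClosed_le continuous_const (by fun_prop)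
  have h1 := hKc.eventually_forall_of_forall_eventually (x₀ := z)
    (P := fun x y => (fib F e u w x).eval y ≠ 0) ?_
  · have hc : Continuous fun x : ℂ => ‖w + x • u‖ := by fun_prop
    have h2 : ∀ᶠ x in 𝓝 z, ‖w + x • u‖ < ‖w + z • u‖ + 1 :=
      hc.continuousAt.eventually_lt_const (lt_add_one _)
    filter_upwards [h1, h2] with x hx hx2 y hy
    by_contra! hcon
    refine hx y ⟨?_, ?_⟩ hy
    · rw [mem_closedBall_zero_iff]
      by_contra! hlt
      have hM : 0 ≤ M := by positivity
      refine hfar (w + x • u) y (norm_pos_iff.1 (hM.trans_lt hlt)) ?_ ?_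
      · refine le_trans ?_ hlt.le
        exact mul_le_mul_of_nonneg_left hx2.le hK.le
      · simpa [pt] using hy
    · simpa using hcon
  · rintro y ⟨-, hy⟩
    refine continuous_fib_eval.continuousAt.eventually_ne fun h0 => ?_
    have := mem_iInter₂.1 hy y h0
    simp at this
    linarith

end Gap

section Central

variable (F : MvPolynomial (Fin 3) ℂ) (e u w : Fin 3 → ℂ)

/-- The complement of the affine plane curve. -/
abbrev PlaneCpl : Set (ℂ × ℂ) := {q | (fib F e u w q.1).eval q.2 ≠ 0}

/-- The inclusion of the complement of an affine plane section. -/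
noncomputable def planeIncl : C(PlaneCpl F e u w, Cpl F) :=
  subMap (fun q => pt e u w q.1.1 q.1.2) (by fun_prop)
    fun q => mem_cpl.2 fun h => q.2 ((fib_eval F e u w _ _).trans h)

/-- The class of a meridian, in the complement of the cone over the curve. -/
noncomputable def merC (τ : {τ // PDisc (PlaneCpl F e u w) τ}) :
    PC (planeIncl F e u w (tip τ)) (planeIncl F e u w (tip τ)) :=
  (cls (mer τ)).map (planeIncl F e u w)

variable {F e u w} {d : ℕ}

lemma merC_transport {τ τ' : {τ // PDisc (PlaneCpl F e u w) τ}} (Γ : Path τ τ') :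
    merC F e u w τ ⬝ (cls (Γ.map continuous_tip)).map (planeIncl F e u w) =
      (cls (Γ.map continuous_tip)).map (planeIncl F e u w) ⬝ merC F e u w τ' := by
  have := congrArg (fun a => Path.Homotopic.Quotient.map a (planeIncl F e u w)) (mer_transport Γ)
  exact (PC.map_trans _ _ _).symm.trans (this.trans (PC.map_trans _ _ _))

lemma finite_roots_fib (hF : F.IsHomogeneous d) (he : MvPolynomial.eval e F ≠ 0) (x : ℂ) :
    {y | (fib F e u w x).eval y = 0}.Finite := by
  have h0 : fib F e u w x ≠ 0 := linePoly_ne_zero e _ hF he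
  refine (fib F e u w x).roots.toFinset.finite_toSet.subset fun y hy => ?_
  simpa [h0] using hy

/-- Uniform neighbourhoods of the points of the curve on finitely many fibres. -/
lemma exists_charts (hF : F.IsHomogeneous d) (he : MvPolynomial.eval e F ≠ 0)
    (hloc : ∀ c : ℂ × ℂ, (fib F e u w c.1).eval c.2 = 0 → LocComm (PlaneCpl F e u w) c)
    {Z : Set ℂ} (hZ : Z.Finite) :
    ∃ ε > (0 : ℝ), ∀ c : ℂ × ℂ, c.1 ∈ Z → (fib F e u w c.1).eval c.2 = 0 →
      (∀ (x : PlaneCpl F e u w) (α β : Path x x), (∀ t, dist (α t : ℂ × ℂ) c < 2 * ε) →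
        (∀ t, dist (β t : ℂ × ℂ) c < 2 * ε) → cls α ⬝ cls β = cls β ⬝ cls α) ∧
      ∀ c' : ℂ × ℂ, c'.1 ∈ Z → (fib F e u w c'.1).eval c'.2 = 0 → c ≠ c' → 2 * ε < dist c c' := by
  set S : Set (ℂ × ℂ) := {c | c.1 ∈ Z ∧ (fib F e u w c.1).eval c.2 = 0} with hS
  have hSf : S.Finite := by
    refine (hZ.biUnion fun z _ => (finite_roots_fib (u := u) (w := w) hF he z).image
      (Prod.mk z)).subset ?_
    rintro ⟨z, y⟩ ⟨hz, hy⟩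
    exact mem_biUnion hz ⟨y, hy, rfl⟩
  have small : ∀ δ : ℝ, 0 < δ → ∀ᶠ ε in 𝓝[>] (0 : ℝ), 2 * ε < δ := by
    intro δ hδ
    filter_upwards [Ioo_mem_nhdsGT (half_pos hδ)] with ε hε
    linarith [hε.2]
  have h1 : ∀ᶠ ε in 𝓝[>] (0 : ℝ), ∀ c ∈ S, ∀ (x : PlaneCpl F e u w) (α β : Path x x),
      (∀ t, dist (α t : ℂ × ℂ) c < 2 * ε) → (∀ t, dist (β t : ℂ × ℂ) c < 2 * ε) →
      cls α ⬝ cls β = cls β ⬝ cls α := by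
    refine (eventually_all_finite hSf).2 fun c hc => ?_
    obtain ⟨N, hN, h⟩ := hloc c hc.2
    obtain ⟨δ, hδ, hb⟩ := Metric.mem_nhds_iff.1 hN
    filter_upwards [small δ hδ] with ε hε x α β hα hβ
    exact h x α β (fun t => hb ((hα t).trans hε)) fun t => hb ((hβ t).trans hε)
  have h2 : ∀ᶠ ε in 𝓝[>] (0 : ℝ), ∀ c ∈ S, ∀ c' ∈ S, c ≠ c' → 2 * ε < dist c c' := by
    refine (eventually_all_finite hSf).2 fun c hc => (eventually_all_finite hSf).2 fun c' hc' => ?_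
    by_cases h : c = c'
    · exact Eventually.of_forall fun _ h' => absurd h h'
    · exact (small _ (dist_pos.2 h)).mono fun _ h' _ => h'
  obtain ⟨ε, ⟨h1, h2⟩, hε⟩ := ((h1.and h2).and self_mem_nhdsWithin).exists
  exact ⟨ε, hε, fun c hc hc' => ⟨h1 c ⟨hc, hc'⟩, fun c' h h' => h2 c ⟨hc, hc'⟩ c' ⟨h, h'⟩⟩⟩

/-- Meridians with slowly varying radii are transported to one another along the curve. -/
lemma mer_transport_push (hF : F.IsHomogeneous d) (he : MvPolynomial.eval e F ≠ 0)
    {s : ℂ → ℂ} (hs : Continuous s) {Z : Set ℂ} (hZ : Z.Finite) {ε r : ℝ} (hε : 0 < ε)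
    (hrε : r < ε)
    (hchart : ∀ c : ℂ × ℂ, c.1 ∈ Z → (fib F e u w c.1).eval c.2 = 0 →
      (∀ (x : PlaneCpl F e u w) (α β : Path x x), (∀ t, dist (α t : ℂ × ℂ) c < 2 * ε) →
        (∀ t, dist (β t : ℂ × ℂ) c < 2 * ε) → cls α ⬝ cls β = cls β ⬝ cls α) ∧
      ∀ c' : ℂ × ℂ, c'.1 ∈ Z → (fib F e u w c'.1).eval c'.2 = 0 → c ≠ c' → 2 * ε < dist c c')
    (hnear : ∀ z ∈ Z, ∀ x, dist x z ≤ r → ∀ y, (fib F e u w x).eval y = 0 →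
      ∃ y', (fib F e u w z).eval y' = 0 ∧ dist y y' < ε)
    (hgap : ∀ x, (∀ z ∈ Z, r ≤ dist x z) → ∀ y, (fib F e u w x).eval y = 0 → ∀ y',
      (fib F e u w x).eval y' = 0 → y ≠ y' → ‖s x‖ < dist y y')
    (hsmall : ∀ z ∈ Z, ∀ x, dist x z < ε → ‖s x‖ < ε)
    {p p' : Push F e u w s} (a : PC p p') (h : PDisc (PlaneCpl F e u w) (p.1, s p.1.1))
    (h' : PDisc (PlaneCpl F e u w) (p'.1, s p'.1.1)) :
    merC F e u w ⟨_, h⟩ ⬝ a.map (push F e u w s hs) =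
      a.map (push F e u w s hs) ⬝ merC F e u w ⟨_, h'⟩ := by
  have hP : Continuous fun p : Push F e u w s => (p : ℂ × ℂ) := continuous_subtype_val
  have hs' : Continuous fun p : Push F e u w s => s p.1.1 := by fun_prop
  have hΩ : ∀ p : Push F e u w s, (p.1.1, p.1.2 + s p.1.1) ∈ PlaneCpl F e u w := fun p => p.2.2.2
  have hs0 : ∀ p : Push F e u w s, s p.1.1 ≠ 0 := by
    intro p h0
    refine p.2.2.2 ?_
    rw [h0, add_zero]
    exact p.2.2.1
  let ι : Type := {c : ℂ × ℂ // c.1 ∈ Z ∧ (fib F e u w c.1).eval c.2 = 0}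
  let W : ι → Set (Push F e u w s) := fun c => {p | dist p.1 c.1 < ε}
  let V : ι → Set (ℂ × ℂ) := fun c => {q | q ∈ PlaneCpl F e u w ∧ dist q c.1 < 2 * ε}
  have hball : ∀ (c : ι) (p : Push F e u w s), p ∈ W c → ∀ ζ : ℂ, ‖ζ‖ < ε →
      dist ((p.1.1, p.1.2 + ζ) : ℂ × ℂ) c.1 < 2 * ε := by
    intro c p hp ζ hζ
    have h1 : dist ((p.1.1, p.1.2 + ζ) : ℂ × ℂ) p.1 < ε := by
      rw [Prod.dist_eq]
      simpa [dist_eq_norm, hε] using hζ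
    have h2 : dist p.1 c.1 < ε := hp
    linarith [dist_triangle ((p.1.1, p.1.2 + ζ) : ℂ × ℂ) p.1 c.1]
  have hWs : ∀ (c : ι) (p : Push F e u w s), p ∈ W c → ‖s p.1.1‖ < ε := fun c p hp =>
    hsmall _ c.2.1 _ (lt_of_le_of_lt (by rw [Prod.dist_eq]; exact le_max_left _ _) hp)
  have key := mer_transport_global (Ω := PlaneCpl F e u w) hP hs' hΩ W V (fun _ _ hq => hq.1)
    ?_ ?_ ?_ ?_ ?_ ?_ a h h'
  · have := congrArg (fun b => Path.Homotopic.Quotient.map b (planeIncl F e u w)) key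
    have h2 := (PC.map_trans _ _ _).symm.trans (this.trans (PC.map_trans _ _ _))
    obtain ⟨γ, rfl⟩ := a.exists_rep
    exact h2
  · intro p
    by_cases hfar : ∀ z ∈ Z, r < dist p.1.1 z
    · left
      have hopen : IsOpen {x : ℂ | ∀ z ∈ Z, r < dist x z} := by
        have : {x : ℂ | ∀ z ∈ Z, r < dist x z} = ⋂ z ∈ Z, {x | r < dist x z} := by
          ext x; simp
        rw [this]
        exact hZ.isOpen_biInter fun z _ => isOpen_lt continuous_const (by fun_prop)
      have hc : Continuous fun p : Push F e u w s => p.1.1 := by fun_prop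
      filter_upwards [(hopen.preimage hc).eventually_mem hfar] with q hq
      refine ⟨hs0 q, fun ζ hζ hζs hroot => ?_⟩
      have := hgap q.1.1 (fun z hz => (hq z hz).le) _ hroot q.1.2 q.2.2.1 (by simpa using hζ)
      rw [dist_eq_norm, add_sub_cancel_left] at this
      exact absurd hζs (not_le.2 this)
    · right
      push Not at hfar
      obtain ⟨z, hz, hzr⟩ := hfar
      obtain ⟨y', hy', hyy⟩ := hnear z hz _ hzr _ p.2.2.1
      refine ⟨⟨(z, y'), hz, hy'⟩, ?_⟩
      refine (isOpen_lt (by fun_prop) continuous_const).mem_nhds ?_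
      show dist p.1 (z, y') < ε
      rw [Prod.dist_eq]
      exact max_lt (hzr.trans_lt hrε) hyy
  · intro p c c' hc hc'
    by_contra hne
    have h1 := (hchart c.1 c.2.1 c.2.2).2 c'.1 c'.2.1 c'.2.2 
      (fun h => hne (Subtype.val_injective
        (p := fun c : ℂ × ℂ => c.1 ∈ Z ∧ (fib F e u w c.1).eval c.2 = 0) h))
    have h2 : dist p.1 c.1 < ε := hc
    have h3 : dist p.1 c'.1 < ε := hc'
    linarith [dist_triangle_left c.1 c'.1 p.1]
  · intro c p hp
    exact ⟨hΩ p, hball c p hp _ (hWs c p hp)⟩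
  · intro c p hp
    obtain ⟨δ, hδ, hev⟩ := fib_gap (u := u) (w := w) hF he p.2.1
    have hc : Continuous fun p : Push F e u w s => p.1.1 := by fun_prop
    have hW : IsOpen (W c) := isOpen_lt ((hP.dist continuous_const : Continuous fun q : Push F e u
        w s => dist q.1 c.1)) continuous_const
    refine ⟨min δ (ε / 2), by positivity, ?_⟩
    filter_upwards [hc.continuousAt.eventually hev, hW.eventually_mem hp] with q hq hqW b hb hbδ
    refine ⟨hb, fun ζ hζ hζb => ⟨fun hroot => ?_, hball c q hqW ζ ?_⟩⟩
    · have := hq _ hroot q.1.2 q.2.2.1 (by simpa using hζ)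
      rw [dist_eq_norm, add_sub_cancel_left] at this
      have h4 := hζb.trans (hbδ.trans (min_le_left _ _))
      exact absurd h4 (not_le.2 this)
    · have h4 := hζb.trans (hbδ.trans (min_le_right _ _))
      exact h4.trans_lt (half_lt_self hε)
  · intro c p hp hd
    exact ⟨hd.1, fun ζ hζ hζs => ⟨hd.2 ζ hζ hζs, hball c p hp ζ (hζs.trans_lt (hWs c p hp))⟩⟩
  · intro c x α β hα hβ
    exact (hchart c.1 c.2.1 c.2.2).1 x α β (fun t => (hα t).2) fun t => (hβ t).2

end Central

section Central

variable {F : MvPolynomial (Fin 3) ℂ} {e u w : Fin 3 → ℂ} {d : ℕ}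

lemma exists_fib_root (hF : F.IsHomogeneous d) (hd : 1 ≤ d) (he : MvPolynomial.eval e F ≠ 0)
    (x : ℂ) : ∃ y, (fib F e u w x).eval y = 0 := by
  refine IsAlgClosed.exists_root _ ?_
  have h0 : fib F e u w x ≠ 0 := linePoly_ne_zero e _ hF he
  have hn : (fib F e u w x).natDegree = d := linePoly_natDegree e _ hF he
  rw [Polynomial.degree_eq_natDegree h0, hn]
  exact_mod_cast (by omega : d ≠ 0)

lemma PC.commute_of_conj {X : Type*} [TopologicalSpace X] {x y : X} {m : PC x x} {m' l : PC y y}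
    {a b : PC x y} (ha : m ⬝ a = a ⬝ m') (hb : m ⬝ b = b ⬝ m') (hl : a ⬝ l = b) :
    m' ⬝ l = l ⬝ m' := by
  subst hl
  refine PC.trans_left_cancel (a := a) ?_
  rw [← Path.Homotopic.Quotient.trans_assoc, ← ha, Path.Homotopic.Quotient.trans_assoc, hb,
    Path.Homotopic.Quotient.trans_assoc]

/-- Some meridian of a nodal curve is central in the fundamental group of the complement. -/
theorem exists_central_meridian (hF : F.IsHomogeneous d) (hd : 1 ≤ d)
    (he : MvPolynomial.eval e F ≠ 0) (hu : (linePoly F e u).Separable)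
    (hli : LinearIndependent ℂ ![u, e, w]) (hZ : {x | ¬ (fib F e u w x).Separable}.Finite)
    (hnodal : ∀ p : Fin 3 → ℂ, p ≠ 0 → MvPolynomial.eval p F = 0 →
      (∀ i, MvPolynomial.eval p (pderiv i F) = 0) → IsOrdinaryNodeAt F p)
    {x₁ : ℂ} (h1 : (fib F e u w x₁).Separable) :
    ∃ τ : {τ // PDisc (PlaneCpl F e u w) τ}, τ.1.1.1 = x₁ ∧ (fib F e u w x₁).eval τ.1.1.2 = 0 ∧
      ∀ l, merC F e u w τ ⬝ l = l ⬝ merC F e u w τ := by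
  set Z : Set ℂ := {x | ¬ (fib F e u w x).Separable} with hZdef
  obtain ⟨ε, hε, hchart⟩ := exists_charts hF he (fun c hc => locComm_curve hF hli hnodal hc) hZ
  obtain ⟨x₀, hx₀⟩ : ∃ x₀, x₀ ∉ Z ∪ {x₁} := by
    have := (hZ.union (finite_singleton x₁)).infinite_compl
    exact this.nonempty
  have h0 : (fib F e u w x₀).Separable := not_not.1 fun h => hx₀ (Or.inl h)
  have hx : x₀ ≠ x₁ := fun h => hx₀ (Or.inr h)
  have small : ∀ δ : ℝ, 0 < δ → ∀ᶠ r in 𝓝[>] (0 : ℝ), r < δ := fun δ hδ =>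
    mem_of_superset (Ioo_mem_nhdsGT hδ) fun r hr => hr.2
  have hev : ∀ᶠ r in 𝓝[>] (0 : ℝ), ∀ z ∈ Z, (∀ x, dist x z ≤ r → ∀ y, (fib F e u w x).eval y = 0 →
      ∃ y', (fib F e u w z).eval y' = 0 ∧ dist y y' < ε) ∧ r < dist x₀ z ∧ r < dist x₁ z := by
    refine (eventually_all_finite hZ).2 fun z hz => ?_
    obtain ⟨ρ, hρ, hn⟩ := Metric.eventually_nhds_iff.1 (fib_roots_near (u := u) (w := w) hF he z hε)
    filter_upwards [small ρ hρ, small (dist x₀ z) (dist_pos.2 fun h => hz (h ▸ h0)),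
      small (dist x₁ z) (dist_pos.2 fun h => hz (h ▸ h1))] with r hr hr0 hr1
    exact ⟨fun x hx => hn (hx.trans_lt hr), hr0, hr1⟩
  obtain ⟨r, ⟨hr, hrε⟩, hr0 : 0 < r⟩ := ((hev.and (small ε hε)).and self_mem_nhdsWithin).exists
  obtain ⟨κ, hκ, hgap⟩ := fib_gap_of_isClosed (w := w) hF he hu
    (S := {x | ∀ z ∈ Z, r ≤ dist x z}) (by
      simp only [ofPred_forall]
      exact isClosed_biInter fun z _ => isClosed_le continuous_const (by fun_prop))
    fun x hx => not_not.1 fun h => (hx x h).not_gt (by simpa using hr0)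
  obtain ⟨R, hR0, hR⟩ := hZ.isBounded.exists_pos_norm_le
  set m := min κ ε
  have hm : 0 < m := lt_min hκ hε
  have hmκ : m ≤ κ := min_le_left _ _
  have hmε : m ≤ ε := min_le_right _ _
  set L := R + ε + ‖x₀‖ + 1
  have hL : 0 < L := by positivity
  set s₀ : ℂ := ((m / 4 : ℝ) : ℂ)
  have hs₀ : ‖s₀‖ = m / 4 := by
    rw [Complex.norm_real, Real.norm_of_nonneg (by positivity)]
  have hx₀S : ∀ z ∈ Z, r ≤ dist x₀ z := fun z hz => (hr z hz).2.1.le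
  have hx₁S : ∀ z ∈ Z, r ≤ dist x₁ z := fun z hz => (hr z hz).2.2.le
  have hs0 : ∀ y, (fib F e u w x₀).eval y = 0 → (fib F e u w x₀).eval (y + s₀) ≠ 0 := by
    intro y hy hy'
    have := hgap x₀ hx₀S _ hy' _ hy fun h => by
      rw [add_eq_left.1 h, norm_zero] at hs₀
      linarith
    rw [dist_eq_norm, add_sub_cancel_left, hs₀] at this
    nlinarith [norm_nonneg x₀]
  obtain ⟨D, hD, hdec⟩ := exists_push_decomposition (u := u) (w := w) hF he (hli.ne_zero 1) hx h0
      h1 hs0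
  obtain ⟨a₀, ha₀, hna⟩ : ∃ a₀ ∈ Metric.ball (0 : ℂ) (m / (4 * L)),
      a₀ ∉ D ∪ {-s₀ / (x₁ - x₀)} := by
    have hinf := infinite_of_mem_nhds (0 : ℂ) (Metric.ball_mem_nhds 0 (by positivity : 0 < m / (4 *
        L)))
    exact (hinf.sdiff (hD.union (finite_singleton _))).nonempty
  rw [mem_ball_zero_iff, lt_div_iff₀ (by positivity)] at ha₀
  set s : ℂ → ℂ := fun x => s₀ + a₀ * (x - x₀) with hsdef
  have hs : Continuous s := by fun_prop
  have hsn : ∀ x, ‖s x‖ ≤ m / 4 + ‖a₀‖ * (‖x‖ + ‖x₀‖) := fun x => by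
    refine (norm_add_le _ _).trans ?_
    rw [hs₀, norm_mul]
    gcongr
    exact norm_sub_le _ _
  have hgap' : ∀ x, (∀ z ∈ Z, r ≤ dist x z) → ∀ y, (fib F e u w x).eval y = 0 → ∀ y',
      (fib F e u w x).eval y' = 0 → y ≠ y' → ‖s x‖ < dist y y' := by
    intro x hx y hy y' hy' hne
    refine lt_of_le_of_lt (hsn x) (lt_of_le_of_lt ?_ (hgap x hx y hy y' hy' hne))
    have h2 : ‖a₀‖ * (1 + ‖x₀‖) ≤ ‖a₀‖ * L := by
      gcongr
      simp only [L]
      linarith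
    nlinarith [norm_nonneg a₀, norm_nonneg x₀, norm_nonneg x, mul_nonneg hm.le (norm_nonneg x),
      mul_nonneg (norm_nonneg a₀) (norm_nonneg x₀),
      mul_le_mul_of_nonneg_right hmκ (norm_nonneg x)]
  have hsmall : ∀ z ∈ Z, ∀ x, dist x z < ε → ‖s x‖ < ε := by
    intro z hz x hxz
    have h2 : ‖x‖ ≤ R + ε := by
      have := norm_le_norm_add_norm_sub' x z
      rw [← dist_eq_norm] at this
      linarith [hR z hz]
    have h3 : ‖a₀‖ * (‖x‖ + ‖x₀‖) ≤ ‖a₀‖ * L := by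
      gcongr
      simp only [L]
      linarith
    linarith [hsn x]
  have hdisc : ∀ x, (∀ z ∈ Z, r ≤ dist x z) → s x ≠ 0 → ∀ y, (fib F e u w x).eval y = 0 →
      PDisc (PlaneCpl F e u w) ((x, y), s x) := by
    refine fun x hx hsx y hy => ⟨hsx, fun ζ hζ hζs hroot => ?_⟩
    have := hgap' x hx _ hroot y hy (by simpa using hζ)
    rw [dist_eq_norm, add_sub_cancel_left] at this
    exact absurd hζs (not_le.2 this)
  have hs1 : s x₁ ≠ 0 := by
    intro h
    refine hna (Or.inr ?_)
    rw [mem_singleton_iff, eq_div_iff (sub_ne_zero.2 hx.symm)]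
    linear_combination h
  obtain ⟨y₁, hy₁⟩ := exists_fib_root (u := u) (w := w) hF hd he x₁
  have hd1 := hdisc x₁ hx₁S hs1 y₁ hy₁
  let p₁ : Push F e u w s := ⟨(x₁, y₁), h1, hy₁, hd1.2 _ hs1 le_rfl⟩
  refine ⟨⟨_, hd1⟩, rfl, hy₁, fun l => ?_⟩
  obtain ⟨⟨⟨x, y₀⟩, p₀h⟩, hp₀ : x = x₀, v, v', hv⟩ :=
    hdec a₀ (fun h => hna (Or.inl h)) hs p₁ rfl l
  subst hp₀
  have hsx : s x ≠ 0 := by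
    intro h
    refine p₀h.2.2 ?_
    show (fib F e u w x).eval (y₀ + s x) = 0
    rw [h, add_zero]
    exact p₀h.2.1
  have hd0 := hdisc x hx₀S hsx y₀ p₀h.2.1
  have tr := fun a => mer_transport_push hF he hs hZ hε hrε hchart
    (fun z hz => (hr z hz).1) hgap' hsmall (p := ⟨(x, y₀), p₀h⟩) (p' := p₁) a hd0 hd1
  exact PC.commute_of_conj (tr (cls v)) (tr (cls v')) hv

end Central

section PolynomialGrowth

/-- An entire function of polynomial growth is a polynomial. -/
lemma exists_polynomial_of_growth {g : ℂ → ℂ} (hg : Differentiable ℂ g) {n : ℕ} {C : ℝ}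
    (h : ∀ x, ‖g x‖ ≤ C * (1 + ‖x‖) ^ n) :
    ∃ q : Polynomial ℂ, q.natDegree ≤ n ∧ ∀ x, g x = q.eval x := by
  induction n generalizing g C with
  | zero =>
    obtain ⟨c, hc⟩ := hg.exists_const_forall_eq_of_bounded
      (isBounded_iff_forall_norm_le.2 ⟨C, by rintro _ ⟨x, rfl⟩; simpa using h x⟩)
    exact ⟨Polynomial.C c, by simp, fun x => by simp [hc x]⟩
  | succ n ih =>
    have hd : Differentiable ℂ (dslope g 0) :=
      differentiableOn_univ.1 ((Complex.differentiableOn_dslope univ_mem).2 hg.differentiableOn)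
    obtain ⟨M, hM⟩ := (isCompact_closedBall (0 : ℂ) 1).exists_bound_of_continuousOn
      hd.continuous.continuousOn
    have hC : 0 ≤ C := by simpa using (norm_nonneg _).trans (h 0)
    have hM0 : 0 ≤ M := (norm_nonneg _).trans (hM 0 (by simp))
    have hgrow : ∀ x, ‖dslope g 0 x‖ ≤ (4 * C + M) * (1 + ‖x‖) ^ n := by
      intro x
      have hp : 1 ≤ (1 + ‖x‖) ^ n := one_le_pow₀ (by linarith [norm_nonneg x])
      rcases le_total ‖x‖ 1 with hx | hx
      · refine (hM x (by simpa using hx)).trans ?_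
        nlinarith
      · have hx0 : x ≠ 0 := norm_pos_iff.1 (by linarith)
        rw [dslope_of_ne _ hx0, slope_def_field, sub_zero, norm_div, div_le_iff₀ (by linarith)]
        have h0 : ‖g 0‖ ≤ C := by simpa using h 0
        have h1 := (norm_sub_le (g x) (g 0)).trans (add_le_add (h x) h0)
        have h2 : C ≤ C * (1 + ‖x‖) ^ n * ‖x‖ := by
          rw [mul_assoc]
          exact le_mul_of_one_le_right hC (by nlinarith)
        have h3 : C * (1 + ‖x‖) ^ (n + 1) ≤ 2 * (C * (1 + ‖x‖) ^ n * ‖x‖) := by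
          rw [pow_succ]
          have : 0 ≤ C * (1 + ‖x‖) ^ n := by positivity
          nlinarith
        have h4 : 0 ≤ M * (1 + ‖x‖) ^ n * ‖x‖ := by positivity
        nlinarith
    obtain ⟨q, hq, hqe⟩ := ih hd hgrow
    refine ⟨Polynomial.C (g 0) + Polynomial.X * q, ?_, fun x => ?_⟩
    · refine (Polynomial.natDegree_add_le _ _).trans (max_le (by simp) ?_)
      refine Polynomial.natDegree_mul_le.trans ?_
      rw [Polynomial.natDegree_X]
      omega
    · have := sub_smul_dslope g 0 x
      rw [sub_zero, smul_eq_mul, hqe x] at this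
      simp [this]

/-- A holomorphic function of polynomial growth off a finite set is a polynomial. -/
lemma exists_polynomial_of_growth_off_finite {Z : Set ℂ} (hZ : Z.Finite) {g : ℂ → ℂ}
    (hg : ∀ x ∉ Z, DifferentiableAt ℂ g x) {n : ℕ} {C : ℝ}
    (h : ∀ x ∉ Z, ‖g x‖ ≤ C * (1 + ‖x‖) ^ n) :
    ∃ q : Polynomial ℂ, q.natDegree ≤ n ∧ ∀ x ∉ Z, g x = q.eval x := by
  classical
  set G : ℂ → ℂ := fun x => if x ∈ Z then limUnder (𝓝[≠] x) g else g x with hG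
  have hGg : ∀ x ∉ Z, G x = g x := fun x hx => if_neg hx
  have hdiff : Differentiable ℂ G := by
    intro z
    by_cases hz : z ∈ Z
    · have hs : Metric.ball z 1 ∩ (Z \ {z})ᶜ ∈ 𝓝 z :=
        inter_mem (Metric.ball_mem_nhds z one_pos)
          ((hZ.subset sdiff_subset).isClosed.isOpen_compl.mem_nhds (by simp))
      have hsub : ∀ x ∈ (Metric.ball z 1 ∩ (Z \ {z})ᶜ) \ {z}, x ∉ Z :=
        fun x hx hxZ => hx.1.2 ⟨hxZ, hx.2⟩
      have hd := Complex.differentiableOn_update_limUnder_of_bddAbove hs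
        (f := g) (fun x hx => (hg x (hsub x hx)).differentiableWithinAt) ?_
      · refine (hd.differentiableAt hs).congr_of_eventuallyEq ?_
        filter_upwards [hs] with x hx
        rcases eq_or_ne x z with rfl | hne
        · simp [hG, hz]
        · rw [Function.update_of_ne hne, hGg x (hsub x ⟨hx, hne⟩)]
      · refine ⟨|C| * (2 + ‖z‖) ^ n, ?_⟩
        rintro _ ⟨x, hx, rfl⟩
        have h1 : ‖x‖ ≤ 1 + ‖z‖ := by
          have := norm_le_norm_add_norm_sub' x z
          rw [← dist_eq_norm] at this
          linarith [Metric.mem_ball.1 hx.1.1]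
        exact (h x (hsub x hx)).trans (mul_le_mul (le_abs_self C)
          (pow_le_pow_left₀ (by positivity) (by linarith) n) (by positivity) (abs_nonneg C))
    · refine (hg z hz).congr_of_eventuallyEq ?_
      filter_upwards [hZ.isClosed.isOpen_compl.mem_nhds hz] with x hx using hGg x hx
  have hdense : Dense Zᶜ := hZ.countable.dense_compl ℂ
  have hgrow : ∀ x, ‖G x‖ ≤ C * (1 + ‖x‖) ^ n := by
    have hcl : IsClosed {x | ‖G x‖ ≤ C * (1 + ‖x‖) ^ n} :=
      isClosed_le hdiff.continuous.norm (by fun_prop)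
    have : closure Zᶜ ⊆ {x | ‖G x‖ ≤ C * (1 + ‖x‖) ^ n} := by
      refine hcl.closure_subset_iff.2 fun x hx => ?_
      show ‖G x‖ ≤ _
      rw [hGg x hx]
      exact h x hx
    intro x
    exact this (hdense.closure_eq ▸ mem_univ x)
  obtain ⟨q, hq, hqe⟩ := exists_polynomial_of_growth hdiff hgrow
  exact ⟨q, hq, fun x hx => by rw [← hGg x hx, hqe]⟩

end PolynomialGrowth

section Sections

variable {F : MvPolynomial (Fin 3) ℂ} {e u w : Fin 3 → ℂ} {d : ℕ}

lemma exists_sections (hF : F.IsHomogeneous d) (he : MvPolynomial.eval e F ≠ 0) {x₁ : ℂ}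
    (h1 : (fib F e u w x₁).Separable) :
    ∃ r > 0, ∃ (n : ℕ) (a : Fin n → ℂ → ℂ),
      (∀ x ∈ Metric.ball x₁ r, (fib F e u w x).Separable) ∧
      (∀ k, ContinuousOn (a k) (Metric.ball x₁ r)) ∧
      (∀ x ∈ Metric.ball x₁ r, Function.Injective fun k => a k x) ∧
      ∀ x ∈ Metric.ball x₁ r, ∀ y, (fib F e u w x).eval y = 0 ↔ ∃ k, a k x = y := by
  classical
  have hφ : Continuous fun x : {x // (fib F e u w x).Separable} =>
      (⟨w + x.1 • u, x.2⟩ : SepBase F e) := by fun_prop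
  obtain ⟨n, N, a, hN, hxN, hc, hinj, hr⟩ := ((locTriv_linePoly hF he).comp hφ) ⟨x₁, h1⟩
  have hop : IsOpen {x | (fib F e u w x).Separable} := isOpen_separable_fib hF he
  have hN' : IsOpen (Subtype.val '' N) := hop.isOpenMap_subtype_val N hN
  obtain ⟨r, hr0, hsub⟩ := Metric.isOpen_iff.1 hN' x₁ ⟨_, hxN, rfl⟩
  have hsep : ∀ x ∈ Metric.ball x₁ r, (fib F e u w x).Separable := fun x hx => by
    obtain ⟨z, -, rfl⟩ := hsub hx
    exact z.2
  have hmem : ∀ x (hx : x ∈ Metric.ball x₁ r),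
      (⟨x, hsep x hx⟩ : {x // (fib F e u w x).Separable}) ∈ N := fun x hx => by
    obtain ⟨z, hz, rfl⟩ := hsub hx
    exact hz
  set a' : Fin n → ℂ → ℂ := fun k x => if h : (fib F e u w x).Separable then a k ⟨x, h⟩ else 0
  have ha' : ∀ k x (h : (fib F e u w x).Separable), a' k x = a k ⟨x, h⟩ := fun k x h => dif_pos h
  refine ⟨r, hr0, n, a', hsep, fun k => ?_, fun x hx k l hkl => ?_, fun x hx y => ?_⟩
  · rw [continuousOn_iff_continuous_domRestrict]
    have hcont : Continuous fun x : Metric.ball x₁ r =>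
        (⟨⟨x.1, hsep x.1 x.2⟩, hmem x.1 x.2⟩ : N) := by fun_prop
    have := (continuousOn_iff_continuous_domRestrict.1 (hc k)).comp hcont
    exact this.congr fun x => (ha' k x.1 (hsep x.1 x.2)).symm
  · refine hinj _ (hmem x hx) ?_
    simpa only [ha' _ x (hsep x hx)] using hkl
  · have := Set.ext_iff.1 (hr _ (hmem x hx)) y
    simp only [ha' _ x (hsep x hx)]
    exact this

lemma isInvertible_of_apply_one_ne_zero {L : ℂ →L[ℂ] ℂ} (h : L 1 ≠ 0) : L.IsInvertible :=
  ⟨ContinuousLinearEquiv.unitsEquivAut ℂ (Units.mk0 (L 1) h), by ext; simp⟩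

/-- A continuous choice of root over transverse fibres is holomorphic. -/
lemma differentiableAt_section {x₁ : ℂ} (h1 : (fib F e u w x₁).Separable) {s : ℂ → ℂ}
    (hs : ContinuousAt s x₁) (h : ∀ᶠ x in 𝓝 x₁, (fib F e u w x).eval (s x) = 0) :
    DifferentiableAt ℂ s x₁ := by
  set f : ℂ × ℂ → ℂ := fun q => (fib F e u w q.1).eval q.2 with hf
  obtain ⟨L, hL⟩ : ∃ L, HasStrictFDerivAt f L (x₁, s x₁) := by
    have := (hasStrictFDerivAt_eval F (pt e u w x₁ (s x₁))).comp (x₁, s x₁)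
      (hasStrictFDerivAt_pt (e := e) (u := u) (w := w) (x₁, s x₁))
    refine ⟨_, this.congr_of_eventuallyEq (Eventually.of_forall fun q => ?_)⟩
    simp [f]
  have h0 : (fib F e u w x₁).eval (s x₁) = 0 := h.self_of_nhds
  have hinv : (L ∘L .inr ℂ ℂ ℂ).IsInvertible := by
    refine isInvertible_of_apply_one_ne_zero ?_
    have hd : HasFDerivAt (fun y : ℂ => f (x₁, y)) (L ∘L .inr ℂ ℂ ℂ) (s x₁) :=
      HasFDerivAt.comp (s x₁) (g := f) hL.hasFDerivAt (hasFDerivAt_prodMk_right x₁ (s x₁))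
    have := hd.hasDerivAt.unique ((fib F e u w x₁).hasDerivAt (s x₁))
    rw [this]
    exact (separable_iff_roots.1 h1) _ h0
  have h2 := hL.eventually_apply_eq_iff_implicitFunctionOfProdDomain hinv
  have hc : ContinuousAt (fun x => (x, s x)) x₁ := continuousAt_id.prodMk hs
  have h3 := hc.eventually h2
  have h4 := (hL.hasStrictFDerivAt_implicitFunctionOfProdDomain hinv).hasFDerivAt.differentiableAt
  refine h4.congr_of_eventuallyEq ?_
  filter_upwards [h3, h] with x hx hx0
  exact (hx.1 (by simp only [f]; rw [hx0, h0])).symm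

end Sections

section Parts

variable (F : MvPolynomial (Fin 3) ℂ) (e u w : Fin 3 → ℂ)

/-- The affine plane curve, off the fibres which are not transverse. -/
abbrev Crv := {p : ℂ × ℂ // (fib F e u w p.1).Separable ∧ (fib F e u w p.1).eval p.2 = 0}

open scoped Classical in
/-- The monic polynomial whose roots are the points of a part of the curve in a fibre. -/
noncomputable def partPoly (Q : ℂ × ℂ → Prop) (x : ℂ) : Polynomial ℂ :=
  ∏ y ∈ (fib F e u w x).roots.toFinset with Q (x, y), (Polynomial.X - Polynomial.C y)

variable {F e u w} {d : ℕ} {Q : ℂ × ℂ → Prop}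

lemma partPoly_natDegree_le (hF : F.IsHomogeneous d) (x : ℂ) :
    (partPoly F e u w Q x).natDegree ≤ d := by
  classical
  rw [partPoly, Polynomial.natDegree_prod_of_monic _ _ fun y _ => Polynomial.monic_X_sub_C y]
  simp only [Polynomial.natDegree_X_sub_C, Finset.sum_const, smul_eq_mul, mul_one]
  exact (Finset.card_filter_le _ _).trans ((Multiset.toFinset_card_le _).trans
    ((Polynomial.card_roots' _).trans (linePoly_natDegree_le e _ hF)))

lemma partPoly_eval_eq_zero (hF : F.IsHomogeneous d) (he : MvPolynomial.eval e F ≠ 0) {x y : ℂ} :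
    (partPoly F e u w Q x).eval y = 0 ↔ (fib F e u w x).eval y = 0 ∧ Q (x, y) := by
  classical
  have h0 : fib F e u w x ≠ 0 := linePoly_ne_zero e _ hF he
  rw [partPoly, Polynomial.eval_prod, Finset.prod_eq_zero_iff]
  simp only [Finset.mem_filter, Multiset.mem_toFinset, Polynomial.mem_roots h0,
    Polynomial.IsRoot.def, Polynomial.eval_sub, Polynomial.eval_X, Polynomial.eval_C, sub_eq_zero]
  constructor
  · rintro ⟨z, hz, rfl⟩
    exact hz
  · exact fun h => ⟨y, h, rfl⟩

lemma partPoly_mul_compl (hF : F.IsHomogeneous d) (he : MvPolynomial.eval e F ≠ 0) {x : ℂ}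
    (hx : (fib F e u w x).Separable) :
    Polynomial.C (MvPolynomial.eval e F) *
      (partPoly F e u w Q x * partPoly F e u w (fun p => ¬ Q p) x) = fib F e u w x := by
  classical
  have hlead : (fib F e u w x).leadingCoeff = MvPolynomial.eval e F := by
    have hn : (fib F e u w x).natDegree = d := linePoly_natDegree e _ hF he
    rw [Polynomial.leadingCoeff, hn]
    exact linePoly_coeff_top e _ hF
  have hs := (IsAlgClosed.splits (fib F e u w x)).eq_prod_roots
  rw [hlead] at hs
  conv_rhs => rw [hs]
  rw [partPoly, partPoly]
  congr 1
  refine Eq.trans (by congr!) ((Finset.prod_filter_mul_prod_filter_not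
    (fib F e u w x).roots.toFinset (fun y => Q (x, y)) _).trans ?_)
  rw [Finset.prod, Multiset.toFinset_val, (Polynomial.nodup_roots hx).dedup]

/-- A union of path components of the curve. -/
def IsPart (F : MvPolynomial (Fin 3) ℂ) (e u w : Fin 3 → ℂ) (Q : ℂ × ℂ → Prop) : Prop :=
  ∀ p q : Crv F e u w, Joined p q → Q p.1 → Q q.1

lemma IsPart.not (hQ : IsPart F e u w Q) : IsPart F e u w fun p => ¬ Q p :=
  fun p q h hp hq => hp (hQ q p h.symm hq)

lemma IsPart.differentiableAt (hQ : IsPart F e u w Q) (hF : F.IsHomogeneous d)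
    (he : MvPolynomial.eval e F ≠ 0) {x₁ : ℂ} (h1 : (fib F e u w x₁).Separable) (t : ℂ) :
    DifferentiableAt ℂ (fun x => (partPoly F e u w Q x).eval t) x₁ := by
  classical
  obtain ⟨r, hr, n, a, hsep, hc, hinj, hroot⟩ := exists_sections hF he h1
  have hx1 : x₁ ∈ Metric.ball x₁ r := Metric.mem_ball_self hr
  have hlc : ∀ k, ∀ x ∈ Metric.ball x₁ r, ∀ x' ∈ Metric.ball x₁ r, Q (x, a k x) →
      Q (x', a k x') := by
    intro k x hx x' hx'
    have hj : JoinedIn (Metric.ball x₁ r) x x' :=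
      ((convex_ball x₁ r).isPathConnected ⟨x₁, hx1⟩).joinedIn x hx x' hx'
    have hcont : Continuous fun x : Metric.ball x₁ r => (⟨(x.1, a k x.1), hsep _ x.2,
        (hroot _ x.2 _).2 ⟨k, rfl⟩⟩ : Crv F e u w) := by
      have := continuousOn_iff_continuous_domRestrict.1 (hc k)
      exact Continuous.subtype_mk (continuous_subtype_val.prodMk this) _
    exact hQ _ _ ((joinedIn_iff_joined hx hx').1 hj |>.map hcont)
  have heq : (fun x => (partPoly F e u w Q x).eval t) =ᶠ[𝓝 x₁]
      fun x => ∏ k with Q (x₁, a k x₁), (t - a k x) := by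
    filter_upwards [Metric.ball_mem_nhds x₁ hr] with x hx
    have h0 : fib F e u w x ≠ 0 := (linePoly_ne_zero e _ hF he)
    have : (fib F e u w x).roots.toFinset.filter (fun y => Q (x, y)) =
        (Finset.univ.filter fun k => Q (x₁, a k x₁)).image fun k => a k x := by
      ext y
      simp only [Finset.mem_filter, Multiset.mem_toFinset, Polynomial.mem_roots h0,
        Polynomial.IsRoot.def, hroot x hx, Finset.mem_image, Finset.mem_univ, true_and]
      constructor
      · rintro ⟨⟨k, rfl⟩, hq⟩
        exact ⟨k, hlc k x hx x₁ hx1 hq, rfl⟩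
      · rintro ⟨k, hq, rfl⟩
        exact ⟨⟨k, rfl⟩, hlc k x₁ hx1 x hx hq⟩
    rw [partPoly, this, Finset.prod_image fun k _ l _ h => hinj x hx h, Polynomial.eval_prod]
    simp
  refine DifferentiableAt.congr_of_eventuallyEq ?_ heq
  refine DifferentiableAt.fun_finsetProd fun k _ => (differentiableAt_const t).sub ?_
  refine differentiableAt_section h1 ((hc k).continuousAt (Metric.ball_mem_nhds x₁ hr)) ?_
  filter_upwards [Metric.ball_mem_nhds x₁ hr] with x hx using (hroot x hx _).2 ⟨k, rfl⟩

lemma exists_partPoly_bound (hF : F.IsHomogeneous d) (he : MvPolynomial.eval e F ≠ 0) (t : ℂ) :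
    ∃ C, ∀ x, ‖(partPoly F e u w Q x).eval t‖ ≤ C * (1 + ‖x‖) ^ d := by
  classical
  obtain ⟨K, hK, hfar⟩ := exists_far_bound hF he
  set c := 1 + ‖t‖ + K * (‖w‖ + ‖u‖)
  have hc : 1 ≤ c := by
    have : 0 ≤ ‖t‖ + K * (‖w‖ + ‖u‖) := by positivity
    simp only [c]
    linarith
  refine ⟨c ^ d, fun x => ?_⟩
  rw [← mul_pow, partPoly, Polynomial.eval_prod, norm_prod]
  have h0 : fib F e u w x ≠ 0 := linePoly_ne_zero e _ hF he
  have hx : 1 ≤ 1 + ‖x‖ := by linarith [norm_nonneg x]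
  have hM : 1 ≤ c * (1 + ‖x‖) := one_le_mul_of_one_le_of_one_le hc hx
  refine (Finset.prod_le_prod (g := fun _ => c * (1 + ‖x‖)) (fun _ _ => norm_nonneg _)
    fun y hy => ?_).trans ((Finset.prod_const _).trans_le (pow_le_pow_right₀ hM ?_))
  · simp only [Finset.mem_filter, Multiset.mem_toFinset, Polynomial.mem_roots h0,
      Polynomial.IsRoot.def] at hy
    have hy1 : ‖y‖ ≤ K * ‖w + x • u‖ := by
      by_contra! hlt
      have : y ≠ 0 := norm_pos_iff.1 (lt_of_le_of_lt (by positivity) hlt)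
      exact hfar (w + x • u) y this hlt.le (by simpa [pt] using hy.1)
    have hy2 : ‖w + x • u‖ ≤ (‖w‖ + ‖u‖) * (1 + ‖x‖) := by
      refine (norm_add_le _ _).trans ?_
      rw [norm_smul]
      nlinarith [norm_nonneg w, norm_nonneg u, norm_nonneg x, mul_nonneg (norm_nonneg w)
          (norm_nonneg x)]
    have hy3 := mul_le_mul_of_nonneg_left hy2 hK.le
    rw [Polynomial.eval_sub, Polynomial.eval_X, Polynomial.eval_C]
    refine (norm_sub_le _ _).trans ?_
    have : 0 ≤ (1 + ‖t‖) * ‖x‖ := by positivity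
    simp only [c]
    nlinarith
  · exact (Finset.card_filter_le _ _).trans ((Multiset.toFinset_card_le _).trans
      ((Polynomial.card_roots' _).trans (linePoly_natDegree_le e _ hF)))

end Parts

section Connected

variable {F : MvPolynomial (Fin 3) ℂ} {e u w : Fin 3 → ℂ} {d : ℕ} {Q : ℂ × ℂ → Prop}

lemma exists_linear_form (φ : (Fin 3 → ℂ) →ₗ[ℂ] ℂ) :
    ∃ α : MvPolynomial (Fin 3) ℂ, ∀ v, MvPolynomial.eval v α = φ v := by
  refine ⟨∑ i, MvPolynomial.C (φ (Pi.single i 1)) * MvPolynomial.X i, fun v => ?_⟩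
  conv_rhs => rw [← Finset.univ_sum_single v, map_sum]
  simp only [map_sum, map_mul, eval_C, eval_X]
  refine Finset.sum_congr rfl fun i _ => ?_
  rw [mul_comm, ← smul_eq_mul, ← map_smul, ← Pi.single_smul, smul_eq_mul, mul_one]

lemma exists_dual_forms (hli : LinearIndependent ℂ ![u, e, w]) :
    ∃ α β γ : MvPolynomial (Fin 3) ℂ,
      (∀ v, v = MvPolynomial.eval v α • u + MvPolynomial.eval v β • e + MvPolynomial.eval v γ • w) ∧
      (∀ (c : ℂ) v, MvPolynomial.eval (c • v) α = c * MvPolynomial.eval v α ∧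
        MvPolynomial.eval (c • v) β = c * MvPolynomial.eval v β ∧
        MvPolynomial.eval (c • v) γ = c * MvPolynomial.eval v γ) ∧
      ∀ x y, MvPolynomial.eval (pt e u w x y) α = x ∧ MvPolynomial.eval (pt e u w x y) β = y ∧
        MvPolynomial.eval (pt e u w x y) γ = 1 := by
  set b := basisOfLinearIndependentOfCardEqFinrank hli (by simp)
  have hb : ⇑b = ![u, e, w] := coe_basisOfLinearIndependentOfCardEqFinrank _ _
  have hb0 : u = b 0 := by rw [hb]; rfl
  have hb1 : e = b 1 := by rw [hb]; rfl
  have hb2 : w = b 2 := by rw [hb]; rfl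
  obtain ⟨α, hα⟩ := exists_linear_form (b.coord 0)
  obtain ⟨β, hβ⟩ := exists_linear_form (b.coord 1)
  obtain ⟨γ, hγ⟩ := exists_linear_form (b.coord 2)
  refine ⟨α, β, γ, fun v => ?_, fun c v => by simp [hα, hβ, hγ], fun x y => ?_⟩
  · conv_lhs => rw [← b.sum_repr v, Fin.sum_univ_three, ← hb0, ← hb1, ← hb2]
    simp [hα, hβ, hγ]
  · rw [hα, hβ, hγ, pt, hb0, hb1, hb2]
    simp

/-- The value of the homogenization of `p` in degree `d` at a pair of polynomials. -/
noncomputable def homogEval (d : ℕ) (p : Polynomial ℂ) (α γ : MvPolynomial (Fin 3) ℂ) :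
    MvPolynomial (Fin 3) ℂ :=
  ∑ i ∈ Finset.range (d + 1), MvPolynomial.C (p.coeff i) * α ^ i * γ ^ (d - i)

lemma eval_homogEval_of_eval_eq_one {p : Polynomial ℂ} (hp : p.natDegree ≤ d)
    {α γ : MvPolynomial (Fin 3) ℂ} {v : Fin 3 → ℂ} (h : MvPolynomial.eval v γ = 1) :
    MvPolynomial.eval v (homogEval d p α γ) = p.eval (MvPolynomial.eval v α) := by
  rw [Polynomial.eval_eq_sum_range' (Nat.lt_succ_of_le hp), homogEval, map_sum]
  simp [h]

lemma eval_homogEval_smul {p : Polynomial ℂ} {α γ : MvPolynomial (Fin 3) ℂ} {v : Fin 3 → ℂ} {c : ℂ}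
    (hα : MvPolynomial.eval (c • v) α = c * MvPolynomial.eval v α)
    (hγ : MvPolynomial.eval (c • v) γ = c * MvPolynomial.eval v γ) :
    MvPolynomial.eval (c • v) (homogEval d p α γ) =
      c ^ d * MvPolynomial.eval v (homogEval d p α γ) := by
  simp only [homogEval, map_sum, map_mul, map_pow, eval_C, hα, hγ, Finset.mul_sum]
  refine Finset.sum_congr rfl fun i hi => ?_
  rw [← Nat.add_sub_of_le (Nat.lt_succ_iff.1 (Finset.mem_range.1 hi)), pow_add,
    Nat.add_sub_cancel_left]
  ring

/-- A union of components of the curve is cut out by a form. -/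
lemma IsPart.exists_form (hQ : IsPart F e u w Q) (hF : F.IsHomogeneous d)
    (he : MvPolynomial.eval e F ≠ 0) (hli : LinearIndependent ℂ ![u, e, w])
    (hZ : {x | ¬ (fib F e u w x).Separable}.Finite) :
    ∃ G : MvPolynomial (Fin 3) ℂ,
      (∀ x, (fib F e u w x).Separable → ∀ y, MvPolynomial.eval (pt e u w x y) G =
        (partPoly F e u w Q x).eval y) ∧
      ∀ (c : ℂ) v, MvPolynomial.eval (c • v) G = c ^ (2 * d) * MvPolynomial.eval v G := by
  classical
  obtain ⟨α, β, γ, -, hsm, hpt⟩ := exists_dual_forms hli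
  have hq : ∀ t : ℂ, ∃ q : Polynomial ℂ, q.natDegree ≤ d ∧ ∀ x, (fib F e u w x).Separable →
      (partPoly F e u w Q x).eval t = q.eval x := by
    intro t
    obtain ⟨C, hC⟩ := exists_partPoly_bound (u := u) (w := w) (Q := Q) hF he t
    obtain ⟨q, hq, h⟩ := exists_polynomial_of_growth_off_finite hZ
      (fun x hx => hQ.differentiableAt hF he (not_not.1 hx) t) fun x _ => hC x
    exact ⟨q, hq, fun x hx => h x (not_not.2 hx)⟩
  choose q hqd hqe using hq
  set s := Finset.range (d + 1)
  have hinj : InjOn (fun i : ℕ => (i : ℂ)) s := Nat.cast_injective.injOn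
  refine ⟨∑ i ∈ s, homogEval d (q i) α γ *
    homogEval d (Lagrange.basis s (fun i : ℕ => (i : ℂ)) i) β γ, fun x hx y => ?_, fun c v => ?_⟩
  · have hdeg : (partPoly F e u w Q x).degree < s.card := by
      refine Polynomial.degree_le_natDegree.trans_lt ?_
      rw [Finset.card_range]
      exact_mod_cast Nat.lt_succ_of_le (partPoly_natDegree_le hF x)
    rw [Lagrange.eq_interpolate hinj hdeg, Lagrange.interpolate_apply, Polynomial.eval_finsetSum,
      map_sum]
    refine Finset.sum_congr rfl fun i hi => ?_
    obtain ⟨h1, h2, h3⟩ := hpt x y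
    rw [map_mul, eval_homogEval_of_eval_eq_one (hqd _) h3, eval_homogEval_of_eval_eq_one ?_ h3,
      h1, h2, Polynomial.eval_mul, Polynomial.eval_C, hqe _ x hx]
    refine Polynomial.natDegree_le_iff_degree_le.2 ?_
    rw [Lagrange.degree_basis hinj hi, Finset.card_range]
    simp
  · obtain ⟨h1, h2, h3⟩ := hsm c v
    rw [map_sum, map_sum, Finset.mul_sum]
    refine Finset.sum_congr rfl fun i _ => ?_
    rw [map_mul, map_mul, eval_homogEval_smul h1 h3, eval_homogEval_smul h2 h3]
    ring

/-- An irreducible curve is path connected off finitely many fibres. -/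
theorem joined_curve (hF : F.IsHomogeneous d) (hd : 1 ≤ d) (hirr : Irreducible F)
    (he : MvPolynomial.eval e F ≠ 0) (hli : LinearIndependent ℂ ![u, e, w])
    (hZ : {x | ¬ (fib F e u w x).Separable}.Finite) (p₀ p₁ : Crv F e u w) : Joined p₀ p₁ := by
  set Q : ℂ × ℂ → Prop := fun p => ∃ q : Crv F e u w, q.1 = p ∧ Joined p₀ q with hQdef
  have hQ : IsPart F e u w Q := by
    rintro p q hpq ⟨p', hp', h⟩
    obtain rfl := Subtype.ext hp'
    exact ⟨q, rfl, h.trans hpq⟩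
  obtain ⟨G, hG, hGs⟩ := hQ.exists_form hF he hli hZ
  obtain ⟨G', hG', hGs'⟩ := hQ.not.exists_form hF he hli hZ
  obtain ⟨α, β, γ, hv, hsm, hpt⟩ := exists_dual_forms hli
  have hplane : ∀ x y, MvPolynomial.eval e F * (MvPolynomial.eval (pt e u w x y) G *
      MvPolynomial.eval (pt e u w x y) G') = MvPolynomial.eval (pt e u w x y) F := by
    intro x y
    have hdense : Dense {x | ¬ (fib F e u w x).Separable}ᶜ := hZ.countable.dense_compl ℂ
    have hcont : ∀ H : MvPolynomial (Fin 3) ℂ,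
        Continuous fun x => MvPolynomial.eval (pt e u w x y) H := fun H =>
      (MvPolynomial.continuous_eval H).comp (by fun_prop)
    refine congrFun (Continuous.ext_on hdense (continuous_const.mul ((hcont G).mul (hcont G')))
      (hcont F) fun x hx => ?_) x
    have hx' : (fib F e u w x).Separable := not_not.1 hx
    have := congrArg (Polynomial.eval y) (partPoly_mul_compl (Q := Q) hF he hx')
    rw [Polynomial.eval_mul, Polynomial.eval_mul, Polynomial.eval_C, fib_eval] at this
    show MvPolynomial.eval e F * (MvPolynomial.eval (pt e u w x y) G *
      MvPolynomial.eval (pt e u w x y) G') = MvPolynomial.eval (pt e u w x y) F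
    rw [hG x hx', hG' x hx', this]
  have hmul : MvPolynomial.C (MvPolynomial.eval e F) * (G * G') * γ ^ d = γ ^ (4 * d) * F := by
    refine MvPolynomial.funext fun v => ?_
    simp only [map_mul, map_pow, eval_C]
    by_cases hγ : MvPolynomial.eval v γ = 0
    · rw [hγ, zero_pow (by omega), zero_pow (by omega)]
      ring
    · set c := MvPolynomial.eval v γ
      have hvc : v = c • pt e u w (MvPolynomial.eval v α / c) (MvPolynomial.eval v β / c) := by
        conv_lhs => rw [hv v]
        simp only [pt, smul_add, smul_smul, mul_div_cancel₀ _ hγ]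
        abel
      have := hplane (MvPolynomial.eval v α / c) (MvPolynomial.eval v β / c)
      rw [hvc, hGs, hGs', eval_smul_of_homogeneous hF, ← this]
      ring
  have hprime : Prime F := hirr.prime
  have hdvd : F ∣ MvPolynomial.C (MvPolynomial.eval e F) * (G * G') * γ ^ d :=
    hmul ▸ Dvd.intro_left _ rfl
  have hvanish : ∀ H, F ∣ H → ∀ p : Crv F e u w, MvPolynomial.eval (pt e u w p.1.1 p.1.2) H = 0 :=
      by
    rintro _ ⟨H, rfl⟩ p
    rw [map_mul, ← fib_eval, p.2.2, zero_mul]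
  rcases hprime.dvd_or_dvd hdvd with h | h
  · rcases hprime.dvd_or_dvd h with h | h
    · have := hvanish _ h p₀
      rw [eval_C] at this
      exact absurd this he
    · rcases hprime.dvd_or_dvd h with h | h
      · have := hvanish _ h p₁
        rw [hG _ p₁.2.1, partPoly_eval_eq_zero hF he] at this
        obtain ⟨q, hq, hj⟩ := this.2
        rwa [Subtype.ext hq] at hj
      · have := hvanish _ h p₀
        rw [hG' _ p₀.2.1, partPoly_eval_eq_zero hF he] at this
        exact absurd ⟨p₀, rfl, Joined.refl p₀⟩ this.2
  · have := hvanish _ (hprime.dvd_of_dvd_pow h) p₀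
    rw [(hpt _ _).2.2] at this
    exact absurd this one_ne_zero

end Connected

section LoopFamilies

/-- A family of homotopy classes of loops which is stable under composition, inversion and change
of base point. -/
structure LoopFamily {X : Type*} [TopologicalSpace X] (H : ∀ {q : X}, PC q q → Prop) : Prop where
  refl : ∀ q : X, H (Path.Homotopic.Quotient.refl q)
  trans : ∀ {q : X} {a b : PC q q}, H a → H b → H (a ⬝ b)
  symm : ∀ {q : X} {a : PC q q}, H a → H a.symm
  conj : ∀ {q r : X} (a : PC q r) {g : PC r r}, H g → H (a ⬝ g ⬝ a.symm)

/-- The loop winding `n` times around a circle. -/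
noncomputable def arc {U : Set ℂ} (s ζ : ℂ)
    (h : ∀ θ : ℝ, s + ζ * Complex.exp (2 * Real.pi * Complex.I * θ) ∈ U) {q : U}
    (hq : (q : ℂ) = s + ζ) (n : ℤ) : Path q q :=
  mkPath (fun t => ⟨_, h (n * (t : ℝ))⟩) (by fun_prop) (Subtype.ext (by simp [hq]))
    (Subtype.ext (by
      have := Complex.exp_int_mul_two_pi_mul_I n
      simp only [Icc.coe_one, mul_one, Complex.ofReal_intCast, hq]
      rw [mul_comm _ (n : ℂ), this, mul_one]))

lemma exp_add_int (m : ℤ) (θ : ℝ) : Complex.exp (2 * Real.pi * Complex.I * ((m + θ : ℝ) : ℂ)) =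
    Complex.exp (2 * Real.pi * Complex.I * θ) := by
  have := Complex.exp_int_mul_two_pi_mul_I m
  rw [Complex.ofReal_add, mul_add, Complex.exp_add, Complex.ofReal_intCast, mul_comm _ (m : ℂ),
    this, one_mul]

section Arc

variable {U : Set ℂ} {s ζ : ℂ}
  (h : ∀ θ : ℝ, s + ζ * Complex.exp (2 * Real.pi * Complex.I * θ) ∈ U) {q : U}
  (hq : (q : ℂ) = s + ζ)

lemma cls_arc_add_one (m : ℤ) :
    cls (arc s ζ h hq m) ⬝ cls (arc s ζ h hq 1) = cls (arc s ζ h hq (m + 1)) := by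
  have := cls_square (fun p : I × I => (⟨_, h (m * p.1 + p.2 + m * p.2 - m * p.1 * p.2)⟩ : U))
    (by fun_prop) (arc s ζ h hq m) (arc s ζ h hq 1) (arc s ζ h hq (m + 1)) (Path.refl q)
    (fun t => ?_) (fun t => ?_) (fun t => ?_) fun t => ?_
  · simpa using this
  · simp [arc]
  · refine Subtype.ext ?_
    simp only [arc, mkPath_apply]
    rw [show (m * ((1 : I) : ℝ) + t + m * t - m * ((1 : I) : ℝ) * t : ℝ) = m + ((1 : ℤ) * t : ℝ) by
      simp, exp_add_int]
  · refine Subtype.ext ?_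
    simp only [arc, mkPath_apply]
    congr 5
    simp
    ring
  · refine Subtype.ext ?_
    simp only [Path.refl_apply]
    rw [show (m * (t : ℝ) + ((1 : I) : ℝ) + m * ((1 : I) : ℝ) - m * (t : ℝ) * ((1 : I) : ℝ) : ℝ) =
      (m + 1 : ℤ) + (0 : ℝ) by simp; ring, exp_add_int]
    simp [hq]

lemma LoopFamily.arc {H : ∀ {q : U}, PC q q → Prop} (hH : LoopFamily H)
    (h1 : H (cls (arc s ζ h hq 1))) (n : ℤ) : H (cls (MilnorNodal.arc s ζ h hq n)) := by
  induction n using Int.induction_on with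
  | zero =>
    have : MilnorNodal.arc s ζ h hq 0 = Path.refl q := by
      ext t
      simp [MilnorNodal.arc, hq]
    rw [this]
    exact hH.refl q
  | succ i ih =>
    rw [← cls_arc_add_one]
    exact hH.trans ih h1
  | pred i ih =>
    have := cls_arc_add_one h hq (-(i : ℤ) - 1)
    rw [sub_add_cancel] at this
    have h2 : cls (MilnorNodal.arc s ζ h hq (-(i : ℤ) - 1)) =
        cls (MilnorNodal.arc s ζ h hq (-(i : ℤ))) ⬝ (cls (MilnorNodal.arc s ζ h hq 1)).symm := by
      rw [← this, Path.Homotopic.Quotient.trans_assoc]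
      simp
    rw [h2]
    exact hH.trans ih (hH.symm h1)

/-- A loop in a punctured disc winds around a circle. -/
lemma exists_cls_eq_arc {ρ : ℝ} (hU : ∀ ξ : ℂ, ξ ≠ 0 → ‖ξ‖ < ρ → s + ξ ∈ U) (γ : Path q q)
    (hγ : ∀ t, (γ t : ℂ) ≠ s ∧ ‖(γ t : ℂ) - s‖ < ρ) : ∃ n, cls γ = cls (arc s ζ h hq n) := by
  have hζ : ζ ≠ 0 := fun h0 => (hγ 0).1 (by simp [hq, h0])
  let δ : Path (⟨ζ, hζ⟩ : {z : ℂ // z ≠ 0}) ⟨ζ, hζ⟩ :=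
    mkPath (fun t => ⟨(γ t : ℂ) - s, sub_ne_zero.2 (hγ t).1⟩) (by fun_prop)
      (by simp [hq]) (by simp [hq])
  obtain ⟨e', Γ, hΓ⟩ := exists_path_lift Complex.isCoveringMap_exp δ (e := Complex.log ζ)
    (Subtype.ext (Complex.exp_log hζ))
  have hexp : ∀ t, Complex.exp (Γ t) = (γ t : ℂ) - s := fun t => congrArg Subtype.val (hΓ t)
  obtain ⟨n, hn⟩ : ∃ n : ℤ, e' = Complex.log ζ + n * (2 * Real.pi * Complex.I) := by
    refine Complex.exp_eq_exp_iff_exists_int.1 ?_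
    have := hexp 1
    rw [Γ.target, γ.target, hq] at this
    rw [this, Complex.exp_log hζ]
    ring
  refine ⟨n, ?_⟩
  set θ : I → ℂ := fun t => Complex.log ζ + n * (2 * Real.pi * Complex.I) * ((t : ℝ) : ℂ)
  have hre : ∀ t, (Γ t).re < Real.log ρ := fun t => by
    have := (hγ t).2
    rw [← hexp, Complex.norm_exp] at this
    exact (Real.lt_log_iff_exp_lt ((Real.exp_pos _).trans this)).2 this
  have hρ : 0 < ρ := (norm_nonneg _).trans_lt (hγ 0).2
  have hθ : ∀ t, (θ t).re < Real.log ρ := fun t => by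
    have h0 := hre 0
    rw [Γ.source] at h0
    have : (θ t).re = (Complex.log ζ).re := by simp [θ]
    rwa [this]
  have hmem : ∀ p : I × I, s + Complex.exp ((1 - (p.2 : ℝ) : ℝ) * Γ p.1 + (p.2 : ℝ) * θ p.1) ∈ U :=
      by
    intro p
    refine hU _ (Complex.exp_ne_zero _) ?_
    rw [Complex.norm_exp, ← Real.lt_log_iff_exp_lt hρ, Complex.add_re, Complex.re_ofReal_mul,
      Complex.re_ofReal_mul]
    have h1 := hre p.1
    have h2 := hθ p.1
    have h3 := p.2.2.1
    have h4 := p.2.2.2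
    rcases h3.eq_or_lt with h0 | h0
    · rw [← h0]; linarith
    · nlinarith
  refine cls_eq_of_homotopy (fun p => ⟨_, hmem p⟩) ?_ ?_ ?_ ?_ ?_
  · simp only [θ]
    fun_prop
  · intro t
    refine Subtype.ext ?_
    simp [hexp]
  · intro t
    refine Subtype.ext ?_
    simp [θ, arc, Complex.exp_add, Complex.exp_log hζ]
    left
    ring_nf
  · intro t
    refine Subtype.ext ?_
    have : ((1 - (t : ℝ) : ℝ) : ℂ) * Complex.log ζ + (t : ℝ) * Complex.log ζ = Complex.log ζ := by
      push_cast; ring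
    simp only [Γ.source, θ, hq, Icc.coe_zero, Complex.ofReal_zero, mul_zero, add_zero]
    rw [this, Complex.exp_log hζ]
  · intro t
    refine Subtype.ext ?_
    have h1 := hexp 1
    rw [Γ.target] at h1
    have : ((1 - (t : ℝ) : ℝ) : ℂ) * e' + (t : ℝ) * e' = e' := by
      push_cast; ring
    simp only [Γ.target, θ, Icc.coe_one, Complex.ofReal_one, mul_one, ← hn]
    rw [this, h1, γ.target]
    ring

end Arc

end LoopFamilies

section PuncturedPlane

/-- Every loop in `K` belongs to the family `H`. -/
def LoopsIn {E : Type*} [TopologicalSpace E] {U : Set E} (H : ∀ {q : U}, PC q q → Prop)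
    (K : Set E) : Prop :=
  ∀ (q : U) (l : Path q q), (∀ t, (l t : E) ∈ K) → H (cls l)

lemma LoopFamily.of_conj {X : Type*} [TopologicalSpace X] {H : ∀ {q : X}, PC q q → Prop}
    (hH : LoopFamily H) {q r : X} (a : PC q r) {g : PC r r} (h : H (a ⬝ g ⬝ a.symm)) : H g := by
  have := hH.conj a.symm h
  simpa [Path.Homotopic.Quotient.trans_assoc] using this

lemma LoopsIn.union {E : Type*} [NormedAddCommGroup E] [NormedSpace ℝ E] {U : Set E}
    {H : ∀ {q : U}, PC q q → Prop} (hH : LoopFamily H)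
    {K₁ K₂ : Set E} (ho₁ : IsOpen K₁) (ho₂ : IsOpen K₂)
    (hc : Convex ℝ (K₁ ∩ K₂)) (hU : K₁ ∩ K₂ ⊆ U)
    (hj₁ : ∀ {x y : E}, x ∈ K₁ → y ∈ K₁ → x ∈ U → y ∈ U → JoinedIn (K₁ ∩ U) x y)
    (hj₂ : ∀ {x y : E}, x ∈ K₂ → y ∈ K₂ → x ∈ U → y ∈ U → JoinedIn (K₂ ∩ U) x y)
    (hne : (K₁ ∩ K₂).Nonempty) (h₁ : LoopsIn H K₁) (h₂ : LoopsIn H K₂) :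
    LoopsIn H (K₁ ∪ K₂) := by
  obtain ⟨c, hc₁, hc₂⟩ := hne
  let q₀ : U := ⟨c, hU ⟨hc₁, hc₂⟩⟩
  let Y := {y : U // (y : E) ∈ K₁ ∪ K₂}
  let ι : C(Y, U) := ⟨Subtype.val, continuous_subtype_val⟩
  have hex : ∀ y : Y, ∃ a : Path q₀ (ι y), ((ι y : E) ∈ K₁ → ∀ t, (a t : E) ∈ K₁) ∧
      ((ι y : E) ∈ K₂ → ∀ t, (a t : E) ∈ K₂) := by
    rintro ⟨y, hy⟩
    by_cases hy₁ : (y : E) ∈ K₁ <;> by_cases hy₂ : (y : E) ∈ K₂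
    · have hs := hc.segment_subset (x := (q₀ : E)) ⟨hc₁, hc₂⟩ ⟨hy₁, hy₂⟩
      exact ⟨segPath q₀ y (hs.trans hU), fun _ t => (hs (segPath_mem_segment _ _ _ t)).1,
        fun _ t => (hs (segPath_mem_segment _ _ _ t)).2⟩
    · obtain ⟨γ, hγ⟩ := JoinedIn.exists_subtype_path inter_subset_right
        (hj₁ (x := (q₀ : E)) hc₁ hy₁ q₀.2 y.2)
      exact ⟨γ, fun _ t => (hγ t).1, fun h => absurd h hy₂⟩
    · obtain ⟨γ, hγ⟩ := JoinedIn.exists_subtype_path inter_subset_right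
        (hj₂ (x := (q₀ : E)) hc₂ hy₂ q₀.2 y.2)
      exact ⟨γ, fun h => absurd h hy₁, fun _ t => (hγ t).1⟩
    · exact absurd hy (by simp [hy₁, hy₂])
  choose a ha₁ ha₂ using hex
  have key : ∀ {y z : Y} (g : PC y z), H (cls (a y) ⬝ g.map ι ⬝ (cls (a z)).symm) := by
    refine fun {y z} g => PC.induction_local
      (fun {y z} g => H (cls (a y) ⬝ g.map ι ⬝ (cls (a z)).symm)) ?_ ?_ g
    · intro x y z b c hb hc
      have := hH.trans hb hc
      simpa [Path.Homotopic.Quotient.trans_assoc] using this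
    · have aux : ∀ K : Set E, IsOpen K → LoopsIn H K →
          (∀ y : Y, (ι y : E) ∈ K → ∀ t, (a y t : E) ∈ K) → ∀ x : Y, (ι x : E) ∈ K →
          ∃ V ∈ 𝓝 x, ∀ {y z : Y} (γ : Path y z), range γ ⊆ V →
            H (cls (a y) ⬝ (cls γ).map ι ⬝ (cls (a z)).symm) := by
        intro K hK hKH haK x hx
        refine ⟨{y | (ι y : E) ∈ K}, (hK.preimage (by fun_prop)).mem_nhds hx, ?_⟩
        intro y z γ hγ
        have hγK : ∀ t, (ι (γ t) : E) ∈ K := fun t => hγ ⟨t, rfl⟩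
        have hy := hγK 0
        have hz := hγK 1
        rw [γ.source] at hy
        rw [γ.target] at hz
        refine hKH _ (((a y).trans (γ.map ι.continuous)).trans (a z).symm) ?_
        exact trans_forall (p := fun v : U => (v : E) ∈ K)
          (trans_forall (p := fun v : U => (v : E) ∈ K) (haK y hy) hγK)
          (fun t => haK z hz _)
      intro x
      rcases x.2 with h | h
      · exact aux K₁ ho₁ h₁ ha₁ x h
      · exact aux K₂ ho₂ h₂ ha₂ x h
  intro q l hl
  let q' : Y := ⟨q, by simpa using hl 0⟩
  let l' : Path q' q' := mkPath (fun t => ⟨l t, hl t⟩) (by fun_prop) (by simp [q']) (by simp [q'])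
  exact hH.of_conj _ (key (cls l'))

variable {S : Set ℂ} {H : ∀ {q : (Sᶜ : Set ℂ)}, PC q q → Prop}

/-- The family `H` contains the small circles around the points of `S`. -/
def SmallCircles (S : Set ℂ) (H : ∀ {q : (Sᶜ : Set ℂ)}, PC q q → Prop) : Prop :=
  ∀ s ∈ S, ∃ ρ > 0, ∀ (ζ : ℂ) (h : ∀ θ : ℝ, s + ζ * Complex.exp (2 * Real.pi * Complex.I * θ) ∈ Sᶜ)
    (q : (Sᶜ : Set ℂ)) (hq : (q : ℂ) = s + ζ), ‖ζ‖ < ρ → H (cls (arc s ζ h hq 1))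

lemma loopsIn_of_subset_singleton (hS : S.Finite) (hH : LoopFamily H) (hsm : SmallCircles S H)
    {K : Set ℂ} (hK : Convex ℝ K) {s : ℂ} (hs : S ∩ K = {s}) : LoopsIn H K := by
  obtain ⟨hsS, hsK⟩ : s ∈ S ∩ K := by rw [hs]; rfl
  obtain ⟨ρ, hρ, hρH⟩ := hsm s hsS
  obtain ⟨ρ', hρ', hball⟩ : ∃ ρ' > 0, ∀ ξ : ℂ, ξ ≠ 0 → ‖ξ‖ < ρ' → s + ξ ∈ Sᶜ := by
    have h1 : (S \ {s})ᶜ ∈ 𝓝 s := (hS.subset sdiff_subset).isClosed.isOpen_compl.mem_nhds (by simp)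
    obtain ⟨ρ', hρ', hb⟩ := Metric.mem_nhds_iff.1 h1
    refine ⟨ρ', hρ', fun ξ hξ hn hmem => hb (a := s + ξ) (by simpa using hn) ⟨hmem, ?_⟩⟩
    simpa using hξ
  intro q l hl
  obtain ⟨R, hR⟩ : ∃ R, ∀ t, ‖(l t : ℂ) - s‖ ≤ R := by
    have : Continuous fun t => ‖(l t : ℂ) - s‖ := by fun_prop
    obtain ⟨R, hR⟩ := (isCompact_range this).bddAbove
    exact ⟨R, fun t => hR ⟨t, rfl⟩⟩
  have hR0 : 0 ≤ R := (norm_nonneg _).trans (hR 0)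
  have hls : ∀ t, (l t : ℂ) - s ≠ 0 := fun t h0 => (l t).2 (by rwa [sub_eq_zero.1 h0])
  set r := min ρ ρ' with hr
  have hr0 : 0 < r := lt_min hρ hρ'
  set κ : ℝ := r / (R + r) with hκ
  have hRr : 0 < R + r := by positivity
  have hκ0 : 0 < κ := by positivity
  have hκ1 : κ ≤ 1 := (div_le_one hRr).2 (by linarith)
  have hκR : κ * R < r := by
    rw [hκ, div_mul_eq_mul_div, div_lt_iff₀ hRr]
    nlinarith
  have hmem : ∀ (t x : I), s + (((1 - x) + x * κ : ℝ) : ℂ) * ((l t : ℂ) - s) ∈ Sᶜ := by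
    intro t x hS'
    have hx0 := x.2.1
    have hx1 := x.2.2
    have hc0 : 0 < (1 - (x : ℝ)) + x * κ := by
      rcases hx0.eq_or_lt with h | h
      · rw [← h]; norm_num
      · have := mul_pos h hκ0
        linarith
    have hc1 : (1 - (x : ℝ)) + x * κ ≤ 1 := by nlinarith
    have hKmem : s + (((1 - x) + x * κ : ℝ) : ℂ) * ((l t : ℂ) - s) ∈ K := by
      have := hK.add_smul_sub_mem hsK (hl t) ⟨hc0.le, hc1⟩
      simpa using this
    have : s + (((1 - x) + x * κ : ℝ) : ℂ) * ((l t : ℂ) - s) ∈ S ∩ K := ⟨hS', hKmem⟩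
    rw [hs, mem_singleton_iff, add_eq_left] at this
    exact (mul_ne_zero (Complex.ofReal_ne_zero.2 hc0.ne') (hls t)) this
  let q' : (Sᶜ : Set ℂ) := ⟨_, hmem 0 1⟩
  let l' : Path q' q' := mkPath (fun t => ⟨_, hmem t 1⟩) (by fun_prop) rfl (by simp [q'])
  let m : Path q q' := mkPath (fun x => ⟨_, hmem 0 x⟩) (by fun_prop) (by simp) rfl
  have hsq : cls l ⬝ cls m = cls m ⬝ cls l' := by
    refine cls_square (fun p : I × I => (⟨_, hmem p.1 p.2⟩ : (Sᶜ : Set ℂ))) (by fun_prop) l m m l'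
      (fun t => ?_) (fun t => ?_) (fun t => rfl) fun t => rfl
    · exact Subtype.ext (by simp)
    · exact Subtype.ext (by simp [m])
  have hl' : ∀ t, (l' t : ℂ) = s + (κ : ℂ) * ((l t : ℂ) - s) := fun t => by simp [l']
  have hcirc : ∀ θ : ℝ, s + ((κ : ℂ) * ((q : ℂ) - s)) * Complex.exp (2 * Real.pi * Complex.I * θ)
      ∈ Sᶜ := by
    intro θ
    have h0 := hls 0
    have hR0' := hR 0
    rw [l.source] at h0 hR0'
    refine hball _ (mul_ne_zero (mul_ne_zero (by exact_mod_cast hκ0.ne') h0)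
      (Complex.exp_ne_zero _)) ?_
    have : 2 * Real.pi * Complex.I * θ = ((2 * Real.pi * θ : ℝ) : ℂ) * Complex.I := by
      push_cast; ring
    rw [norm_mul, this, Complex.norm_exp_ofReal_mul_I, mul_one, norm_mul, Complex.norm_real,
      Real.norm_of_nonneg hκ0.le]
    exact ((mul_le_mul_of_nonneg_left hR0' hκ0.le).trans_lt hκR).trans_le (min_le_right _ _)
  have hq' : (q' : ℂ) = s + (κ : ℂ) * ((q : ℂ) - s) := by simp [q']
  have hnorm : ∀ t, ‖(κ : ℂ) * ((l t : ℂ) - s)‖ < r := fun t => by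
    rw [norm_mul, Complex.norm_real, Real.norm_of_nonneg hκ0.le]
    exact (mul_le_mul_of_nonneg_left (hR t) hκ0.le).trans_lt hκR
  have hq0 := hnorm 0
  rw [l.source] at hq0
  obtain ⟨n, hn⟩ := exists_cls_eq_arc hcirc hq' (ρ := ρ') hball l' fun t => by
    rw [hl' t]
    refine ⟨?_, by simpa using (hnorm t).trans_le (min_le_right _ _)⟩
    rw [Ne, add_eq_left]
    exact mul_ne_zero (by exact_mod_cast hκ0.ne') (hls t)
  have hl'H : H (cls l') := by
    rw [hn]
    exact hH.arc hcirc hq' (hρH _ hcirc q' hq' (hq0.trans_le (min_le_left _ _))) n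
  have : cls l = cls m ⬝ cls l' ⬝ (cls m).symm := by
    rw [← hsq, Path.Homotopic.Quotient.trans_assoc]
    simp
  rw [this]
  exact hH.conj _ hl'H

theorem loopsIn_of_smallCircles (hS : S.Finite) (hH : LoopFamily H) (hsm : SmallCircles S H)
    {K : Set ℂ} (hKo : IsOpen K) (hK : Convex ℝ K) : LoopsIn H K := by
  induction hn : (S ∩ K).ncard using Nat.strong_induction_on generalizing K with
  | _ n ih =>
  have hfin : (S ∩ K).Finite := hS.subset inter_subset_left
  rcases (S ∩ K).subsingleton_or_nontrivial with hsub | ⟨s, hs, s', hs', hne⟩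
  · rcases hsub.eq_empty_or_singleton with h0 | ⟨s, hs⟩
    · intro q l hl
      have : cls l = cls (Path.refl q) := cls_eq_of_convex hK
        (fun x hx hxS => (h0 ▸ (⟨hxS, hx⟩ : x ∈ S ∩ K) : x ∈ (∅ : Set ℂ))) l (Path.refl q) hl
        fun t => by simpa using hl 0
      rw [this]
      exact hH.refl q
    · exact loopsIn_of_subset_singleton hS hH hsm hK hs
  · let φ : ℂ →L[ℝ] ℝ := Complex.reCLM.comp ((ContinuousLinearMap.mul ℝ ℂ) (starRingEnd ℂ (s' - s)))
    have hφ : φ s < φ s' := by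
      have h1 : φ (s' - s) = Complex.normSq (s' - s) := by
        simp [φ, Complex.normSq_apply]
        ring
      have h2 := Complex.normSq_pos.2 (sub_ne_zero.2 hne.symm)
      rw [← h1, map_sub] at h2
      linarith
    obtain ⟨α, β, hsα, hαβ, hβs, hgap⟩ : ∃ α β, φ s < α ∧ α < β ∧ β < φ s' ∧
        ∀ y ∈ S ∩ K, φ y ≤ α ∨ β ≤ φ y := by
      have hfin' : (φ '' (S ∩ K)).Finite := hfin.image φ
      obtain ⟨c, ⟨hc1, hc2⟩, hc⟩ := (Ioo_infinite hφ).exists_notMem_finite hfin'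
      have hev : ∀ᶠ x in 𝓝 c, x ∉ φ '' (S ∩ K) := hfin'.isClosed.isOpen_compl.mem_nhds hc
      obtain ⟨l, u, hlu, hsub⟩ := mem_nhds_iff_exists_Ioo_subset.1
        (hev.and (Ioo_mem_nhds hc1 hc2))
      obtain ⟨α, hα1, hα2⟩ := exists_between hlu.1
      obtain ⟨β, hβ1, hβ2⟩ := exists_between hlu.2
      refine ⟨α, β, (hsub ⟨hα1, hα2.trans hlu.2⟩).2.1, hα2.trans hβ1,
        (hsub ⟨hlu.1.trans hβ1, hβ2⟩).2.2, fun y hy => ?_⟩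
      by_contra! hcon
      exact (hsub ⟨hα1.trans hcon.1, hcon.2.trans hβ2⟩).1 ⟨y, hy, rfl⟩
    set K₁ := K ∩ {y | φ y < β} with hK₁
    set K₂ := K ∩ {y | α < φ y} with hK₂
    have ho₁ : IsOpen K₁ := hKo.inter (isOpen_lt φ.continuous continuous_const)
    have ho₂ : IsOpen K₂ := hKo.inter (isOpen_lt continuous_const φ.continuous)
    have hc₁ : Convex ℝ K₁ := hK.inter (convex_halfSpace_lt φ.toLinearMap.isLinear β)
    have hc₂ : Convex ℝ K₂ := hK.inter (convex_halfSpace_gt φ.toLinearMap.isLinear α)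
    have hunion : K = K₁ ∪ K₂ := by
      ext y
      simp only [hK₁, hK₂, mem_union, mem_inter_iff, mem_ofPred_eq]
      constructor
      · intro hy
        rcases lt_or_ge (φ y) β with h | h
        · exact Or.inl ⟨hy, h⟩
        · exact Or.inr ⟨hy, hαβ.trans_le h⟩
      · rintro (h | h) <;> exact h.1
    have hj : ∀ {K' : Set ℂ}, IsOpen K' → Convex ℝ K' → ∀ {x y : ℂ}, x ∈ K' → y ∈ K' → x ∈ Sᶜ →
        y ∈ Sᶜ → JoinedIn (K' ∩ Sᶜ) x y := fun ho hc x y hx hy hxS hyS =>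
      Thin.joinedIn hS.thin ho hc hx hy hxS hyS
    have hlt : ∀ {K' : Set ℂ}, K' ⊆ K → (∃ y ∈ S ∩ K, y ∉ K') → (S ∩ K').ncard < n := by
      rintro K' hsub ⟨y, hy, hyK⟩
      rw [← hn]
      exact Set.ncard_lt_ncard ⟨inter_subset_inter_right _ hsub, fun h => hyK (h hy).2⟩ hfin
    have h₁ : LoopsIn H K₁ := ih _ (hlt inter_subset_left ⟨s', hs', fun h => (h.2.trans hβs).false⟩)
      ho₁ hc₁ rfl
    have h₂ : LoopsIn H K₂ := ih _ (hlt inter_subset_left ⟨s, hs, fun h => (h.2.trans hsα).false⟩)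
      ho₂ hc₂ rfl
    rw [hunion]
    refine LoopsIn.union hH ho₁ ho₂ (hc₁.inter hc₂) ?_ (hj ho₁ hc₁) (hj ho₂ hc₂) ?_ h₁ h₂
    · rintro y ⟨hy₁, hy₂⟩ hyS
      rcases hgap y ⟨hyS, hy₁.1⟩ with h | h
      · exact (h.trans_lt hy₂.2).false
      · exact (h.trans_lt hy₁.2).false
    · have hpre : IsPreconnected (φ '' K) := hK.isPreconnected.image _ φ.continuous.continuousOn
      obtain ⟨c, hc1, hc2⟩ := exists_between hαβ
      obtain ⟨y, hy, rfl⟩ := hpre.Icc_subset ⟨s, hs.2, rfl⟩ ⟨s', hs'.2, rfl⟩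
        ⟨(hsα.trans hc1).le, (hc2.trans hβs).le⟩
      exact ⟨y, ⟨hy, hc2⟩, hy, hc1⟩

/-- A family of loops in the complement of a finite set which contains the small circles around
the points of this set contains all loops. -/
theorem LoopFamily.of_smallCircles (hS : S.Finite) (hH : LoopFamily H) (hsm : SmallCircles S H)
    {q : (Sᶜ : Set ℂ)} (g : PC q q) : H g := by
  obtain ⟨l, rfl⟩ := g.exists_rep
  exact loopsIn_of_smallCircles hS hH hsm isOpen_univ convex_univ q l fun t => mem_univ _

end PuncturedPlane

/-- The group of homotopy classes of loops at a point. -/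
noncomputable instance PC.instGroup {X : Type*} [TopologicalSpace X] (b : X) : Group (PC b b) where
  mul a c := a ⬝ c
  one := Path.Homotopic.Quotient.refl b
  inv a := a.symm
  mul_assoc a c g := Path.Homotopic.Quotient.trans_assoc a c g
  one_mul a := Path.Homotopic.Quotient.refl_trans a
  mul_one a := Path.Homotopic.Quotient.trans_refl a
  inv_mul_cancel a := Path.Homotopic.Quotient.symm_trans a

lemma PC.trans_eq_mul {X : Type*} [TopologicalSpace X] {b : X} (a c : PC b b) : a ⬝ c = a * c := rfl

/-- Loops which are mapped to powers of `γ` form a stable family. -/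
lemma loopFamily_zpow {X Y : Type*} [TopologicalSpace X] [TopologicalSpace Y] (f : C(X, Y)) {b : Y}
    (γ : PC b b) : LoopFamily fun {q : X} (l : PC q q) =>
      ∀ k : PC (f q) b, ∃ n : ℤ, l.map f ⬝ k = k ⬝ γ ^ n where
  refl q k := ⟨0, by
    rw [zpow_zero, PC.map_refl, Path.Homotopic.Quotient.refl_trans]
    exact (Path.Homotopic.Quotient.trans_refl k).symm⟩
  trans {q a c} ha hc k := by
    obtain ⟨n, hn⟩ := ha k
    obtain ⟨m, hm⟩ := hc k
    refine ⟨n + m, ?_⟩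
    rw [PC.map_trans, Path.Homotopic.Quotient.trans_assoc, hm,
      ← Path.Homotopic.Quotient.trans_assoc, hn, Path.Homotopic.Quotient.trans_assoc,
      PC.trans_eq_mul, zpow_add]
  symm {q a} ha k := by
    obtain ⟨n, hn⟩ := ha k
    refine ⟨-n, PC.trans_left_cancel (a := a.map f) ?_⟩
    rw [PC.map_symm, PC.trans_symm_cancel, ← Path.Homotopic.Quotient.trans_assoc, hn,
      Path.Homotopic.Quotient.trans_assoc, PC.trans_eq_mul, zpow_neg, mul_inv_cancel]
    exact (Path.Homotopic.Quotient.trans_refl k).symm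
  conj {q r} a {g} hg k := by
    obtain ⟨n, hn⟩ := hg ((a.map f).symm ⬝ k)
    refine ⟨n, ?_⟩
    rw [PC.map_trans, PC.map_trans, PC.map_symm, Path.Homotopic.Quotient.trans_assoc,
      Path.Homotopic.Quotient.trans_assoc, hn, Path.Homotopic.Quotient.trans_assoc,
      PC.trans_symm_cancel]

section Generator

variable {F : MvPolynomial (Fin 3) ℂ} {e u w : Fin 3 → ℂ} {d : ℕ}

/-- Punctured discs around points of the curve over a closed set of transverse fibres. -/
lemma exists_pDisc_of_isClosed (hF : F.IsHomogeneous d) (he : MvPolynomial.eval e F ≠ 0)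
    (hu : (linePoly F e u).Separable) {S : Set ℂ} (hS : IsClosed S)
    (hsep : ∀ x ∈ S, (fib F e u w x).Separable) :
    ∃ κ : ℝ, 0 < κ ∧ ∀ p : ℂ × ℂ, p.1 ∈ S → (fib F e u w p.1).eval p.2 = 0 → ∀ a : ℂ, a ≠ 0 →
      ‖a‖ ≤ κ → PDisc (PlaneCpl F e u w) (p, a) := by
  obtain ⟨κ, hκ, h⟩ := fib_gap_of_isClosed hF he hu hS hsep
  refine ⟨κ, hκ, fun p hp hp0 a ha0 ha => ⟨ha0, fun ζ hζ0 hζ h0 => ?_⟩⟩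
  have := h p.1 hp p.2 hp0 (p.2 + ζ) h0 (by simpa using hζ0)
  rw [dist_self_add_right] at this
  have h2 : ‖ζ‖ ≤ κ := hζ.trans ha
  nlinarith [norm_nonneg p.1]

/-- Two meridians around points in the same component of the smooth part of the curve are
conjugate. -/
lemma merC_conj (hF : F.IsHomogeneous d) (he : MvPolynomial.eval e F ≠ 0)
    (hu : (linePoly F e u).Separable) {p p' : Crv F e u w} (hj : Joined p p') {a a' : ℂ}
    (h : PDisc (PlaneCpl F e u w) (p.1, a)) (h' : PDisc (PlaneCpl F e u w) (p'.1, a')) :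
    ∃ k, merC F e u w ⟨_, h⟩ ⬝ k = k ⬝ merC F e u w ⟨_, h'⟩ := by
  obtain ⟨Γ⟩ := hj
  obtain ⟨κ, hκ, hd⟩ := exists_pDisc_of_isClosed hF he hu (w := w) (S := range fun t => (Γ t).1.1)
    (isCompact_range (by fun_prop)).isClosed (by rintro _ ⟨t, rfl⟩; exact (Γ t).2.1)
  have hd' : ∀ t, PDisc (PlaneCpl F e u w) ((Γ t).1, (κ : ℂ)) := fun t =>
    hd _ ⟨t, rfl⟩ (Γ t).2.2 _ (by exact_mod_cast hκ.ne') (by simp [abs_of_pos hκ])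
  have h0 := hd' 0
  have h1 := hd' 1
  rw [Γ.source] at h0
  rw [Γ.target] at h1
  obtain ⟨Γ₁, -⟩ := PDisc.exists_path h h0 subset_rfl
  obtain ⟨Γ₃, -⟩ := PDisc.exists_path h1 h' subset_rfl
  let Γ₂ : Path (⟨(p.1, (κ : ℂ)), h0⟩ : {τ // PDisc (PlaneCpl F e u w) τ}) ⟨(p'.1, (κ : ℂ)), h1⟩ :=
    mkPath (fun t => ⟨_, hd' t⟩) (by fun_prop) (by simp) (by simp)
  exact ⟨_, merC_transport ((Γ₁.trans Γ₂).trans Γ₃)⟩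

lemma PC.conj_of_central {X : Type*} [TopologicalSpace X] {x y : X} {m : PC x x} {c : PC y y}
    {a : PC x y} (h : m ⬝ a = a ⬝ c) (hc : ∀ l, c ⬝ l = l ⬝ c) (k : PC x y) : m ⬝ k = k ⬝ c := by
  refine PC.trans_left_cancel (a := a.symm) ?_
  rw [← Path.Homotopic.Quotient.trans_assoc a.symm k c, ← hc, ← PC.conj_eq h]
  simp [Path.Homotopic.Quotient.trans_assoc]

/-- The inclusion of the complement of the curve in a vertical line. -/
noncomputable def lineIncl (F : MvPolynomial (Fin 3) ℂ) (e u w : Fin 3 → ℂ) (x : ℂ) :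
    C(({y | (fib F e u w x).eval y = 0}ᶜ : Set ℂ), Cpl F) :=
  subMap (fun y => pt e u w x y) (by fun_prop)
    fun y => mem_cpl.2 fun h => y.2 ((fib_eval F e u w _ _).trans h)

lemma separable_linePoly_pt {x y : ℂ} (h : (fib F e u w x).Separable) :
    (linePoly F e (pt e u w x y)).Separable := by
  have heq : linePoly F e (pt e u w x y) =
      (fib F e u w x).comp (Polynomial.X + Polynomial.C y) := Polynomial.funext fun t => by
    simp only [Polynomial.eval_comp, fib, linePoly_eval, Polynomial.eval_add, Polynomial.eval_X,
      Polynomial.eval_C, pt]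
    exact congrArg (fun v => MvPolynomial.eval v F) (by module)
  rw [heq, separable_iff_roots] at *
  intro t ht
  have := h (t + y) (by simpa using ht)
  simpa [Polynomial.derivative_comp] using this

/-- The fundamental group of the complement of the cone over a nodal curve is generated by
a meridian. -/
theorem exists_generator (hF : F.IsHomogeneous d) (hd : 1 ≤ d) (hirr : Irreducible F)
    (he : MvPolynomial.eval e F ≠ 0) (hu : (linePoly F e u).Separable)
    (hli : LinearIndependent ℂ ![u, e, w]) (hZ : {x | ¬ (fib F e u w x).Separable}.Finite)
    (hnodal : ∀ p : Fin 3 → ℂ, p ≠ 0 → MvPolynomial.eval p F = 0 →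
      (∀ i, MvPolynomial.eval p (pderiv i F) = 0) → IsOrdinaryNodeAt F p) :
    ∃ τ : {τ // PDisc (PlaneCpl F e u w) τ},
      (fib F e u w τ.1.1.1).Separable ∧ (fib F e u w τ.1.1.1).eval τ.1.1.2 = 0 ∧
      ∀ a : PC (planeIncl F e u w (tip τ)) (planeIncl F e u w (tip τ)),
        ∃ n : ℤ, a = merC F e u w τ ^ n := by
  obtain ⟨x₁, hx₁⟩ := hZ.infinite_compl.nonempty
  have h1 : (fib F e u w x₁).Separable := not_not.1 hx₁
  obtain ⟨τ, hτ1, hτ0, hcent⟩ := exists_central_meridian hF hd he hu hli hZ hnodal h1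
  obtain ⟨⟨⟨x, y⟩, ζ⟩, hτ⟩ := τ
  obtain rfl : x = x₁ := hτ1
  refine ⟨⟨((x, y), ζ), hτ⟩, h1, hτ0, ?_⟩
  set τ₁ : {τ // PDisc (PlaneCpl F e u w) τ} := ⟨((x, y), ζ), hτ⟩
  intro a
  set γ := merC F e u w τ₁
  have hS : {y | (fib F e u w x).eval y = 0}.Finite := finite_roots_fib hF he x
  have hmer : ∀ (s b : ℂ) (hs : (fib F e u w x).eval s = 0) (h : PDisc (PlaneCpl F e u w) ((x, s),
      b))
      (k : PC (planeIncl F e u w (tip ⟨_, h⟩)) (planeIncl F e u w (tip τ₁))),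
      merC F e u w ⟨_, h⟩ ⬝ k = k ⬝ γ := by
    intro s b hs h k
    obtain ⟨k₀, hk₀⟩ := merC_conj hF he hu
      (joined_curve hF hd hirr he hli hZ ⟨(x, s), h1, hs⟩ ⟨(x, y), h1, hτ0⟩) h hτ
    exact PC.conj_of_central hk₀ hcent k
  have hsm : SmallCircles {y | (fib F e u w x).eval y = 0}
      fun {q} l => ∀ k : PC (lineIncl F e u w x q) (planeIncl F e u w (tip τ₁)),
        ∃ n : ℤ, l.map (lineIncl F e u w x) ⬝ k = k ⬝ γ ^ n := by
    obtain ⟨κ, hκ, hdisc⟩ := exists_pDisc_of_isClosed hF he hu (w := w) (isClosed_singleton (x :=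
        x))
      (by rintro _ rfl; exact h1)
    rintro s hs
    refine ⟨κ, hκ, ?_⟩
    rintro b h ⟨q, hq'⟩ hq hb k
    obtain rfl : q = s + b := hq
    have hb0 : b ≠ 0 := by
      rintro rfl
      rw [add_zero] at hq'
      exact hq' hs
    have hD := hdisc (x, s) rfl hs b hb0 hb.le
    refine ⟨1, ?_⟩
    rw [zpow_one]
    refine Eq.trans ?_ (hmer s b hs hD k)
    congr 1
    refine congrArg cls (Path.ext (funext fun t => Subtype.ext ?_))
    show pt e u w x (s + b * Complex.exp (2 * Real.pi * Complex.I * (((1 : ℤ) * (t : ℝ) : ℝ) : ℂ)))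
        =
      pt e u w x (s + b * Complex.exp (2 * Real.pi * Complex.I * (t : ℝ)))
    simp
  obtain ⟨δ, hg', rfl⟩ := exists_line_rep hF he (planeIncl F e u w (tip τ₁))
    (separable_linePoly_pt h1) a
  choose g hg using hg'
  have he0 : e ≠ 0 := hli.ne_zero 1
  obtain ⟨i, hi⟩ := Function.ne_iff.1 he0
  have hgc : Continuous g := by
    have : g = fun t => ((δ t : Fin 3 → ℂ) i - (planeIncl F e u w (tip τ₁) : Fin 3 → ℂ) i) / e i :=
        by
      funext t
      rw [hg t]
      have : e i ≠ 0 := hi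
      simp [this]
    rw [this]
    exact (((continuous_apply i).comp (continuous_subtype_val.comp δ.continuous)).sub
      continuous_const).div_const _
  have hδ : ∀ t, (δ t : Fin 3 → ℂ) = pt e u w x (y + ζ + g t) := fun t => by
    rw [hg t]
    show pt e u w x (y + ζ) + g t • e = _
    simp only [pt]
    module
  have hmem : ∀ t, y + ζ + g t ∈ {y | (fib F e u w x).eval y = 0}ᶜ := fun t h => by
    refine mem_cpl.1 (δ t).2 ?_
    rw [hδ t]
    exact (fib_eval F e u w _ _).symm.trans h
  have hinj : ∀ t, (δ t) = planeIncl F e u w (tip τ₁) → g t = 0 := fun t h => by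
    have := hg t
    rw [h, left_eq_add, smul_eq_zero] at this
    exact this.resolve_right he0
  let q : ({y | (fib F e u w x).eval y = 0}ᶜ : Set ℂ) := ⟨y + ζ, (tip τ₁).2⟩
  let l : Path q q := mkPath (fun t => ⟨_, hmem t⟩) (by fun_prop)
    (Subtype.ext (by simp [q, hinj 0 δ.source])) (Subtype.ext (by simp [q, hinj 1 δ.target]))
  obtain ⟨n, hn⟩ := (loopFamily_zpow (lineIncl F e u w x) γ).of_smallCircles hS hsm (cls l)
    (Path.Homotopic.Quotient.refl _)
  refine ⟨n, ?_⟩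
  have h2 : (cls l).map (lineIncl F e u w x) = cls δ :=
    congrArg cls (Path.ext (funext fun t => Subtype.ext (hδ t).symm))
  have h3 := (Path.Homotopic.Quotient.trans_refl _).symm.trans
    (hn.trans (Path.Homotopic.Quotient.refl_trans _))
  exact h2.symm.trans h3

end Generator

section Winding

/-- The exponential function as a covering map of the punctured plane. -/
noncomputable def expCover (z : ℂ) : {z : ℂ // z ≠ 0} := ⟨Complex.exp z, Complex.exp_ne_zero z⟩

lemma isCoveringMap_expCover : IsCoveringMap expCover := Complex.isCoveringMap_exp

lemma expCover_eq_iff {z z' : ℂ} : expCover z = expCover z' ↔ Complex.exp z = Complex.exp z' :=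
  Subtype.ext_iff

variable {X : Type*} [TopologicalSpace X] (f : C(X, {z : ℂ // z ≠ 0}))

/-- The logarithm of `f` can be continued along `γ` and increases by `δ`. -/
def IsLogIncrement {x y : X} (γ : Path x y) (δ : ℂ) : Prop :=
  ∃ (z z' : ℂ) (Γ : Path z z'), (∀ t, expCover (Γ t) = f (γ t)) ∧ z' - z = δ

variable {f} {x y : X}

/-- Adding a constant to a path of logarithms. -/
lemma exists_shift {γ : Path x y} {z z' : ℂ} (Γ : Path z z') (hΓ : ∀ t, expCover (Γ t) = f (γ t))
    {z₁ : ℂ} (hz₁ : expCover z₁ = f x) :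
    ∃ Γ' : Path z₁ (z' + (z₁ - z)), ∀ t, expCover (Γ' t) = f (γ t) := by
  refine ⟨mkPath (fun t => Γ t + (z₁ - z)) (by fun_prop) (by simp) (by simp), fun t => ?_⟩
  have h0 := hΓ 0
  rw [Γ.source, γ.source, ← hz₁, expCover_eq_iff] at h0
  rw [← hΓ t, expCover_eq_iff, mkPath_apply, Complex.exp_add, Complex.exp_sub, h0,
    div_self (Complex.exp_ne_zero _), mul_one]

lemma exists_expCover_eq (x : X) : ∃ z, expCover z = f x :=
  ⟨Complex.log (f x), Subtype.ext (Complex.exp_log (f x).2)⟩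

variable (f) in
lemma exists_isLogIncrement (γ : Path x y) : ∃ δ, IsLogIncrement f γ δ := by
  obtain ⟨z, hz⟩ := exists_expCover_eq (f := f) x
  obtain ⟨z', Γ, hΓ⟩ := exists_path_lift isCoveringMap_expCover (γ.map f.continuous) hz
  exact ⟨_, z, z', Γ, hΓ, rfl⟩

lemma IsLogIncrement.unique {γ γ' : Path x y} (h : cls γ = cls γ') {δ δ' : ℂ}
    (hγ : IsLogIncrement f γ δ) (hγ' : IsLogIncrement f γ' δ') : δ = δ' := by
  obtain ⟨z, z', Γ, hΓ, rfl⟩ := hγ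
  obtain ⟨z₁, z₁', Γ₁, hΓ₁, rfl⟩ := hγ'
  obtain ⟨Γ₂, hΓ₂⟩ := exists_shift Γ₁ hΓ₁ (z₁ := z) (by simpa using hΓ 0)
  have := lift_endpoint_eq isCoveringMap_expCover (γ := γ.map f.continuous)
    (γ' := γ'.map f.continuous) (congrArg (fun a => Path.Homotopic.Quotient.map a f) h) Γ Γ₂ hΓ hΓ₂
  rw [this]
  ring

variable (f) in
/-- The increment of the logarithm of `f` along a homotopy class of paths. -/
noncomputable def wind (a : PC x y) : ℂ := (exists_isLogIncrement f a.exists_rep.choose).choose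

lemma isLogIncrement_wind (γ : Path x y) : IsLogIncrement f γ (wind f (cls γ)) := by
  obtain ⟨δ, hδ⟩ := exists_isLogIncrement f γ
  have h := (exists_isLogIncrement f (cls γ).exists_rep.choose).choose_spec
  rw [← IsLogIncrement.unique (cls γ).exists_rep.choose_spec h hδ] at hδ
  exact hδ

lemma IsLogIncrement.wind_eq {γ : Path x y} {δ : ℂ} (h : IsLogIncrement f γ δ) :
    wind f (cls γ) = δ :=
  IsLogIncrement.unique rfl (isLogIncrement_wind γ) h

lemma wind_trans {z : X} (a : PC x y) (b : PC y z) : wind f (a ⬝ b) = wind f a + wind f b := by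
  obtain ⟨γ, rfl⟩ := a.exists_rep
  obtain ⟨γ', rfl⟩ := b.exists_rep
  obtain ⟨z, z', Γ, hΓ, h⟩ := isLogIncrement_wind (f := f) γ
  obtain ⟨z₁, z₁', Γ₁, hΓ₁, h₁⟩ := isLogIncrement_wind (f := f) γ'
  obtain ⟨Γ₂, hΓ₂⟩ := exists_shift Γ₁ hΓ₁ (z₁ := z') (by simpa using hΓ 1)
  rw [← h, ← h₁, ← cls_trans]
  refine IsLogIncrement.wind_eq ⟨_, _, Γ.trans Γ₂, fun t => ?_, by ring⟩
  refine (lifts_trans (γ := γ.map f.continuous) (γ' := γ'.map f.continuous) hΓ hΓ₂ t).trans ?_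
  rw [← Path.map_trans]
  rfl

lemma wind_zpow (a : PC x x) (n : ℤ) : wind f (a ^ n) = n * wind f a := by
  let φ : PC x x →* Multiplicative ℂ :=
    MonoidHom.mk' (fun a => Multiplicative.ofAdd (wind f a)) fun a b => wind_trans a b
  exact (congrArg Multiplicative.toAdd (map_zpow φ a n)).trans (zsmul_eq_mul (wind f a) n)

lemma wind_eq_of_conj {a : PC x x} {b : PC y y} {k : PC x y} (h : a ⬝ k = k ⬝ b) :
    wind f a = wind f b := by
  have := congrArg (wind f) h
  rw [wind_trans, wind_trans, add_comm] at this
  exact add_left_cancel this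

lemma exists_lift_of_eq_one {γ : Path x y} (hx : (f x : ℂ) = 1) :
    ∃ Γ : Path 0 (wind f (cls γ)), ∀ t, expCover (Γ t) = f (γ t) := by
  obtain ⟨z, z', Γ, hΓ, h⟩ := isLogIncrement_wind (f := f) γ
  obtain ⟨Γ₂, hΓ₂⟩ := exists_shift Γ hΓ (z₁ := 0) (Subtype.ext (by simp [expCover, hx]))
  exact ⟨Γ₂.cast rfl (by rw [← h]; ring), hΓ₂⟩

end Winding

section Meridian

variable {F : MvPolynomial (Fin 3) ℂ} {e u w : Fin 3 → ℂ} {d : ℕ}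

variable (F) in
/-- The polynomial function `F` on the complement of its zero set. -/
noncomputable def evalCpl : C(Cpl F, {z : ℂ // z ≠ 0}) :=
  ⟨fun v => ⟨MvPolynomial.eval (v : Fin 3 → ℂ) F, v.2⟩, Continuous.subtype_mk
    ((MvPolynomial.continuous_eval F).comp continuous_subtype_val) _⟩

/-- The winding number of the polynomial along a meridian is one. -/
lemma wind_merC (τ : {τ // PDisc (PlaneCpl F e u w) τ}) (hsep : (fib F e u w τ.1.1.1).Separable)
    (h0 : (fib F e u w τ.1.1.1).eval τ.1.1.2 = 0) :
    wind (evalCpl F) (merC F e u w τ) = 2 * Real.pi * Complex.I := by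
  obtain ⟨⟨⟨x, y⟩, ζ⟩, hτ⟩ := τ
  obtain ⟨g, hg⟩ := Polynomial.dvd_iff_isRoot.2 h0
  have hgy : g.eval y ≠ 0 := by
    have := separable_iff_roots.1 hsep y h0
    simp only at hg
    rw [hg] at this
    simpa using this
  have hslit : ∀ᶠ z in 𝓝 (0 : ℂ), g.eval (y + z) / g.eval y ∈ Complex.slitPlane := by
    have hc : Continuous fun z => g.eval (y + z) / g.eval y := by fun_prop
    refine hc.continuousAt.eventually (Complex.isOpen_slitPlane.mem_nhds ?_)
    simp [hgy]
  obtain ⟨ρ, hρ, hs⟩ := Metric.eventually_nhds_iff.1 hslit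
  obtain ⟨b, hb0, hb⟩ : ∃ b : ℝ, 0 < b ∧ b < min ρ ‖ζ‖ :=
    exists_between (lt_min hρ (norm_pos_iff.2 hτ.1))
  have hbn : ‖(b : ℂ)‖ = b := by simp [abs_of_pos hb0]
  have hb0' : (b : ℂ) ≠ 0 := by exact_mod_cast hb0.ne'
  have hτ' : PDisc (PlaneCpl F e u w) ((x, y), (b : ℂ)) :=
    hτ.of_le hb0' (hbn.trans_le (hb.le.trans (min_le_right _ _)))
  obtain ⟨Γ, -⟩ := PDisc.exists_path hτ hτ' subset_rfl
  refine (wind_eq_of_conj (merC_transport Γ)).trans ?_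
  have hcirc : ∀ t : I, g.eval (y + b * Complex.exp (2 * Real.pi * Complex.I * (t : ℝ))) / g.eval y
      ∈
      Complex.slitPlane := fun t => hs (by
    have : 2 * Real.pi * Complex.I * (t : ℝ) = ((2 * Real.pi * t : ℝ) : ℂ) * Complex.I := by
      push_cast; ring
    rw [dist_zero_right, norm_mul, this, Complex.norm_exp_ofReal_mul_I, mul_one, hbn]
    exact hb.trans_le (min_le_left _ _))
  let L : I → ℂ := fun t => Complex.log b + 2 * Real.pi * Complex.I * (t : ℝ) +
    Complex.log (g.eval y) +
    Complex.log (g.eval (y + b * Complex.exp (2 * Real.pi * Complex.I * (t : ℝ))) / g.eval y)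
  have hL : Continuous L := by
    refine Continuous.add (by fun_prop) (Continuous.clog (by fun_prop) hcirc)
  refine IsLogIncrement.wind_eq (γ := (mer ⟨((x, y), (b : ℂ)), hτ'⟩).map
    (planeIncl F e u w).continuous) ⟨L 0, L 1, mkPath L hL rfl rfl, fun t => Subtype.ext ?_, ?_⟩
  · show Complex.exp (L t) = MvPolynomial.eval
      (pt e u w x (y + b * Complex.exp (2 * Real.pi * Complex.I * (t : ℝ)))) F
    rw [← fib_eval, show fib F e u w x = _ from hg]
    simp only [L, Complex.exp_add]
    rw [Complex.exp_log hb0', Complex.exp_log hgy,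
      Complex.exp_log (Complex.slitPlane_ne_zero (hcirc t))]
    simp
    field_simp
  · simp [L]

end Meridian

section MilnorFiber

variable {F : MvPolynomial (Fin 3) ℂ} {d : ℕ}

lemma eval_exp_smul (hF : F.IsHomogeneous d) (hd : 1 ≤ d) {v : Fin 3 → ℂ} {z : ℂ}
    (hz : Complex.exp z = MvPolynomial.eval v F) :
    MvPolynomial.eval (Complex.exp (-z / d) • v) F = 1 := by
  have hd0 : (d : ℂ) ≠ 0 := by exact_mod_cast (by omega : d ≠ 0)
  rw [eval_smul_of_homogeneous hF, ← Complex.exp_nat_mul, mul_div_cancel₀ _ hd0, ← hz,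
    ← Complex.exp_add, neg_add_cancel, Complex.exp_zero]

lemma joined_cpl (x y : Cpl F) : Joined x y := by
  obtain ⟨γ, -⟩ := JoinedIn.exists_subtype_path (U := Cpl F)
    (S := univ \ {v | MvPolynomial.eval v F = 0})
    (fun v hv => hv.2) ((thin_zeros F).joinedIn isOpen_univ convex_univ (mem_univ _) (mem_univ _)
      x.2 y.2)
  exact ⟨γ⟩

variable (F) in
/-- The inclusion of the Milnor fibre in the complement of the cone over the curve. -/
noncomputable def fiberIncl : C({p : Fin 3 → ℂ // MvPolynomial.eval p F = 1}, Cpl F) :=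
  subMap (fun p => p.1) (by fun_prop) fun p => by simp [p.2]

lemma coe_fiberIncl (p : {p : Fin 3 → ℂ // MvPolynomial.eval p F = 1}) :
    (fiberIncl F p : Fin 3 → ℂ) = p := rfl

/-- The fundamental group of the complement of the cone is generated by a loop of winding number
one. -/
def HasGenerator (F : MvPolynomial (Fin 3) ℂ) : Prop :=
  ∃ (b : Cpl F) (γ : PC b b), wind (evalCpl F) γ = 2 * Real.pi * Complex.I ∧
    ∀ a : PC b b, ∃ n : ℤ, a = γ ^ n

theorem pathConnected_fiber (hF : F.IsHomogeneous d) (hd : 1 ≤ d)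
    (hne : ∃ e, MvPolynomial.eval e F ≠ 0) (hgen : HasGenerator F) :
    PathConnectedSpace {p : Fin 3 → ℂ // MvPolynomial.eval p F = 1} := by
  refine ⟨?_, fun p q => ?_⟩
  · obtain ⟨e, he⟩ := hne
    exact ⟨⟨_, eval_exp_smul hF hd (Complex.exp_log he)⟩⟩
  obtain ⟨b, γ, hγ, -⟩ := hgen
  obtain ⟨a⟩ := joined_cpl (fiberIncl F p) (fiberIncl F q)
  obtain ⟨k⟩ := joined_cpl (fiberIncl F p) b
  have hp : (evalCpl F (fiberIncl F p) : ℂ) = 1 := p.2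
  obtain ⟨n, hn⟩ : ∃ n : ℤ, wind (evalCpl F) (cls a) = n * (2 * Real.pi * Complex.I) := by
    obtain ⟨Γ, hΓ⟩ := exists_lift_of_eq_one (γ := a) hp
    refine Complex.exp_eq_one_iff.1 ?_
    have := congrArg Subtype.val (hΓ 1)
    rw [Γ.target, a.target] at this
    exact this.trans q.2
  obtain ⟨α, hα⟩ := (cls k ⬝ γ ^ (-n) ⬝ (cls k).symm ⬝ cls a).exists_rep
  have hw : wind (evalCpl F) (cls α) = 0 := by
    have h1 : wind (evalCpl F) (cls k) + wind (evalCpl F) (cls k).symm = 0 := by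
      have := wind_zpow (f := evalCpl F) (1 : PC (fiberIncl F p) (fiberIncl F p)) 0
      rw [zpow_zero, Int.cast_zero, zero_mul] at this
      rw [← wind_trans, Path.Homotopic.Quotient.trans_symm]
      exact this
    refine (congrArg (wind (evalCpl F)) hα).trans ?_
    rw [wind_trans, wind_trans, wind_trans, wind_zpow, hγ, hn]
    push_cast
    linear_combination h1
  obtain ⟨Γ, hΓ⟩ := exists_lift_of_eq_one (γ := α) hp
  refine ⟨mkPath (fun t => ⟨_, eval_exp_smul hF hd (congrArg Subtype.val (hΓ t))⟩) ?_ ?_ ?_⟩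
  · fun_prop
  · refine Subtype.ext ?_
    simp only [Γ.source, α.source, coe_fiberIncl, neg_zero, zero_div,
      Complex.exp_zero, one_smul]
  · refine Subtype.ext ?_
    simp only [Γ.target, hw, α.target, coe_fiberIncl, neg_zero, zero_div,
      Complex.exp_zero, one_smul]

theorem nullhomotopic_fiber (hF : F.IsHomogeneous d) (hd : 1 ≤ d) (hgen : HasGenerator F)
    {p : {p : Fin 3 → ℂ // MvPolynomial.eval p F = 1}} (α : Path p p) :
    Path.Homotopic α (Path.refl p) := by
  obtain ⟨b, γ, hγ, hall⟩ := hgen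
  obtain ⟨k⟩ := joined_cpl (fiberIncl F p) b
  have hp : (evalCpl F (fiberIncl F p) : ℂ) = 1 := p.2
  obtain ⟨n, hn⟩ := hall ((cls k).symm ⬝ (cls α).map (fiberIncl F) ⬝ cls k)
  have hconj : (cls α).map (fiberIncl F) ⬝ cls k = cls k ⬝ γ ^ n := PC.eq_of_conj_eq hn
  have hw : wind (evalCpl F) ((cls α).map (fiberIncl F)) = 0 :=
    IsLogIncrement.wind_eq (γ := α.map (fiberIncl F).continuous)
      ⟨0, 0, Path.refl 0, fun t => Subtype.ext (by
        have : MvPolynomial.eval (α t : Fin 3 → ℂ) F = 1 := (α t).2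
        exact Complex.exp_zero.trans this.symm), sub_zero 0⟩
  have hn0 : n = 0 := by
    have := wind_eq_of_conj (f := evalCpl F) hconj
    rw [hw, wind_zpow, hγ] at this
    have h2 := mul_eq_zero.1 this.symm
    exact_mod_cast h2.resolve_right Complex.two_pi_I_ne_zero
  have hnull : cls (α.map (fiberIncl F).continuous) = cls (Path.refl (fiberIncl F p)) := by
    refine PC.trans_right_cancel (a := cls k) (hconj.trans ?_)
    rw [hn0, zpow_zero, cls_refl, Path.Homotopic.Quotient.refl_trans]
    exact Path.Homotopic.Quotient.trans_refl _
  obtain ⟨H⟩ := cls_eq.1 hnull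
  let K : C(I × I, {z : ℂ // z ≠ 0}) := (evalCpl F).comp H.toContinuousMap
  have hK0 : ∀ t, K (0, t) = expCover (ContinuousMap.const I (0 : ℂ) t) := fun t => by
    refine Subtype.ext ?_
    have h1 : H (0, t) = fiberIncl F (α t) := H.apply_zero t
    have h2 : MvPolynomial.eval (α t : Fin 3 → ℂ) F = 1 := (α t).2
    refine (congrArg (fun v => (evalCpl F v : ℂ)) h1).trans (h2.trans Complex.exp_zero.symm)
  set L := isCoveringMap_expCover.liftHomotopy K (ContinuousMap.const I (0 : ℂ)) hK0
  have hL : ∀ z, expCover (L z) = evalCpl F (H z) :=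
    congrFun (isCoveringMap_expCover.liftHomotopy_lifts K _ hK0)
  have hL0 : ∀ t, L (0, t) = 0 := isCoveringMap_expCover.liftHomotopy_zero K _ hK0
  have hconst : ∀ g : C(I, I × I), (∀ s, H (g s) = fiberIncl F p) → ∀ s, L (g s) = L (g 0) :=
    fun g hg s => isCoveringMap_expCover.const_of_comp (g := fun s => L (g s)) (by fun_prop)
      (fun s s' => by rw [hL, hL, hg, hg]) s 0
  have hl : ∀ s, L (s, 0) = 0 := fun s =>
    (hconst ⟨fun s => (s, 0), by fun_prop⟩ (fun s => H.source s) s).trans (hL0 0)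
  have hr : ∀ s, L (s, 1) = 0 := fun s =>
    (hconst ⟨fun s => (s, 1), by fun_prop⟩ (fun s => H.target s) s).trans (hL0 1)
  have h1 : ∀ t, L (1, t) = 0 := fun t =>
    (hconst ⟨fun t => (1, t), by fun_prop⟩ (fun t => H.apply_one t) t).trans (hl 1)
  refine cls_eq.1 (cls_eq_of_homotopy
    (fun z => ⟨_, eval_exp_smul hF hd (congrArg Subtype.val (hL z.swap))⟩) ?_ ?_ ?_ ?_ ?_)
  · have : Continuous fun z : I × I => (H z.swap : Fin 3 → ℂ) := by fun_prop
    fun_prop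
  all_goals intro t; refine Subtype.ext ?_
  · simp [hL0, coe_fiberIncl]
  · simp [h1, coe_fiberIncl]
  · simp [hl, coe_fiberIncl]
  · simp [hr, coe_fiberIncl]

end MilnorFiber

end MilnorNodal

/-- If `f_d` is an irreducible homogeneous polynomial of degree `d ≥ 1` all of whose projective
singular points are ordinary nodes, then the global Milnor fiber `{f_d = 1} ⊂ ℂ³` is simply
connected. -/
theorem milnor_fiber_of_nodal_curve_simply_connected
    (d : ℕ) (hd : 1 ≤ d) (fd : MvPolynomial (Fin 3) ℂ)
    (hhom : fd.IsHomogeneous d) (hirr : Irreducible fd)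
    (hnodal : ∀ p : Fin 3 → ℂ, p ≠ 0 → eval p fd = 0 →
      (∀ i, eval p (pderiv i fd) = 0) → IsOrdinaryNodeAt fd p) :
    SimplyConnectedSpace {p : Fin 3 → ℂ // eval p fd = 1} := by
  obtain ⟨u, e, w, he, hu, hli, hZ⟩ := MilnorNodal.exists_coordinates hhom hd hirr
  obtain ⟨τ, hsep, h0, hall⟩ := MilnorNodal.exists_generator hhom hd hirr he hu hli hZ hnodal
  have hgen : MilnorNodal.HasGenerator fd := ⟨_, MilnorNodal.merC fd e u w τ,
    MilnorNodal.wind_merC τ hsep h0, hall⟩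
  exact simply_connected_iff_loops_nullhomotopic.2
    ⟨MilnorNodal.pathConnected_fiber hhom hd ⟨e, he⟩ hgen,
      fun _ => MilnorNodal.nullhomotopic_fiber hhom hd hgen⟩
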